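/- Let X be a Lévy process with E[e^{iθX_t}] = e^{−tΨ(θ)} for all θ ∈ ℝ, t ≥ 0, where Ψ is the General Hypergeometric characteristic exponent with parameters β > 0, c_i > 0, γ_i ∈ (−∞,0) ∪ (0,1), 1 − α_i + γ_i > 0, δ_i ≥ 0, k_i ≥ 0 with k₁k₂ = 0 (i = 1,2), and d, σ ∈ ℝ. Fix q > 0 and let (ξₙ⁻)_{n≥0} be the negative-imaginary-axis roots: q + Ψ(iξₙ⁻) = 0 with ξ₀⁻ ∈ (−β(1+γ₁−α₁), 0) and ξₙ⁻ ∈ (−β(1+γ₁−α₁+n), −β(γ₁−α₁+n)) for n ≥ 1. Define c₀⁻ = Π_{n≥1} (1 + ξ₀⁻/(β(γ₁−α₁+n)))/(1 − ξ₀⁻/ξₙ⁻) and, for k ≥ 1, c_k⁻ = [(1 + ξ_k⁻/(β(γ₁−α₁+k)))/(1 − ξ_k⁻/ξ₀⁻)] · Π_{n≥1, n≠k} (1 + ξ_k⁻/(β(γ₁−α₁+n)))/(1 − ξ_k⁻/ξₙ⁻); these infinite products converge. Let e be an exponential random variable with rate q independent of X. Then for every Borel set A ⊆ (0,∞), ℙ(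 sup_{0≤s≤e} X_s ∈ A ) = ∫_A ( − Σ_{k≥0} c_k⁻ ξ_k⁻ e^{ξ_k⁻ x} ) dx. -/

import Mathlib

open MeasureTheory ProbabilityTheory Set

noncomputable section

/-- A real-valued Lévy process on a probability space `(Ω, ℱ, P)`. -/
structure IsLevyProcess {Ω : Type*} [MeasurableSpace Ω] (P : Measure Ω)
    (X : ℝ → Ω → ℝ) : Prop where
  measurable : ∀ t : ℝ, Measurable (X t)
  init : ∀ᵐ ω ∂P, X 0 ω = 0
  cadlag : ∀ᵐ ω ∂P, (∀ t : ℝ, 0 ≤ t →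
      ContinuousWithinAt (fun s => X s ω) (Ici t) t) ∧
      (∀ t : ℝ, 0 < t → ∃ l : ℝ,
        Filter.Tendsto (fun s => X s ω) (nhdsWithin t (Ico 0 t)) (nhds l))
  stationary : ∀ s t : ℝ, 0 ≤ s → 0 ≤ t →
      Measure.map (fun ω => X (t + s) ω - X t ω) P = Measure.map (X s) P
  indep_past : ∀ t : ℝ, 0 ≤ t →
      IndepFun (fun ω => (fun u : Icc (0 : ℝ) t => X u ω))
        (fun ω => (fun s : {s : ℝ // 0 ≤ s} => X (t + s) ω - X t ω)) P

/-- The Beta function `B(x,y) = Γ(x)Γ(y)/Γ(x+y)` built from the complex Gamma function. -/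
def cBeta (x y : ℂ) : ℂ := Complex.Gamma x * Complex.Gamma y / Complex.Gamma (x + y)

/-- The Laplace exponent `Φ(z) = k + δz + (c/β){B(1−α+γ, −γ) − B(1−α+γ+z/β, −γ)}`
of a β-class subordinator, as a function of a complex variable. -/
def betaSubLaplaceExponent (k δ c α β γ : ℝ) (z : ℂ) : ℂ :=
  (k : ℂ) + (δ : ℂ) * z
    + (c / β : ℂ) * (cBeta ((1 - α + γ : ℝ) : ℂ) ((-γ : ℝ) : ℂ)
        - cBeta (((1 - α + γ : ℝ) : ℂ) + z / β) ((-γ : ℝ) : ℂ))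

/-- The General Hypergeometric characteristic exponent
`Ψ(z) = d i z + σ²z²/2 + Φ₁(−iz)Φ₂(iz)`. -/
def GHExponent (d σ k₁ δ₁ c₁ α₁ γ₁ k₂ δ₂ c₂ α₂ γ₂ β : ℝ) (z : ℂ) : ℂ :=
  (d : ℂ) * Complex.I * z + (σ : ℂ) ^ 2 * z ^ 2 / 2
    + betaSubLaplaceExponent k₁ δ₁ c₁ α₁ β γ₁ (-(Complex.I) * z)
        * betaSubLaplaceExponent k₂ δ₂ c₂ α₂ β γ₂ (Complex.I * z)

open Complex in
/-- A continuous function on `ℂ` that is holomorphic off the imaginary axis is entire. -/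
lemma differentiable_of_off_imaginary_axis {F : ℂ → ℂ} (hc : Continuous F)
    (hd : ∀ s : ℂ, s.re ≠ 0 → DifferentiableAt ℂ F s) : Differentiable ℂ F := by
  have key : ∀ z w : ℂ, w.re = 0 →
      (∫ x : ℝ in z.re..w.re, F (x + z.im * I)) - (∫ x : ℝ in z.re..w.re, F (x + w.im * I)) +
      I • (∫ y : ℝ in z.im..w.im, F (re w + y * I)) -
      I • (∫ y : ℝ in z.im..w.im, F (re z + y * I)) = 0 := by
    intro z w hw
    refine integral_boundary_rect_eq_zero_of_continuousOn_of_differentiableOn F z w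
      hc.continuousOn ?_
    intro s hs
    refine (hd s ?_).differentiableWithinAt
    have := hs.1
    simp only [mem_preimage, mem_Ioo, hw] at this
    intro h0
    rw [h0] at this
    rcases le_total z.re 0 with h | h
    · rw [max_eq_right h] at this; exact lt_irrefl _ this.2
    · rw [min_eq_right h] at this; exact lt_irrefl _ this.1
  have hcons : IsConservativeOn F univ := by
    intro z w _
    rw [← add_eq_zero_iff_eq_neg, wedgeIntegral_add_wedgeIntegral_eq]
    have h1 := key z ⟨0, w.im⟩ rfl
    have h2 := key w ⟨0, z.im⟩ rfl
    have ii : ∀ (b : ℝ) (p r : ℝ), IntervalIntegrable (fun x : ℝ => F (x + b * I)) volume p r :=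
      fun b p r => (by fun_prop : Continuous fun x : ℝ => F (x + b * I)).intervalIntegrable _ _
    have e1 := intervalIntegral.integral_add_adjacent_intervals (ii z.im z.re 0) (ii z.im 0 w.re)
    have e2 := intervalIntegral.integral_add_adjacent_intervals (ii w.im z.re 0) (ii w.im 0 w.re)
    rw [← e1, ← e2]
    have s1 := intervalIntegral.integral_symm (μ := volume) (f := fun x : ℝ => F (x + z.im * I)) w.re 0
    have s2 := intervalIntegral.integral_symm (μ := volume) (f := fun x : ℝ => F (x + w.im * I)) w.re 0
    have s3 := intervalIntegral.integral_symm (μ := volume) (f := fun x : ℝ => F ((0:ℝ) + x * I)) z.im w.im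
    have s4 := intervalIntegral.integral_symm (μ := volume) (f := fun x : ℝ => F (w.re + x * I)) z.im w.im
    simp only [smul_eq_mul] at *
    rw [s1, s2]
    rw [s3, s4] at h2
    linear_combination h1 + h2
  have := (IsConservativeOn.isExactOn_univ hc hcons).differentiableOn isOpen_univ
  exact differentiableOn_univ.mp this

/-- An entire function whose growth is polynomial up to a factor `|Im s| ^ (-2)` has
polynomial growth. -/
lemma norm_le_of_norm_mul_im_sq_le {F : ℂ → ℂ} (hF : Differentiable ℂ F) {C : ℝ} {k : ℕ}
    (hb : ∀ s : ℂ, ‖F s‖ * s.im ^ 2 ≤ C * (1 + ‖s‖) ^ k) {R : ℝ} (hR : 1 ≤ R) {s : ℂ}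
    (hs : ‖s‖ ≤ R / 2) : ‖F s‖ ≤ 8 * C * (1 + R) ^ k := by
  have hC : 0 ≤ C := by
    have := hb 0
    simpa using this
  set g : ℂ → ℂ := fun z => F z * (z ^ 2 - (R : ℂ) ^ 2) ^ 2 with hg
  have hgd : Differentiable ℂ g := by fun_prop
  have hR0 : 0 < R := by linarith
  have hfr : ∀ z ∈ frontier (Metric.ball (0 : ℂ) R), ‖g z‖ ≤ 4 * R ^ 2 * (C * (1 + R) ^ k) := by
    intro z hz
    rw [frontier_ball _ hR0.ne', mem_sphere_zero_iff_norm] at hz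
    have h1 : z ^ 2 - (R : ℂ) ^ 2 = 2 * Complex.I * z * (z.im : ℂ) := by
      have : (R : ℂ) ^ 2 = z * (starRingEnd ℂ) z := by
        rw [Complex.mul_conj, Complex.normSq_eq_norm_sq, hz]; push_cast; ring
      rw [this]
      apply Complex.ext <;> simp [pow_two] <;> ring
    have h2 : ‖z ^ 2 - (R : ℂ) ^ 2‖ ^ 2 = 4 * R ^ 2 * z.im ^ 2 := by
      rw [h1]; simp only [norm_mul, Complex.norm_I, Complex.norm_ofNat, hz, Complex.norm_real,
        Real.norm_eq_abs, mul_pow, sq_abs]; ring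
    rw [hg]; simp only [norm_mul, norm_pow, h2]
    have := hb z
    rw [hz] at this
    nlinarith [sq_nonneg R]
  have hm := Complex.norm_le_of_forall_mem_frontier_norm_le Metric.isBounded_ball
    hgd.diffContOnCl hfr (z := s) (subset_closure (by simp; linarith))
  have h3 : 3 / 4 * R ^ 2 ≤ ‖s ^ 2 - (R : ℂ) ^ 2‖ := by
    have := norm_sub_norm_le ((R : ℂ) ^ 2) (s ^ 2)
    rw [norm_sub_rev] at this
    simp only [norm_pow, Complex.norm_real, Real.norm_of_nonneg hR0.le] at this
    nlinarith [norm_nonneg s]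
  rw [hg] at hm; simp only [norm_mul, norm_pow] at hm
  have h4 : (3 / 4 * R ^ 2) ^ 2 ≤ ‖s ^ 2 - (R : ℂ) ^ 2‖ ^ 2 := by gcongr
  have h5 : ‖F s‖ * (3 / 4 * R ^ 2) ^ 2 ≤ 4 * R ^ 2 * (C * (1 + R) ^ k) :=
    le_trans (by gcongr) hm
  have h6 : 0 ≤ C * (1 + R) ^ k := by positivity
  have h7 : ‖F s‖ * (9 / 16 * R ^ 2) ≤ 4 * (C * (1 + R) ^ k) := by
    have : 0 < R ^ 2 := by positivity
    nlinarith
  have h8 : 1 ≤ R ^ 2 := by nlinarith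
  have h9 : ‖F s‖ * (9 / 16) ≤ ‖F s‖ * (9 / 16 * R ^ 2) := by
    gcongr; linarith
  linarith

/-- An entire function of polynomial growth is a polynomial. -/
lemma exists_sum_of_polynomial_growth {F : ℂ → ℂ} (hF : Differentiable ℂ F) {C : ℝ} {k : ℕ}
    (hb : ∀ R : ℝ, 1 ≤ R → ∀ s : ℂ, ‖s‖ ≤ R / 2 → ‖F s‖ ≤ C * (1 + R) ^ k) :
    ∃ a : ℕ → ℂ, ∀ s, F s = ∑ j ∈ Finset.range (k + 1), a j * s ^ j := by
  have hz : ∀ n, k < n → iteratedDeriv n F 0 = 0 := by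
    intro n hn
    have hle : ∀ R : ℝ, 1 ≤ R → ‖iteratedDeriv n F 0‖ ≤
        (n.factorial * C * 2 ^ n * 2 ^ k) * (R ^ k / R ^ n) := by
      intro R hR
      have h1 := Complex.norm_iteratedDeriv_le_of_forall_mem_sphere_norm_le (c := 0) (R := R / 2)
        n (by linarith) hF.diffContOnCl (C := C * (1 + R) ^ k)
        (fun z hz => hb R hR z (by rw [mem_sphere_zero_iff_norm] at hz; exact hz.le))
      refine h1.trans ?_
      have hC : 0 ≤ C := by
        have := (norm_nonneg _).trans (hb 1 le_rfl 0 (by simp))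
        by_contra hcon
        push Not at hcon
        nlinarith [pow_pos (show (0:ℝ) < 1 + 1 by norm_num) k]
      have h2 : (1 + R) ^ k ≤ (2 * R) ^ k := by gcongr; linarith
      have hR0 : 0 < R := by linarith
      calc (n.factorial : ℝ) * (C * (1 + R) ^ k) / (R / 2) ^ n
          ≤ n.factorial * (C * (2 * R) ^ k) / (R / 2) ^ n := by gcongr
        _ = _ := by rw [mul_pow, div_pow]; field_simp
    have hlim : Filter.Tendsto (fun R : ℝ => (n.factorial * C * 2 ^ n * 2 ^ k) * (R ^ k / R ^ n))
        Filter.atTop (nhds 0) := by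
      have := (tendsto_pow_div_pow_atTop_zero (𝕜 := ℝ) hn).const_mul
        (n.factorial * C * 2 ^ n * 2 ^ k)
      simpa using this
    have : ‖iteratedDeriv n F 0‖ ≤ 0 :=
      ge_of_tendsto hlim (Filter.eventually_atTop.mpr ⟨1, hle⟩)
    simpa using this
  refine ⟨fun j => (j.factorial : ℂ)⁻¹ * iteratedDeriv j F 0, fun s => ?_⟩
  have h := Complex.taylorSeries_eq_of_entire' (f := F) 0 s hF
  rw [← h, tsum_eq_sum (s := Finset.range (k + 1))]
  · simp
  · intro n hn
    rw [hz n (by simpa using hn)]; simp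

/-- A polynomial function that grows at most linearly along the negative half-line is affine. -/
lemma affine_of_sum_of_linear_growth {F : ℂ → ℂ} {C : ℝ}
    (hb : ∀ x : ℝ, 0 ≤ x → ‖F (-x)‖ ≤ C * (1 + x)) (k : ℕ) (a : ℕ → ℂ)
    (hF : ∀ s, F s = ∑ j ∈ Finset.range (k + 1), a j * s ^ j) :
    ∃ u v : ℂ, ∀ s, F s = u + v * s := by
  induction k with
  | zero => exact ⟨a 0, 0, fun s => by simp [hF s]⟩
  | succ k ih =>
    rcases Nat.eq_zero_or_pos k with rfl | hk
    · exact ⟨a 0, a 1, fun s => by simp [hF s, Finset.sum_range_succ]⟩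
    have h0 : a (k + 1) = 0 := by
      have hzero : Filter.Tendsto (fun x : ℝ => F (-x) / (x : ℂ) ^ (k + 1)) Filter.atTop
          (nhds 0) := by
        refine squeeze_zero_norm' (a := fun x : ℝ => 2 * C * (x ^ 1 / x ^ (k + 1))) ?_ ?_
        · filter_upwards [Filter.eventually_ge_atTop (1 : ℝ)] with x hx
          have hx0 : 0 < x := by linarith
          have hC : 0 ≤ C := by
            have := (norm_nonneg _).trans (hb 0 le_rfl); simpa using this
          rw [norm_div, norm_pow, Complex.norm_real, Real.norm_of_nonneg hx0.le]
          calc ‖F (-x)‖ / x ^ (k + 1) ≤ (C * (1 + x)) / x ^ (k + 1) := by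
                gcongr; exact hb x hx0.le
            _ ≤ (2 * C * x) / x ^ (k + 1) := by
                refine div_le_div_of_nonneg_right ?_ (by positivity)
                nlinarith
            _ = _ := by ring
        · have := (tendsto_pow_div_pow_atTop_zero (𝕜 := ℝ) (show 1 < k + 1 by omega)).const_mul (2 * C)
          simpa using this
      have hlim : Filter.Tendsto (fun x : ℝ => F (-x) / (x : ℂ) ^ (k + 1)) Filter.atTop
          (nhds ((-1) ^ (k + 1) * a (k + 1))) := by
        have h1 : Filter.Tendsto (fun x : ℝ => (∑ j ∈ Finset.range (k + 1),
            a j * (-1) ^ j * ((x : ℂ) ^ j / (x : ℂ) ^ (k + 1))) + (-1) ^ (k + 1) * a (k + 1))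
            Filter.atTop (nhds ((∑ j ∈ Finset.range (k + 1), a j * (-1) ^ j * 0)
              + (-1) ^ (k + 1) * a (k + 1))) := by
          refine Filter.Tendsto.add (tendsto_finsetSum _ fun j hj => ?_) tendsto_const_nhds
          refine Filter.Tendsto.const_mul _ ?_
          have h2 := tendsto_pow_div_pow_atTop_zero (𝕜 := ℝ) (Finset.mem_range.mp hj)
          have h3 := (Complex.continuous_ofReal.tendsto 0).comp h2
          simpa [Function.comp_def] using h3
        simp only [mul_zero, Finset.sum_const_zero, zero_add] at h1
        refine h1.congr' ?_
        filter_upwards [Filter.eventually_gt_atTop (0 : ℝ)] with x hx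
        have hx0 : (x : ℂ) ≠ 0 := by exact_mod_cast hx.ne'
        rw [hF, Finset.sum_range_succ _ (k + 1), add_div, Finset.sum_div]
        congr 1
        · refine Finset.sum_congr rfl fun j _ => ?_
          rw [neg_pow (x : ℂ)]; ring
        · rw [neg_pow (x : ℂ)]; field_simp
      have := tendsto_nhds_unique hlim hzero
      simpa using this
    refine ih fun s => ?_
    rw [hF s, Finset.sum_range_succ, h0]; simp

/-- Liouville-type gluing: two functions holomorphic in complementary half-planes that agree on the
imaginary axis, of at most linear growth on the left and of at most polynomial growth, up to a
factor `|Im s| ^ (-2)`, on the right, are restrictions of one affine function. -/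
lemma affine_of_glue_half_planes {L R : ℂ → ℂ}
    (hLc : ContinuousOn L {s | s.re ≤ 0}) (hLd : ∀ s : ℂ, s.re < 0 → DifferentiableAt ℂ L s)
    (hRc : ContinuousOn R {s | 0 ≤ s.re}) (hRd : ∀ s : ℂ, 0 < s.re → DifferentiableAt ℂ R s)
    (hLR : ∀ s : ℂ, s.re = 0 → L s = R s) {C : ℝ} {k : ℕ} (hk : 3 ≤ k)
    (hLb : ∀ s : ℂ, s.re ≤ 0 → ‖L s‖ ≤ C * (1 + ‖s‖))
    (hRb : ∀ s : ℂ, 0 ≤ s.re → s.im ≠ 0 → ‖R s‖ * s.im ^ 2 ≤ C * (1 + ‖s‖) ^ k) :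
    ∃ u v : ℂ, (∀ s : ℂ, s.re ≤ 0 → L s = u + v * s) ∧ (∀ s : ℂ, 0 ≤ s.re → R s = u + v * s) := by
  classical
  set F : ℂ → ℂ := fun s => if s.re ≤ 0 then L s else R s with hFdef
  have hFL : ∀ s : ℂ, s.re ≤ 0 → F s = L s := fun s hs => by simp [hFdef, hs]
  have hFR : ∀ s : ℂ, 0 ≤ s.re → F s = R s := fun s hs => by
    rcases hs.lt_or_eq with h | h
    · simp [hFdef, h]
    · rw [hFL s h.symm.le]; exact hLR s h.symm
  have hFc : Continuous F := by
    refine continuous_if_le (by fun_prop) continuous_const hLc hRc fun s hs => hLR s hs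
  have hFd : Differentiable ℂ F := by
    refine differentiable_of_off_imaginary_axis hFc fun s hs => ?_
    rcases lt_or_gt_of_ne hs with h | h
    · refine (hLd s h).congr_of_eventuallyEq ?_
      filter_upwards [(isOpen_lt Complex.continuous_re continuous_const).mem_nhds h] with z hz
      exact hFL z (le_of_lt hz)
    · refine (hRd s h).congr_of_eventuallyEq ?_
      filter_upwards [(isOpen_lt continuous_const Complex.continuous_re).mem_nhds h] with z hz
      exact hFR z (le_of_lt hz)
  have hC : 0 ≤ C := by
    have := (norm_nonneg _).trans (hLb 0 (by simp)); simpa using this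
  have hb : ∀ s : ℂ, ‖F s‖ * s.im ^ 2 ≤ C * (1 + ‖s‖) ^ k := by
    intro s
    rcases le_total s.re 0 with h | h
    · rw [hFL s h]
      have h1 : s.im ^ 2 ≤ (1 + ‖s‖) ^ 2 := by
        rw [← sq_abs s.im]
        have := Complex.abs_im_le_norm s
        gcongr; linarith
      calc ‖L s‖ * s.im ^ 2 ≤ (C * (1 + ‖s‖)) * (1 + ‖s‖) ^ 2 := by
            gcongr; exact hLb s h
        _ = C * (1 + ‖s‖) ^ 3 := by ring
        _ ≤ C * (1 + ‖s‖) ^ k := by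
            gcongr
            linarith [norm_nonneg s]
    · rw [hFR s h]
      by_cases hi : s.im = 0
      · rw [hi]; simp; positivity
      · exact hRb s h hi
  obtain ⟨a, ha⟩ := exists_sum_of_polynomial_growth hFd (C := 8 * C) (k := k)
    (fun R hR s hs => norm_le_of_norm_mul_im_sq_le hFd hb hR hs)
  obtain ⟨u, v, huv⟩ := affine_of_sum_of_linear_growth (F := F) (C := C) (fun x hx => by
    rw [hFL _ (by simpa using hx)]
    have := hLb (-x) (by simpa using hx)
    simpa [abs_of_nonneg hx] using this) k a ha
  exact ⟨u, v, fun s hs => by rw [← hFL s hs, huv], fun s hs => by rw [← hFR s hs, huv]⟩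

/-- The meromorphic series `∑ wₙ / (pₙ - s)`. -/
def cauchySeries (w p : ℕ → ℝ) (s : ℂ) : ℂ := ∑' n, (w n : ℂ) / ((p n : ℂ) - s)

/-- Nonnegative weights and positive poles tending to infinity for which `∑ wₙ / (pₙ - s)`
converges away from the poles. -/
structure CauchyData (w p : ℕ → ℝ) : Prop where
  w_nonneg : ∀ n, 0 ≤ w n
  p_pos : ∀ n, 0 < p n
  summable : Summable fun n => w n / p n
  tendsto : Filter.Tendsto p Filter.atTop Filter.atTop

lemma norm_div_sub_le_of_im_ne_zero {w p : ℝ} (hw : 0 ≤ w) (hp : 0 < p) {s : ℂ} (hs : s.im ≠ 0) :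
    ‖(w : ℂ) / ((p : ℂ) - s)‖ ≤ ‖s‖ / |s.im| * (w / p) := by
  have h1 : p * |s.im| ≤ ‖(p : ℂ) - s‖ * ‖s‖ := by
    have h := Complex.abs_im_le_norm (((p : ℂ) - s) * (starRingEnd ℂ) s)
    have h2 : (((p : ℂ) - s) * (starRingEnd ℂ) s).im = -(p * s.im) := by simp; ring
    rw [h2, norm_mul, RCLike.norm_conj, abs_neg, abs_mul, abs_of_pos hp] at h
    exact h
  have him : 0 < |s.im| := abs_pos.mpr hs
  have h3 : 0 < ‖(p : ℂ) - s‖ := by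
    rw [norm_pos_iff]
    intro h
    apply hs
    have := congrArg Complex.im h
    simpa using this
  rw [norm_div, Complex.norm_real, Real.norm_of_nonneg hw, div_mul_div_comm,
    div_le_div_iff₀ h3 (by positivity)]
  nlinarith [mul_le_mul_of_nonneg_left h1 hw]

namespace CauchyData
variable {w p : ℕ → ℝ}

lemma exists_eventually_norm_le (h : CauchyData w p) {s : ℂ} (hs : ∀ n, w n ≠ 0 → s ≠ p n) :
    ∃ K, ∀ᶠ z in nhds s, ∀ n, ‖(w n : ℂ) / ((p n : ℂ) - z)‖ ≤ K * (w n / p n) := by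
  have hloc : ∀ n, ∃ K, 0 ≤ K ∧
      ∀ᶠ z in nhds s, ‖(w n : ℂ) / ((p n : ℂ) - z)‖ ≤ K * (w n / p n) := by
    intro n
    by_cases hw : w n = 0
    · exact ⟨0, le_rfl, by simp [hw]⟩
    have hw' : 0 < w n := lt_of_le_of_ne (h.w_nonneg n) (Ne.symm hw)
    have hne : (p n : ℂ) - s ≠ 0 := sub_ne_zero.mpr (hs n hw).symm
    have hc : ContinuousAt (fun z : ℂ => ‖(w n : ℂ) / ((p n : ℂ) - z)‖) s := by
      fun_prop (disch := exact hne)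
    have hp := h.p_pos n
    refine ⟨(‖(w n : ℂ) / ((p n : ℂ) - s)‖ + 1) * (p n / w n), by positivity, ?_⟩
    filter_upwards [hc.eventually_lt continuousAt_const (lt_add_one _)] with z hz
    rw [mul_assoc, div_mul_div_comm, mul_comm (p n), div_self (by positivity), mul_one]
    exact hz.le
  choose K hK0 hK using hloc
  obtain ⟨M, hM⟩ := (h.tendsto.eventually_ge_atTop (2 * (‖s‖ + 1))).exists_forall_of_atTop
  refine ⟨2 + ∑ n ∈ Finset.range M, K n, ?_⟩
  have h1 : ∀ᶠ z in nhds s, ∀ n ∈ Finset.range M,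
      ‖(w n : ℂ) / ((p n : ℂ) - z)‖ ≤ K n * (w n / p n) :=
    (Finset.eventually_all (Finset.range M)).mpr fun n _ => hK n
  have h2 : ∀ᶠ z in nhds s, ‖z‖ < ‖s‖ + 1 :=
    continuous_norm.continuousAt.eventually_lt continuousAt_const (lt_add_one _)
  filter_upwards [h1, h2] with z hz1 hz2 n
  have hwp : 0 ≤ w n / p n := div_nonneg (h.w_nonneg n) (h.p_pos n).le
  by_cases hn : n < M
  · refine (hz1 n (Finset.mem_range.mpr hn)).trans ?_
    gcongr
    have := Finset.single_le_sum (fun i _ => hK0 i) (Finset.mem_range.mpr hn)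
    linarith
  · have hp := hM n (not_lt.mp hn)
    have hsum : 0 ≤ ∑ n ∈ Finset.range M, K n := Finset.sum_nonneg fun i _ => hK0 i
    have h3 : p n / 2 ≤ ‖(p n : ℂ) - z‖ := by
      have := norm_sub_norm_le (p n : ℂ) z
      rw [Complex.norm_real, Real.norm_of_nonneg (h.p_pos n).le] at this
      linarith
    have h4 : ‖(w n : ℂ) / ((p n : ℂ) - z)‖ ≤ 2 * (w n / p n) := by
      rw [norm_div, Complex.norm_real, Real.norm_of_nonneg (h.w_nonneg n)]
      have hp0 := h.p_pos n
      have hw0 := h.w_nonneg n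
      calc w n / ‖(p n : ℂ) - z‖ ≤ w n / (p n / 2) := by gcongr
        _ = 2 * (w n / p n) := by field_simp
    refine h4.trans ?_
    gcongr
    linarith

lemma summable_term (h : CauchyData w p) {s : ℂ} (hs : ∀ n, w n ≠ 0 → s ≠ p n) :
    Summable fun n => (w n : ℂ) / ((p n : ℂ) - s) := by
  obtain ⟨K, hK⟩ := h.exists_eventually_norm_le hs
  exact (h.summable.mul_left K).of_norm_bounded hK.self_of_nhds

lemma eventually_ne_pole (h : CauchyData w p) {s : ℂ} (hs : ∀ n, w n ≠ 0 → s ≠ p n) :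
    ∀ᶠ z in nhds s, ∀ n, w n ≠ 0 → z ≠ (p n : ℂ) := by
  obtain ⟨M, hM⟩ := (h.tendsto.eventually_ge_atTop (‖s‖ + 1)).exists_forall_of_atTop
  have h1 : ∀ᶠ z in nhds s, ∀ n ∈ Finset.range M, w n ≠ 0 → z ≠ (p n : ℂ) :=
    (Finset.eventually_all (Finset.range M)).mpr fun n _ => by
      by_cases hw : w n = 0
      · simp [hw]
      · filter_upwards [isOpen_ne.mem_nhds (hs n hw)] with z hz _ using hz
  have h2 : ∀ᶠ z in nhds s, ‖z‖ < ‖s‖ + 1 :=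
    continuous_norm.continuousAt.eventually_lt continuousAt_const (lt_add_one _)
  filter_upwards [h1, h2] with z hz1 hz2 n hw
  by_cases hn : n < M
  · exact hz1 n (Finset.mem_range.mpr hn) hw
  · rintro rfl
    rw [Complex.norm_real, Real.norm_of_nonneg (h.p_pos n).le] at hz2
    linarith [hM n (not_lt.mp hn)]

lemma differentiableAt (h : CauchyData w p) {s : ℂ} (hs : ∀ n, w n ≠ 0 → s ≠ p n) :
    DifferentiableAt ℂ (cauchySeries w p) s := by
  obtain ⟨K, hK⟩ := h.exists_eventually_norm_le hs
  obtain ⟨U, hU, hUo, hsU⟩ := eventually_nhds_iff.mp (hK.and (h.eventually_ne_pole hs))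
  have hd : DifferentiableOn ℂ (fun z => ∑' n, (w n : ℂ) / ((p n : ℂ) - z)) U := by
    refine Complex.differentiableOn_tsum_of_summable_norm (h.summable.mul_left K) ?_ hUo
      fun n z hz => (hU z hz).1 n
    intro n z hz
    by_cases hw : w n = 0
    · simpa [hw] using differentiableWithinAt_const (0 : ℂ)
    · have hne : (p n : ℂ) - z ≠ 0 := sub_ne_zero.mpr ((hU z hz).2 n hw).symm
      exact DifferentiableAt.differentiableWithinAt (by fun_prop (disch := exact hne))
  exact hd.differentiableAt (hUo.mem_nhds hsU)

lemma update (h : CauchyData w p) (j : ℕ) : CauchyData (Function.update w j 0) p where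
  w_nonneg n := by
    rcases eq_or_ne n j with rfl | hn
    · simp
    · simpa [hn] using h.w_nonneg n
  p_pos := h.p_pos
  summable := by
    refine h.summable.of_nonneg_of_le (fun n => ?_) (fun n => ?_) <;>
    · have := div_nonneg (h.w_nonneg n) (h.p_pos n).le
      rcases eq_or_ne n j with rfl | hn
      · simp [this]
      · simp [hn, this]
  tendsto := h.tendsto

lemma eq_add_update (h : CauchyData w p) (j : ℕ) {s : ℂ} (hs : ∀ n, w n ≠ 0 → s ≠ p n) :
    cauchySeries w p s
      = (w j : ℂ) / ((p j : ℂ) - s) + cauchySeries (Function.update w j 0) p s := by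
  rw [cauchySeries, (h.summable_term hs).tsum_eq_add_tsum_ite j, cauchySeries]
  congr 1
  refine tsum_congr fun n => ?_
  rcases eq_or_ne n j with rfl | hn <;> simp [*]

lemma norm_le_of_im_ne_zero (h : CauchyData w p) {s : ℂ} (hs : s.im ≠ 0) :
    ‖cauchySeries w p s‖ ≤ ‖s‖ / |s.im| * ∑' n, w n / p n := by
  rw [← tsum_mul_left]
  exact tsum_of_norm_bounded (h.summable.mul_left _).hasSum
    fun n => norm_div_sub_le_of_im_ne_zero (h.w_nonneg n) (h.p_pos n) hs

lemma ofReal_eq (w p : ℕ → ℝ) (s : ℝ) :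
    cauchySeries w p s = ((∑' n, w n / (p n - s) : ℝ) : ℂ) := by
  rw [cauchySeries, Complex.ofReal_tsum]
  push_cast
  rfl

lemma summable_real (h : CauchyData w p) {s : ℝ} (hs : ∀ n, w n ≠ 0 → s ≠ p n) :
    Summable fun n => w n / (p n - s) := by
  have := h.summable_term (s := s) fun n hn => by exact_mod_cast hs n hn
  rw [← Complex.summable_ofReal]
  push_cast
  exact this

lemma mul_tsum_le (h : CauchyData w p) {s t : ℝ} (hst : s ≤ t)
    (hpole : ∀ n, w n ≠ 0 → p n < s ∨ t < p n) :
    s * ∑' n, w n / (p n - s) ≤ t * ∑' n, w n / (p n - t) := by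
  have h1 := h.summable_real (s := s) fun n hn => by
    rcases hpole n hn with h | h
    · exact h.ne'
    · exact (hst.trans_lt h).ne
  have h2 := h.summable_real (s := t) fun n hn => by
    rcases hpole n hn with h | h
    · exact (h.trans_le hst).ne'
    · exact h.ne
  rw [← tsum_mul_left, ← tsum_mul_left]
  refine (h1.mul_left s).tsum_le_tsum (fun n => ?_) (h2.mul_left t)
  have hw := h.w_nonneg n
  have hp := h.p_pos n
  by_cases hw0 : w n = 0
  · simp [hw0]
  have key : s / (p n - s) ≤ t / (p n - t) := by
    rcases hpole n hw0 with h | h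
    · rw [← neg_le_neg_iff, ← div_neg, ← div_neg, neg_sub, neg_sub,
        div_le_div_iff₀ (by linarith) (by linarith)]
      nlinarith
    · rw [div_le_div_iff₀ (by linarith) (by linarith)]
      nlinarith
  calc s * (w n / (p n - s)) = w n * (s / (p n - s)) := by ring
    _ ≤ w n * (t / (p n - t)) := by gcongr
    _ = _ := by ring

end CauchyData

/-- Zeros `ζ` and poles `r` on the positive half-line, interlacing and tending to infinity. -/
structure Interlacing (ζ r : ℕ → ℝ) : Prop where
  zero_pos : 0 < ζ 0
  lt : ∀ n, ζ n < r n
  lt_succ : ∀ n, r n < ζ (n + 1)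
  tendsto : Filter.Tendsto r Filter.atTop Filter.atTop

/-- The index permutation which sends `m` to `m + 1`, except that the missing value `j` is
replaced by `0`. -/
def skipIndex (j m : ℕ) : ℕ := if m + 1 = j then 0 else m + 1

/-- The factors of the partial-fraction coefficient at `ζ j`. -/
def interlacingFactor (ζ r : ℕ → ℝ) (j m : ℕ) : ℝ :=
  (1 - ζ j / r m) / (1 - ζ j / ζ (skipIndex j m))

namespace Interlacing
variable {ζ r : ℕ → ℝ}

lemma strictMono (h : Interlacing ζ r) : StrictMono ζ :=
  strictMono_nat_of_lt_succ fun n => (h.lt n).trans (h.lt_succ n)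

lemma strictMono_right (h : Interlacing ζ r) : StrictMono r :=
  strictMono_nat_of_lt_succ fun n => (h.lt_succ n).trans (h.lt (n + 1))

lemma pos (h : Interlacing ζ r) (n : ℕ) : 0 < ζ n :=
  h.zero_pos.trans_le (h.strictMono.monotone (Nat.zero_le n))

lemma pos_right (h : Interlacing ζ r) (n : ℕ) : 0 < r n := (h.pos n).trans (h.lt n)

lemma lt_of_le (h : Interlacing ζ r) {m n : ℕ} (hmn : m ≤ n) : ζ m < r n :=
  (h.strictMono.monotone hmn).trans_lt (h.lt n)

lemma lt_of_lt (h : Interlacing ζ r) {m n : ℕ} (hmn : m < n) : r m < ζ n :=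
  (h.lt_succ m).trans_le (h.strictMono.monotone hmn)

lemma tendsto_left (h : Interlacing ζ r) : Filter.Tendsto ζ Filter.atTop Filter.atTop := by
  rw [← Filter.tendsto_add_atTop_iff_nat 1]
  exact Filter.tendsto_atTop_mono (fun n => (h.lt_succ n).le) h.tendsto

lemma factor_pos (h : Interlacing ζ r) (j m : ℕ) : 0 < interlacingFactor ζ r j m := by
  have hj := h.pos j
  have hpos : ∀ {a b : ℝ}, 0 < b → a < b → 0 < 1 - a / b := fun hb hab => by
    rw [sub_pos, div_lt_one hb]; exact hab
  have hneg : ∀ {a b : ℝ}, 0 < b → b < a → 1 - a / b < 0 := fun hb hab => by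
    rw [sub_neg, one_lt_div hb]; exact hab
  unfold interlacingFactor skipIndex
  split_ifs with hm
  · exact div_pos_of_neg_of_neg (hneg (h.pos_right m) (h.lt_of_lt (by omega)))
      (hneg (h.pos 0) (h.strictMono (by omega)))
  · rcases lt_or_ge m j with hmj | hmj
    · exact div_pos_of_neg_of_neg (hneg (h.pos_right m) (h.lt_of_lt hmj))
        (hneg (h.pos _) (h.strictMono (by omega)))
    · exact div_pos (hpos (h.pos_right m) (h.lt_of_le hmj))
        (hpos (h.pos _) (h.strictMono (by omega)))

lemma summable_inv_sub_inv (h : Interlacing ζ r) :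
    Summable fun m => (r m)⁻¹ - (r (m + 1))⁻¹ := by
  refine summable_of_sum_range_le (c := (r 0)⁻¹) (fun m => ?_) (fun n => ?_)
  · have := h.pos_right m
    have := h.strictMono_right (Nat.lt_succ_self m)
    rw [sub_nonneg]
    gcongr
  · rw [Finset.sum_range_sub' fun m => (r m)⁻¹]
    have := inv_pos.mpr (h.pos_right n)
    linarith

lemma summable_factor_sub_one (h : Interlacing ζ r) (j : ℕ) :
    Summable fun m => ‖interlacingFactor ζ r j m - 1‖ := by
  have hev : ∀ᶠ m in Filter.atTop,
      ‖‖interlacingFactor ζ r j m - 1‖‖ ≤ 2 * ζ j * ((r m)⁻¹ - (r (m + 1))⁻¹) := by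
    filter_upwards [Filter.eventually_ge_atTop j, h.tendsto.eventually_ge_atTop (2 * ζ j)]
      with m hm hr
    have hj := h.pos j
    have h0 := h.pos_right m
    have h1 := h.lt_succ m
    have h2 := h.lt (m + 1)
    have hz : 0 < ζ (m + 1) := h.pos _
    have hs : skipIndex j m = m + 1 := if_neg (by omega)
    have hden : 1 / 2 ≤ 1 - ζ j / ζ (m + 1) := by
      have : ζ j / ζ (m + 1) ≤ 1 / 2 := by
        rw [div_le_div_iff₀ hz (by norm_num)]; linarith
      linarith
    have heq : interlacingFactor ζ r j m - 1
        = -(ζ j * ((r m)⁻¹ - (ζ (m + 1))⁻¹) / (1 - ζ j / ζ (m + 1))) := by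
      rw [interlacingFactor, hs]
      have : 1 - ζ j / ζ (m + 1) ≠ 0 := by linarith
      rw [div_sub_one this, ← neg_div]
      congr 1
      field_simp
      ring
    have hi1 : (ζ (m + 1))⁻¹ ≤ (r m)⁻¹ := by gcongr
    have hi2 : (r (m + 1))⁻¹ ≤ (ζ (m + 1))⁻¹ := by gcongr
    have hnn : 0 ≤ ζ j * ((r m)⁻¹ - (ζ (m + 1))⁻¹) := mul_nonneg hj.le (by linarith)
    rw [norm_norm, heq, norm_neg, Real.norm_of_nonneg (div_nonneg hnn (by linarith)),
      div_le_iff₀ (by linarith)]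
    calc ζ j * ((r m)⁻¹ - (ζ (m + 1))⁻¹) ≤ ζ j * ((r m)⁻¹ - (r (m + 1))⁻¹) := by gcongr
      _ = 2 * ζ j * ((r m)⁻¹ - (r (m + 1))⁻¹) * (1 / 2) := by ring
      _ ≤ _ := by
        gcongr
        exact mul_nonneg (by linarith) (by linarith)
  exact Summable.of_norm_bounded_eventually_nat (h.summable_inv_sub_inv.mul_left _) hev

lemma multipliable_factor (h : Interlacing ζ r) (j : ℕ) :
    Multipliable (interlacingFactor ζ r j) := by
  have := multipliable_one_add_of_summable (h.summable_factor_sub_one j)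
  simpa using this

end Interlacing

lemma prod_skipIndex {α : Type*} [CommMonoid α] (g : ℕ → α) {j M : ℕ} (hj : j ≤ M) :
    ∏ m ∈ Finset.range M, g (skipIndex j m) = ∏ n ∈ (Finset.range (M + 1)).erase j, g n := by
  refine Finset.prod_bij (fun m _ => skipIndex j m) ?_ ?_ ?_ fun _ _ => rfl
  · intro m hm
    simp only [Finset.mem_range, Finset.mem_erase] at *
    unfold skipIndex
    split_ifs <;> omega
  · intro a _ b _ hab
    unfold skipIndex at hab
    split_ifs at hab <;> omega
  · intro n hn
    simp only [Finset.mem_range, Finset.mem_erase] at hn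
    rcases Nat.eq_zero_or_pos n with rfl | hn0
    · refine ⟨j - 1, by simp; omega, ?_⟩
      unfold skipIndex
      rw [if_pos (by omega)]
    · refine ⟨n - 1, by simp; omega, ?_⟩
      unfold skipIndex
      rw [if_neg (by omega)]
      omega

namespace Interlacing
variable {ζ r : ℕ → ℝ}

/-- Partial fractions for `∏ (1 - s / rₙ) / ∏ (1 - s / ζₙ)`, cleared of denominators. -/
lemma partial_fractions (h : Interlacing ζ r) (M : ℕ) {s : ℝ} (hs : ∀ k, s ≠ ζ k) :
    ∑ k ∈ Finset.range (M + 1),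
        (∏ m ∈ Finset.range M, interlacingFactor ζ r k m) * (ζ k / (ζ k - s))
      = (∏ n ∈ Finset.range M, (1 - s / r n)) / ∏ n ∈ Finset.range (M + 1), (1 - s / ζ n) := by
  have hne : ∀ n, 1 - s / ζ n ≠ 0 := fun n => by
    have := (h.pos n).ne'
    rw [sub_ne_zero, ne_comm, Ne, div_eq_one_iff_eq this]
    exact hs n
  have hQ : ∏ n ∈ Finset.range (M + 1), (1 - s / ζ n) ≠ 0 := Finset.prod_ne_zero_iff.mpr
    fun n _ => hne n
  let p : Polynomial ℝ := ∏ n ∈ Finset.range M, (1 - Polynomial.C (r n)⁻¹ * Polynomial.X)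
  have hp : ∀ x, p.eval x = ∏ n ∈ Finset.range M, (1 - x / r n) := fun x => by
    simp only [p, Polynomial.eval_prod]
    refine Finset.prod_congr rfl fun n _ => ?_
    simp; ring
  have hdeg : p.degree < ((Finset.range (M + 1)).card : WithBot ℕ) := by
    have h1 : p.natDegree ≤ M := by
      refine (Polynomial.natDegree_prod_le _ _).trans ?_
      refine (Finset.sum_le_card_nsmul _ _ 1 fun n _ => ?_).trans (by simp)
      refine (Polynomial.natDegree_sub_le _ _).trans ?_
      simpa using (Polynomial.natDegree_C_mul_le _ _).trans Polynomial.natDegree_X_le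
    rw [Finset.card_range]
    exact (Polynomial.degree_le_of_natDegree_le h1).trans_lt (by exact_mod_cast Nat.lt_succ_self M)
  have hInt := Lagrange.eq_interpolate (f := p) (v := ζ) (h.strictMono.injective.injOn) hdeg
  have he := congrArg (Polynomial.eval s) hInt
  rw [hp, Lagrange.interpolate_apply, Polynomial.eval_finsetSum] at he
  rw [eq_div_iff hQ, he, Finset.sum_mul]
  refine Finset.sum_congr rfl fun k hk => ?_
  have hkM : k ≤ M := Nat.lt_succ_iff.mp (Finset.mem_range.mp hk)
  have hzk := (h.pos k).ne'
  have hsub : ζ k - s ≠ 0 := sub_ne_zero.mpr (hs k).symm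
  rw [← Finset.mul_prod_erase _ _ hk]
  simp only [interlacingFactor, Finset.prod_div_distrib, Polynomial.eval_mul, Polynomial.eval_C,
    hp, Lagrange.basis, Polynomial.eval_prod]
  rw [prod_skipIndex (fun n => 1 - ζ k / ζ n) hkM]
  have hb : ∏ n ∈ (Finset.range (M + 1)).erase k,
      Polynomial.eval s (Lagrange.basisDivisor (ζ k) (ζ n))
      = (∏ n ∈ (Finset.range (M + 1)).erase k, (1 - s / ζ n))
        / ∏ n ∈ (Finset.range (M + 1)).erase k, (1 - ζ k / ζ n) := by
    rw [← Finset.prod_div_distrib]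
    refine Finset.prod_congr rfl fun n hn => ?_
    have hnk : ζ k ≠ ζ n := fun hh => (Finset.mem_erase.mp hn).1 (h.strictMono.injective hh).symm
    have h1 : ζ k - ζ n ≠ 0 := sub_ne_zero.mpr hnk
    have h2 := (h.pos n).ne'
    have h3 : ζ n - ζ k ≠ 0 := sub_ne_zero.mpr hnk.symm
    simp only [Lagrange.basisDivisor, Polynomial.eval_mul, Polynomial.eval_C, Polynomial.eval_sub,
      Polynomial.eval_X]
    rw [one_sub_div h2, one_sub_div h2, div_div_div_cancel_right₀ h2, ← neg_sub (ζ n) (ζ k),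
      inv_neg]
    field_simp
    ring
  rw [hb]
  have : ζ k / (ζ k - s) * (1 - s / ζ k) = 1 := by field_simp
  calc _ = (∏ n ∈ Finset.range M, (1 - ζ k / r n)) /
        (∏ n ∈ (Finset.range (M + 1)).erase k, (1 - ζ k / ζ n)) *
        (∏ n ∈ (Finset.range (M + 1)).erase k, (1 - s / ζ n)) *
        (ζ k / (ζ k - s) * (1 - s / ζ k)) := by ring
    _ = _ := by rw [this]; ring


lemma sum_prod_factor (h : Interlacing ζ r) (M : ℕ) :
    ∑ k ∈ Finset.range (M + 1), ∏ m ∈ Finset.range M, interlacingFactor ζ r k m = 1 := by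
  have := h.partial_fractions M (s := 0) fun k => (h.pos k).ne
  simpa [div_self (h.pos _).ne'] using this

end Interlacing

/-- Dominated-type convergence for sub-probability weights against a sequence vanishing at
infinity. -/
lemma tendsto_sum_mul_of_tendsto_zero {a : ℕ → ℕ → ℝ} {b e : ℕ → ℝ}
    (ha : ∀ M k, 0 ≤ a M k) (hsum : ∀ M, ∑ k ∈ Finset.range (M + 1), a M k ≤ 1)
    (hb : ∀ k, Filter.Tendsto (fun M => a M k) Filter.atTop (nhds (b k)))
    (hbs : Summable b) (hb0 : ∀ k, 0 ≤ b k) (hb1 : ∑' k, b k ≤ 1)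
    (he : Filter.Tendsto e Filter.atTop (nhds 0)) :
    Filter.Tendsto (fun M => ∑ k ∈ Finset.range (M + 1), a M k * e k) Filter.atTop
      (nhds (∑' k, b k * e k)) := by
  rw [Metric.tendsto_atTop]
  intro ε hε
  obtain ⟨K, hK⟩ := (Metric.tendsto_atTop.mp he (ε / 4) (by positivity))
  have hK' : ∀ k, K ≤ k → |e k| ≤ ε / 4 := fun k hk => by
    have := hK k hk
    rw [Real.dist_eq, sub_zero] at this
    exact this.le
  have hfin : Filter.Tendsto (fun M => ∑ k ∈ Finset.range K, a M k * e k) Filter.atTop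
      (nhds (∑ k ∈ Finset.range K, b k * e k)) :=
    tendsto_finsetSum _ fun k _ => (hb k).mul_const _
  obtain ⟨M₀, hM₀⟩ := Metric.tendsto_atTop.mp hfin (ε / 4) (by positivity)
  have hbe : Summable fun k => b k * e k := by
    refine Summable.of_norm_bounded_eventually_nat (hbs.mul_right (ε / 4)) ?_
    filter_upwards [Filter.eventually_ge_atTop K] with k hk
    rw [norm_mul, Real.norm_of_nonneg (hb0 k)]
    exact mul_le_mul_of_nonneg_left (hK' k hk) (hb0 k)
  refine ⟨max M₀ K, fun M hM => ?_⟩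
  have h1 := hM₀ M (le_of_max_le_left hM)
  have hKM : K ≤ M + 1 := (le_of_max_le_right hM).trans (Nat.le_succ M)
  have h2 : |∑ k ∈ Finset.Ico K (M + 1), a M k * e k| ≤ ε / 4 := by
    refine (Finset.abs_sum_le_sum_abs _ _).trans ?_
    calc ∑ k ∈ Finset.Ico K (M + 1), |a M k * e k|
        ≤ ∑ k ∈ Finset.Ico K (M + 1), a M k * (ε / 4) := by
          refine Finset.sum_le_sum fun k hk => ?_
          rw [abs_mul, abs_of_nonneg (ha M k)]
          exact mul_le_mul_of_nonneg_left (hK' k (Finset.mem_Ico.mp hk).1) (ha M k)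
      _ ≤ ∑ k ∈ Finset.range (M + 1), a M k * (ε / 4) := by
          refine Finset.sum_le_sum_of_subset_of_nonneg (fun k hk => ?_)
            fun k _ _ => mul_nonneg (ha M k) (by positivity)
          exact Finset.mem_range.mpr (Finset.mem_Ico.mp hk).2
      _ ≤ 1 * (ε / 4) := by
          rw [← Finset.sum_mul]
          gcongr
          exact hsum M
      _ = ε / 4 := one_mul _
  have h3 : |∑' k, b (k + K) * e (k + K)| ≤ ε / 4 := by
    have hs : Summable fun k => b (k + K) * (ε / 4) :=
      ((summable_nat_add_iff K).mpr hbs).mul_right _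
    calc |∑' k, b (k + K) * e (k + K)| ≤ ∑' k, b (k + K) * (ε / 4) := by
          rw [← Real.norm_eq_abs]
          refine tsum_of_norm_bounded hs.hasSum fun k => ?_
          rw [norm_mul, Real.norm_of_nonneg (hb0 _)]
          exact mul_le_mul_of_nonneg_left (hK' _ (Nat.le_add_left K k)) (hb0 _)
      _ = (∑' k, b (k + K)) * (ε / 4) := tsum_mul_right
      _ ≤ 1 * (ε / 4) := by
          gcongr
          refine le_trans ?_ hb1
          rw [← hbs.sum_add_tsum_nat_add K]
          have := Finset.sum_nonneg fun k (_ : k ∈ Finset.range K) => hb0 k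
          linarith
      _ = ε / 4 := one_mul _
  rw [← hbe.sum_add_tsum_nat_add K, Real.dist_eq,
    ← Finset.sum_range_add_sum_Ico _ hKM]
  rw [Real.dist_eq] at h1
  have h1' := abs_lt.mp h1
  have h2' := abs_le.mp h2
  have h3' := abs_le.mp h3
  rw [abs_lt]
  constructor <;> linarith [h1'.1, h1'.2, h2'.1, h2'.2, h3'.1, h3'.2]

namespace Interlacing
variable {ζ r : ℕ → ℝ}

/-- The partial-fraction coefficients of `∏ (1 - s / rₙ) / ∏ (1 - s / ζₙ)`. -/
def coeff (ζ r : ℕ → ℝ) (j : ℕ) : ℝ := ∏' m, interlacingFactor ζ r j m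

lemma tendsto_prod_factor (h : Interlacing ζ r) (j : ℕ) :
    Filter.Tendsto (fun M => ∏ m ∈ Finset.range M, interlacingFactor ζ r j m) Filter.atTop
      (nhds (coeff ζ r j)) :=
  (h.multipliable_factor j).tendsto_prod_tprod_nat

lemma prod_factor_nonneg (h : Interlacing ζ r) (M j : ℕ) :
    0 ≤ ∏ m ∈ Finset.range M, interlacingFactor ζ r j m :=
  Finset.prod_nonneg fun m _ => (h.factor_pos j m).le

lemma coeff_nonneg (h : Interlacing ζ r) (j : ℕ) : 0 ≤ coeff ζ r j :=
  ge_of_tendsto' (h.tendsto_prod_factor j) fun M => h.prod_factor_nonneg M j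

lemma sum_coeff_le_one (h : Interlacing ζ r) (K : ℕ) :
    ∑ j ∈ Finset.range K, coeff ζ r j ≤ 1 := by
  refine le_of_tendsto (tendsto_finsetSum _ fun j _ => h.tendsto_prod_factor j) ?_
  filter_upwards [Filter.eventually_ge_atTop K] with M hM
  rw [← h.sum_prod_factor M]
  refine Finset.sum_le_sum_of_subset_of_nonneg (fun k hk => ?_)
    fun k _ _ => h.prod_factor_nonneg M k
  simp only [Finset.mem_range] at *
  omega

lemma summable_coeff (h : Interlacing ζ r) : Summable (coeff ζ r) :=
  summable_of_sum_range_le h.coeff_nonneg h.sum_coeff_le_one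

lemma tsum_coeff_le_one (h : Interlacing ζ r) : ∑' j, coeff ζ r j ≤ 1 :=
  h.summable_coeff.tsum_le_of_sum_range_le h.sum_coeff_le_one

lemma cauchyData_coeff (h : Interlacing ζ r) : CauchyData (coeff ζ r) ζ where
  w_nonneg := h.coeff_nonneg
  p_pos := h.pos
  summable := by
    refine (h.summable_coeff.mul_right (ζ 0)⁻¹).of_nonneg_of_le
      (fun n => div_nonneg (h.coeff_nonneg n) (h.pos n).le) fun n => ?_
    rw [div_eq_mul_inv]
    have := h.zero_pos
    have := h.strictMono.monotone (Nat.zero_le n)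
    have := h.coeff_nonneg n
    gcongr
  tendsto := h.tendsto_left

lemma one_add_mul_tsum_eq_zero (h : Interlacing ζ r) (n : ℕ) :
    1 + r n * ∑' k, coeff ζ r k / (ζ k - r n) = 0 := by
  have hne : ∀ k, r n ≠ ζ k := fun k => by
    rcases lt_or_ge n k with hk | hk
    · exact (h.lt_of_lt hk).ne
    · exact (h.lt_of_le hk).ne'
  have he : Filter.Tendsto (fun k => (ζ k - r n)⁻¹) Filter.atTop (nhds 0) :=
    tendsto_inv_atTop_zero.comp (Filter.tendsto_atTop_add_const_right _ _ h.tendsto_left)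
  have hlim := tendsto_sum_mul_of_tendsto_zero h.prod_factor_nonneg
    (fun M => (h.sum_prod_factor M).le) h.tendsto_prod_factor h.summable_coeff h.coeff_nonneg
    h.tsum_coeff_le_one he
  refine tendsto_nhds_unique (f := fun M => 1 + r n * ∑ k ∈ Finset.range (M + 1),
    (∏ m ∈ Finset.range M, interlacingFactor ζ r k m) * (ζ k - r n)⁻¹)
    ((hlim.const_mul (r n)).const_add 1) ?_
  refine tendsto_const_nhds.congr' ?_
  filter_upwards [Filter.eventually_gt_atTop n] with M hM
  have h1 := h.partial_fractions M hne
  rw [Finset.prod_eq_zero (Finset.mem_range.mpr hM) (by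
    rw [div_self (h.pos_right n).ne', sub_self]), zero_div] at h1
  rw [← h1, ← h.sum_prod_factor M, Finset.mul_sum, ← Finset.sum_add_distrib]
  refine Finset.sum_congr rfl fun k _ => ?_
  have : ζ k - r n ≠ 0 := sub_ne_zero.mpr (hne k).symm
  field_simp
  ring

end Interlacing

namespace Interlacing
variable {ζ r : ℕ → ℝ}

lemma multipliable_update_factor (h : Interlacing ζ r) (j i : ℕ) :
    Multipliable (Function.update (interlacingFactor ζ r j) i 1) := by
  have hs : Summable fun m => ‖Function.update (interlacingFactor ζ r j) i 1 m - 1‖ := by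
    refine (h.summable_factor_sub_one j).of_nonneg_of_le (fun m => norm_nonneg _) fun m => ?_
    rcases eq_or_ne m i with rfl | hm
    · simp
    · simp [hm]
  have := multipliable_one_add_of_summable hs
  simpa using this

lemma mulIndicator_comp_succ {j : ℕ} {g : ℕ → ℝ}
    (hg : ∀ m, m + 1 ≠ j → g (m + 1) = interlacingFactor ζ r j m) (hj : 1 ≤ j) :
    ({m : ℕ | 1 ≤ m ∧ m ≠ j}.mulIndicator g) ∘ Nat.succ
      = Function.update (interlacingFactor ζ r j) (j - 1) 1 := by
  funext m
  rcases eq_or_ne m (j - 1) with rfl | hm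
  · simp [Set.mulIndicator, Nat.sub_add_cancel hj]
  · have : m + 1 ≠ j := by omega
    simp [Set.mulIndicator, this, hm, hg m this]

lemma mulIndicator_eq_one_of_notMem_range_succ (j : ℕ) (g : ℕ → ℝ) (x : ℕ)
    (hx : x ∉ Set.range Nat.succ) : ({m : ℕ | 1 ≤ m ∧ m ≠ j}.mulIndicator g) x = 1 := by
  have : x = 0 := by
    by_contra h
    exact hx ⟨x - 1, Nat.succ_pred_eq_of_ne_zero h⟩
  simp [this]

lemma multipliable_subtype (h : Interlacing ζ r) {j : ℕ} {g : ℕ → ℝ}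
    (hg : ∀ m, m + 1 ≠ j → g (m + 1) = interlacingFactor ζ r j m) (hj : 1 ≤ j) :
    Multipliable fun m : {m : ℕ // 1 ≤ m ∧ m ≠ j} => g m := by
  have h1 : Multipliable ({m : ℕ | 1 ≤ m ∧ m ≠ j}.mulIndicator g) := by
    rw [← Nat.succ_injective.multipliable_iff (mulIndicator_eq_one_of_notMem_range_succ j g),
      mulIndicator_comp_succ hg hj]
    exact h.multipliable_update_factor j (j - 1)
  exact multipliable_subtype_iff_mulIndicator.mpr h1

lemma coeff_eq_mul_tprod_subtype (h : Interlacing ζ r) {j : ℕ} {g : ℕ → ℝ}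
    (hg : ∀ m, m + 1 ≠ j → g (m + 1) = interlacingFactor ζ r j m) (hj : 1 ≤ j) :
    coeff ζ r j = interlacingFactor ζ r j (j - 1)
      * ∏' m : {m : ℕ // 1 ≤ m ∧ m ≠ j}, g m := by
  have h1 : ∏' m : {m : ℕ // 1 ≤ m ∧ m ≠ j}, g m
      = ∏' m, Function.update (interlacingFactor ζ r j) (j - 1) 1 m := by
    rw [← mulIndicator_comp_succ hg hj]
    have := tprod_subtype {m : ℕ | 1 ≤ m ∧ m ≠ j} g
    refine Eq.trans this (Nat.succ_injective.tprod_eq fun x hx => ?_).symm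
    by_contra hx'
    exact hx (mulIndicator_eq_one_of_notMem_range_succ j g x hx')
  rw [h1, coeff, (h.multipliable_update_factor j (j - 1)).tprod_eq_mul_tprod_ite']
  congr 1
  refine tprod_congr fun m => ?_
  rcases eq_or_ne m (j - 1) with rfl | hm <;> simp [*]

end Interlacing

/-- The meromorphic function `∏ (1 - s / rₙ) / ∏ (1 - s / ζₙ)` given by its partial fractions. -/
def interlacingQuotient (ζ r : ℕ → ℝ) (s : ℂ) : ℂ :=
  1 + s * cauchySeries (Interlacing.coeff ζ r) ζ s

namespace Interlacing
variable {ζ r : ℕ → ℝ}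

lemma quotient_ofReal (ζ r : ℕ → ℝ) (x : ℝ) :
    interlacingQuotient ζ r x = ((1 + x * ∑' k, coeff ζ r k / (ζ k - x) : ℝ) : ℂ) := by
  rw [interlacingQuotient, CauchyData.ofReal_eq]
  push_cast
  rfl

lemma quotient_zero (ζ r : ℕ → ℝ) : interlacingQuotient ζ r 0 = 1 := by
  simp [interlacingQuotient]

lemma quotient_right (h : Interlacing ζ r) (n : ℕ) : interlacingQuotient ζ r (r n) = 0 := by
  rw [quotient_ofReal, h.one_add_mul_tsum_eq_zero, Complex.ofReal_zero]

lemma quotient_differentiableAt (h : Interlacing ζ r) {s : ℂ} (hs : ∀ n, s ≠ ζ n) :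
    DifferentiableAt ℂ (interlacingQuotient ζ r) s :=
  (differentiableAt_id.mul (h.cauchyData_coeff.differentiableAt fun n _ => hs n)).const_add 1

lemma quotient_nonneg_of_lt (h : Interlacing ζ r) {x : ℝ} (hx0 : 0 ≤ x) (hx : x < ζ 0) :
    0 ≤ 1 + x * ∑' k, coeff ζ r k / (ζ k - x) := by
  have : 0 ≤ ∑' k, coeff ζ r k / (ζ k - x) := tsum_nonneg fun k =>
    div_nonneg (h.coeff_nonneg k) (by linarith [h.strictMono.monotone (Nat.zero_le k)])
  positivity

lemma quotient_nonneg_of_mem (h : Interlacing ζ r) {x : ℝ} {n : ℕ} (hx : r n ≤ x)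
    (hx' : x < ζ (n + 1)) : 0 ≤ 1 + x * ∑' k, coeff ζ r k / (ζ k - x) := by
  have := h.cauchyData_coeff.mul_tsum_le hx fun k _ => by
    rcases lt_or_ge n k with hk | hk
    · exact Or.inr (hx'.trans_le (h.strictMono.monotone hk))
    · exact Or.inl (h.lt_of_le hk)
  linarith [h.one_add_mul_tsum_eq_zero n]

lemma quotient_nonpos_of_mem (h : Interlacing ζ r) {x : ℝ} {n : ℕ} (hx : ζ n < x)
    (hx' : x ≤ r n) : 1 + x * ∑' k, coeff ζ r k / (ζ k - x) ≤ 0 := by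
  have := h.cauchyData_coeff.mul_tsum_le hx' fun k _ => by
    rcases lt_or_ge n k with hk | hk
    · exact Or.inr (h.lt_of_lt hk)
    · exact Or.inl ((h.strictMono.monotone hk).trans_lt hx)
  linarith [h.one_add_mul_tsum_eq_zero n]

lemma norm_quotient_le_of_im_ne_zero (h : Interlacing ζ r) {s : ℂ} (hs : s.im ≠ 0) :
    ‖interlacingQuotient ζ r s‖ * |s.im| ≤ 2 * ‖s‖ := by
  have him := abs_pos.mpr hs
  have h1 : ‖s * cauchySeries (coeff ζ r) ζ s‖ ≤ ‖s‖ / |s.im| := by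
    have hb : ∀ k, ‖s * ((coeff ζ r k : ℂ) / ((ζ k : ℂ) - s))‖
        ≤ coeff ζ r k * (‖s‖ / |s.im|) := by
      intro k
      have h2 : |s.im| ≤ ‖(ζ k : ℂ) - s‖ := by
        have := Complex.abs_im_le_norm ((ζ k : ℂ) - s)
        simpa using this
      rw [norm_mul, norm_div, Complex.norm_real, Real.norm_of_nonneg (h.coeff_nonneg k)]
      have := h.coeff_nonneg k
      calc ‖s‖ * (coeff ζ r k / ‖(ζ k : ℂ) - s‖) ≤ ‖s‖ * (coeff ζ r k / |s.im|) := by gcongr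
        _ = _ := by ring
    rw [cauchySeries, ← tsum_mul_left]
    refine (tsum_of_norm_bounded (h.summable_coeff.mul_right _).hasSum hb).trans ?_
    rw [tsum_mul_right]
    exact mul_le_of_le_one_left (by positivity) h.tsum_coeff_le_one
  have h2 : ‖interlacingQuotient ζ r s‖ ≤ 1 + ‖s‖ / |s.im| :=
    (norm_add_le _ _).trans (by rw [norm_one]; linarith)
  calc ‖interlacingQuotient ζ r s‖ * |s.im| ≤ (1 + ‖s‖ / |s.im|) * |s.im| := by gcongr
    _ = |s.im| + ‖s‖ := by field_simp
    _ ≤ 2 * ‖s‖ := by linarith [Complex.abs_im_le_norm s]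

lemma norm_quotient_le_of_re_nonpos (h : Interlacing ζ r) {s : ℂ} (hs : s.re ≤ 0) :
    ‖interlacingQuotient ζ r s‖ ≤ 2 := by
  have h1 : ‖s * cauchySeries (coeff ζ r) ζ s‖ ≤ 1 := by
    have hb : ∀ k, ‖s * ((coeff ζ r k : ℂ) / ((ζ k : ℂ) - s))‖ ≤ coeff ζ r k := by
      intro k
      have hz := h.pos k
      have h2 : ‖s‖ ≤ ‖(ζ k : ℂ) - s‖ := by
        rw [← sq_le_sq₀ (norm_nonneg _) (norm_nonneg _), Complex.sq_norm, Complex.sq_norm,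
          Complex.normSq_apply, Complex.normSq_apply]
        simp
        nlinarith
      have h3 : 0 < ‖(ζ k : ℂ) - s‖ := by
        rw [norm_pos_iff]
        intro h0
        have := congrArg Complex.re h0
        simp at this
        linarith
      rw [norm_mul, norm_div, Complex.norm_real, Real.norm_of_nonneg (h.coeff_nonneg k),
        mul_div_assoc', div_le_iff₀ h3, mul_comm]
      exact mul_le_mul_of_nonneg_left h2 (h.coeff_nonneg k)
    rw [cauchySeries, ← tsum_mul_left]
    exact (tsum_of_norm_bounded h.summable_coeff.hasSum hb).trans h.tsum_coeff_le_one
  refine (norm_add_le _ _).trans ?_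
  rw [norm_one]
  linarith

end Interlacing

/-- The coefficients of the binomial series of `(1 - t) ^ (-a)`. -/
def risingCoeff (a : ℝ) (n : ℕ) : ℝ := ∏ i ∈ Finset.range n, ((a + i) / (i + 1))

lemma risingCoeff_nonneg {a : ℝ} (ha : 0 ≤ a) (n : ℕ) : 0 ≤ risingCoeff a n :=
  Finset.prod_nonneg fun i _ => by positivity

lemma mul_risingCoeff_add_one (a : ℝ) (n : ℕ) :
    a * risingCoeff (a + 1) n = risingCoeff a n * (a + n) := by
  induction n with
  | zero => simp [risingCoeff]
  | succ n ih =>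
    have h1 : risingCoeff (a + 1) (n + 1) = risingCoeff (a + 1) n * ((a + 1 + n) / (n + 1)) :=
      Finset.prod_range_succ _ _
    have h2 : risingCoeff a (n + 1) = risingCoeff a n * ((a + n) / (n + 1)) :=
      Finset.prod_range_succ _ _
    rw [h1, ← mul_assoc, ih, h2]
    push_cast
    ring

lemma choose_eq_risingCoeff (a : ℝ) (n : ℕ) : Ring.choose (a + n - 1) n = risingCoeff a n := by
  have h1 : Ring.choose (a + n - 1) n = Ring.multichoose a n := by
    rw [Ring.choose]
    congr 1
    ring
  have h2 : ∀ n : ℕ, (ascPochhammer ℝ n).eval a = n.factorial * risingCoeff a n := by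
    intro n
    induction n with
    | zero => simp [risingCoeff]
    | succ n ih =>
      have h3 : risingCoeff a (n + 1) = risingCoeff a n * ((a + n) / (n + 1)) :=
        Finset.prod_range_succ _ _
      rw [ascPochhammer_succ_eval, ih, h3, Nat.factorial_succ]
      push_cast
      field_simp
  have h4 := Ring.factorial_nsmul_multichoose_eq_ascPochhammer a n
  rw [Polynomial.ascPochhammer_smeval_eq_eval, h2, nsmul_eq_mul] at h4
  rw [h1]
  exact mul_left_cancel₀ (by positivity) h4

lemma hasSum_risingCoeff (a : ℝ) {t : ℝ} (ht0 : 0 ≤ t) (ht1 : t < 1) :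
    HasSum (fun n => risingCoeff a n * t ^ n) ((1 - t) ^ (-a)) := by
  have h := (Real.one_div_one_sub_rpow_hasFPowerSeriesOnBall_zero a).hasSum (y := t) (by
    rw [mem_eball_zero_iff, enorm_eq_nnnorm]
    have : ‖t‖₊ < 1 := by
      rw [← NNReal.coe_lt_coe, coe_nnnorm, Real.norm_of_nonneg ht0]
      exact ht1
    exact_mod_cast this)
  simp only [FormalMultilinearSeries.ofScalars_apply_eq, smul_eq_mul, zero_add,
    choose_eq_risingCoeff] at h
  rwa [Real.rpow_neg (by linarith), ← one_div]

lemma cBeta_integral {u : ℂ} {v : ℝ} (hu : 0 < u.re) (hv : 0 < v) :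
    Complex.Gamma u * Complex.Gamma v / Complex.Gamma (u + v)
      = ∫ t in Ioo (0 : ℝ) 1, (t : ℂ) ^ (u - 1) * (((1 - t) ^ (v - 1) : ℝ) : ℂ) := by
  have h := Complex.Gamma_mul_Gamma_eq_betaIntegral hu (t := v) (by simpa using hv)
  have hne : Complex.Gamma (u + v) ≠ 0 := Complex.Gamma_ne_zero_of_re_pos (by
    simp only [Complex.add_re, Complex.ofReal_re]; linarith)
  rw [h, mul_div_cancel_left₀ _ hne, Complex.betaIntegral,
    intervalIntegral.integral_of_le zero_le_one, integral_Ioc_eq_integral_Ioo]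
  refine setIntegral_congr_fun measurableSet_Ioo fun t ht => ?_
  rw [Complex.ofReal_cpow (by linarith [ht.2])]
  push_cast
  rfl

lemma integrableOn_beta {u v : ℝ} (hu : 0 < u) (hv : 0 < v) :
    IntegrableOn (fun t : ℝ => t ^ (u - 1) * (1 - t) ^ (v - 1)) (Ioo (0 : ℝ) 1) := by
  have h := (Complex.betaIntegral_convergent (u := u) (v := v) (by simpa using hu)
    (by simpa using hv)).1
  rw [integrableOn_Ioc_iff_integrableOn_Ioo] at h
  refine h.norm.congr ?_
  filter_upwards [ae_restrict_mem measurableSet_Ioo] with t ht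
  have h1 : (t : ℂ) ^ ((u : ℂ) - 1) = ((t ^ (u - 1) : ℝ) : ℂ) := by
    rw [Complex.ofReal_cpow ht.1.le]; push_cast; rfl
  have h2 : (1 - (t : ℂ)) ^ ((v : ℂ) - 1) = (((1 - t) ^ (v - 1) : ℝ) : ℂ) := by
    rw [Complex.ofReal_cpow (by linarith [ht.2])]; push_cast; rfl
  rw [h1, h2, ← Complex.ofReal_mul, Complex.norm_real, Real.norm_of_nonneg]
  exact mul_nonneg (Real.rpow_nonneg ht.1.le _) (Real.rpow_nonneg (by linarith [ht.2]) _)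

/-- Partial fractions of the Beta function in its first argument on the right half-plane. -/
lemma hasSum_cBeta_of_re_pos {x : ℂ} {b : ℝ} (hx : 0 < x.re) (hb0 : 0 < b) (hb1 : b ≤ 1) :
    HasSum (fun n : ℕ => (risingCoeff (1 - b) n : ℂ) / (x + n))
      (Complex.Gamma x * Complex.Gamma b / Complex.Gamma (x + b)) := by
  rw [cBeta_integral hx hb0]
  have hco : ∀ n, 0 ≤ risingCoeff (1 - b) n := risingCoeff_nonneg (by linarith)
  have hsum : ∀ t ∈ Ioo (0 : ℝ) 1,
      HasSum (fun n => risingCoeff (1 - b) n * t ^ n) ((1 - t) ^ (b - 1)) := fun t ht => by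
    have := hasSum_risingCoeff (1 - b) ht.1.le ht.2
    rwa [neg_sub] at this
  have hterm : ∀ n : ℕ, ∫ t in Ioo (0 : ℝ) 1,
      (t : ℂ) ^ (x - 1) * ((risingCoeff (1 - b) n * t ^ n : ℝ) : ℂ)
      = (risingCoeff (1 - b) n : ℂ) / (x + n) := by
    intro n
    have h1 : ∫ t in Ioo (0 : ℝ) 1, (t : ℂ) ^ (x + n - 1) = 1 / (x + n) := by
      rw [← integral_Ioc_eq_integral_Ioo, ← intervalIntegral.integral_of_le zero_le_one,
        integral_cpow (Or.inl (by simp; positivity))]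
      have hne : x + n ≠ 0 := fun h0 => by
        have := congrArg Complex.re h0
        simp at this
        have : (0 : ℝ) ≤ n := n.cast_nonneg
        linarith
      simp [hne]
    calc _ = ∫ t in Ioo (0 : ℝ) 1, (risingCoeff (1 - b) n : ℂ) * (t : ℂ) ^ (x + n - 1) := by
          refine setIntegral_congr_fun measurableSet_Ioo fun t ht => ?_
          have ht0 : (t : ℂ) ≠ 0 := by exact_mod_cast ht.1.ne'
          rw [show x + n - 1 = (x - 1) + n by ring, Complex.cpow_add _ _ ht0, Complex.cpow_natCast]
          push_cast
          ring
      _ = _ := by rw [integral_const_mul, h1]; ring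
  simp_rw [← hterm]
  refine hasSum_integral_of_dominated_convergence
    (fun n t => t ^ (x.re - 1) * (risingCoeff (1 - b) n * t ^ n)) (fun n => ?_) (fun n => ?_) ?_ ?_ ?_
  · refine ContinuousOn.aestronglyMeasurable (fun t ht => ?_) measurableSet_Ioo
    refine ContinuousAt.continuousWithinAt ?_
    have : (t : ℂ) ∈ Complex.slitPlane := by simpa using ht.1
    fun_prop (disch := assumption)
  · filter_upwards [ae_restrict_mem measurableSet_Ioo] with t ht
    rw [norm_mul, Complex.norm_cpow_eq_rpow_re_of_pos ht.1, Complex.norm_real,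
      Real.norm_of_nonneg (mul_nonneg (hco n) (pow_nonneg ht.1.le n))]
    simp
  · filter_upwards [ae_restrict_mem measurableSet_Ioo] with t ht
    exact (hsum t ht).summable.mul_left _
  · refine (integrableOn_beta hx hb0).congr ?_
    filter_upwards [ae_restrict_mem measurableSet_Ioo] with t ht
    rw [tsum_mul_left, (hsum t ht).tsum_eq]
  · filter_upwards [ae_restrict_mem measurableSet_Ioo] with t ht
    exact (Complex.hasSum_ofReal.mpr (hsum t ht)).mul_left _

lemma summable_risingCoeff_div {x b : ℝ} (hx : 0 < x) (hb0 : 0 < b) (hb1 : b ≤ 1) :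
    Summable fun n : ℕ => risingCoeff (1 - b) n / (x + n) := by
  have := (hasSum_cBeta_of_re_pos (x := x) (by simpa using hx) hb0 hb1).summable
  rw [← Complex.summable_ofReal]
  push_cast
  exact this

lemma cauchyData_risingCoeff {x b : ℝ} (hx : 0 < x) (hb0 : 0 < b) (hb1 : b ≤ 1) :
    CauchyData (risingCoeff (1 - b)) fun n => x + n where
  w_nonneg := risingCoeff_nonneg (by linarith)
  p_pos n := by positivity
  summable := summable_risingCoeff_div hx hb0 hb1
  tendsto := Filter.tendsto_atTop_add_const_left _ _ tendsto_natCast_atTop_atTop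

lemma differentiableAt_cBeta {y : ℂ} (hy : ∀ n : ℕ, y ≠ -n) (b : ℂ) :
    DifferentiableAt ℂ (fun z => cBeta z b) y := by
  have h1 : DifferentiableAt ℂ (fun z => (Complex.Gamma (z + b))⁻¹) y :=
    (Complex.differentiable_one_div_Gamma (y + b)).comp (f := fun z => z + b) y (by fun_prop)
  have h2 := Complex.differentiableAt_Gamma y hy
  exact (h2.mul_const _).mul h1

/-- Partial fractions of the Beta function in its first argument. -/
lemma hasSum_cBeta {y : ℂ} (hy : ∀ n : ℕ, y ≠ -n) {b : ℝ} (hb0 : 0 < b) (hb1 : b ≤ 1) :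
    HasSum (fun n : ℕ => (risingCoeff (1 - b) n : ℂ) / (y + n)) (cBeta y b) := by
  have hD := cauchyData_risingCoeff one_pos hb0 hb1
  let U : Set ℂ := (Set.range fun n : ℕ => (-n : ℂ))ᶜ
  have hUc : IsPreconnected U :=
    ((Set.countable_range _).isPathConnected_compl_of_one_lt_rank (by
      rw [Complex.rank_real_complex]; norm_num)).isConnected.isPreconnected
  have hmem : ∀ z : ℂ, z ∈ U ↔ ∀ n : ℕ, z ≠ -n := fun z => by
    simp only [U, Set.mem_compl_iff, Set.mem_range, not_exists]
    exact forall_congr' fun n => ne_comm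
  have hUo : IsOpen U := by
    have : IsClosed (Set.range fun n : ℕ => (-n : ℂ)) := by
      have h1 : (Set.range fun n : ℕ => (-n : ℂ)) = Neg.neg '' (Set.range fun n : ℕ => (n : ℂ)) := by
        rw [← Set.range_comp]; rfl
      rw [h1]
      exact (Homeomorph.neg ℂ).isClosedMap _ (by
        have h2 := (Complex.isometry_ofReal.isClosedEmbedding.comp
          Nat.isClosedEmbedding_coe_real).isClosed_range
        convert h2 using 2
        funext n
        simp)
    exact this.isOpen_compl
  have hpole : ∀ z ∈ U, ∀ n, risingCoeff (1 - b) n ≠ 0 → 1 - z ≠ ((1 + n : ℝ) : ℂ) := by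
    intro z hz n _ h
    refine (hmem z).mp hz n ?_
    push_cast at h
    linear_combination -h
  have hser : ∀ z, cauchySeries (risingCoeff (1 - b)) (fun n => 1 + n) (1 - z)
      = ∑' n : ℕ, (risingCoeff (1 - b) n : ℂ) / (z + n) := fun z => by
    rw [cauchySeries]
    refine tsum_congr fun n => ?_
    push_cast
    congr 1
    ring
  have hf : DifferentiableOn ℂ (fun z => cauchySeries (risingCoeff (1 - b)) (fun n => 1 + n) (1 - z)) U :=
    fun z hz => ((hD.differentiableAt (hpole z hz)).comp (f := fun z : ℂ => 1 - z) z
      (by fun_prop)).differentiableWithinAt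
  have hg : DifferentiableOn ℂ (fun z => cBeta z b) U := fun z hz =>
    (differentiableAt_cBeta ((hmem z).mp hz) b).differentiableWithinAt
  have h1U : (1 : ℂ) ∈ U := (hmem 1).mpr fun n h => by
    have := congrArg Complex.re h
    simp at this
    have : (0 : ℝ) ≤ n := n.cast_nonneg
    linarith
  have heq := (hf.analyticOnNhd hUo).eqOn_of_preconnected_of_eventuallyEq
    (hg.analyticOnNhd hUo) hUc h1U (by
      have hopen : IsOpen {z : ℂ | 0 < z.re} := isOpen_lt continuous_const Complex.continuous_re
      filter_upwards [hopen.mem_nhds (by simp : (1 : ℂ) ∈ {z : ℂ | 0 < z.re})] with z hz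
      rw [hser]
      exact (hasSum_cBeta_of_re_pos hz hb0 hb1).tsum_eq)
  have hyU := (hmem y).mpr hy
  have hs := hD.summable_term (hpole y hyU)
  have h2 : (fun n : ℕ => (risingCoeff (1 - b) n : ℂ) / (((1 + n : ℝ) : ℂ) - (1 - y)))
      = fun n : ℕ => (risingCoeff (1 - b) n : ℂ) / (y + n) := by
    funext n
    push_cast
    congr 1
    ring
  rw [h2] at hs
  have h3 := heq hyU
  simp only [hser] at h3
  rw [← h3]
  exact hs.hasSum

lemma cBeta_eq_mul_add_one (x : ℂ) {b : ℂ} (hb : b ≠ 0) :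
    cBeta x b = (x + b) / b * cBeta x (b + 1) := by
  unfold cBeta
  rw [Complex.Gamma_add_one b hb, ← add_assoc]
  by_cases h : x + b = 0
  · simp [h, Complex.Gamma_zero]
  · rw [Complex.Gamma_add_one _ h]
    by_cases hG : Complex.Gamma (x + b) = 0
    · simp [hG]
    · field_simp

lemma hasSum_cBeta_sub {x y : ℂ} (hx : ∀ n : ℕ, x ≠ -n) (hy : ∀ n : ℕ, y ≠ -n) {b : ℝ}
    (hb0 : b ≠ 0) (hb : -1 < b) (hb1 : b ≤ 1) :
    HasSum (fun n : ℕ => (risingCoeff (1 - b) n : ℂ) * (1 / (x + n) - 1 / (y + n)))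
      (cBeta x b - cBeta y b) := by
  rcases lt_or_gt_of_ne hb0 with hneg | hpos
  · have hbC : (b : ℂ) ≠ 0 := by exact_mod_cast hb0
    have hb' : (b : ℂ) + 1 = ((b + 1 : ℝ) : ℂ) := by push_cast; rfl
    rw [cBeta_eq_mul_add_one x hbC, cBeta_eq_mul_add_one y hbC, hb']
    have h1 := (hasSum_cBeta hx (b := b + 1) (by linarith) (by linarith)).mul_left ((x + b) / b)
    have h2 := (hasSum_cBeta hy (b := b + 1) (by linarith) (by linarith)).mul_left ((y + b) / b)
    refine (h1.sub h2).congr_fun fun n => ?_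
    have h3 := mul_risingCoeff_add_one (-b) n
    have h4 : (risingCoeff (1 - b) n : ℂ) = risingCoeff (1 - (b + 1)) n * (b - n) / b := by
      rw [show -b + 1 = 1 - b by ring] at h3
      rw [show 1 - (b + 1) = -b by ring, eq_div_iff hbC]
      have := congrArg (Complex.ofReal) h3
      push_cast at this
      linear_combination -this
    have hxn : x + n ≠ 0 := fun h => hx n (by linear_combination h)
    have hyn : y + n ≠ 0 := fun h => hy n (by linear_combination h)
    rw [h4]
    field_simp
    ring
  · refine ((hasSum_cBeta hx hpos hb1).sub (hasSum_cBeta hy hpos hb1)).congr_fun fun n => ?_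
    ring

lemma summable_risingCoeff_div_sq {x b : ℝ} (hx : 0 < x) (hb0 : b ≠ 0) (hb : -1 < b)
    (hb1 : b ≤ 1) : Summable fun n : ℕ => risingCoeff (1 - b) n / (x + n) ^ 2 := by
  rcases lt_or_gt_of_ne hb0 with hneg | hpos
  · have h := (summable_risingCoeff_div hx (b := b + 1) (by linarith) (by linarith)).mul_left
      (1 + 1 / (-b) + 1 / (-b) / x)
    refine h.of_nonneg_of_le (fun n => ?_) fun n => ?_
    · have := risingCoeff_nonneg (a := 1 - b) (by linarith) n
      positivity
    · have h3 := mul_risingCoeff_add_one (-b) n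
      rw [show -b + 1 = 1 - b by ring] at h3
      have hnn := risingCoeff_nonneg (a := 1 - (b + 1)) (by linarith) n
      rw [show 1 - (b + 1) = -b by ring] at *
      have hb' : 0 < -b := by linarith
      have h4 : risingCoeff (1 - b) n = risingCoeff (-b) n * (-b + n) / (-b) := by
        rw [eq_div_iff hb'.ne']; linarith
      have hn : (0 : ℝ) ≤ n := n.cast_nonneg
      have hxn : 0 < x + n := by positivity
      have h5 : (-b + n) / (-b) ≤ (1 + 1 / (-b) + 1 / (-b) / x) * (x + n) := by
        have e1 : (-b + n) / (-b) = 1 + n / (-b) := by rw [add_div, div_self hb'.ne']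
        have e2 : (1 + 1 / (-b) + 1 / (-b) / x) * (x + n)
          = x + n + (x + n) / (-b) + 1 / (-b) + n / (-b) / x := by field_simp; ring
        have e3 : (x + n) / (-b) = x / (-b) + n / (-b) := by ring
        have e4 : 1 ≤ 1 / (-b) := by rw [le_div_iff₀ hb']; linarith
        have e5 : 0 ≤ n / (-b) / x := by positivity
        have e6 : 0 ≤ x / (-b) := by positivity
        rw [e1, e2, e3]
        linarith
      rw [h4, div_le_iff₀ (by positivity)]
      calc risingCoeff (-b) n * (-b + n) / (-b) = risingCoeff (-b) n * ((-b + n) / (-b)) := by ring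
        _ ≤ risingCoeff (-b) n * ((1 + 1 / (-b) + 1 / (-b) / x) * (x + n)) := by gcongr
        _ = _ := by field_simp
  · refine ((summable_risingCoeff_div hx hpos hb1).mul_right (1 / x)).of_nonneg_of_le
      (fun n => ?_) fun n => ?_
    all_goals have := risingCoeff_nonneg (a := 1 - b) (by linarith) n
    · positivity
    · have hn : (0 : ℝ) ≤ n := n.cast_nonneg
      rw [div_mul_div_comm, mul_one]
      gcongr
      nlinarith

/-- The measure `c e^{-r y} dy` on the positive half-line. -/
def expTilt (c r : ℝ) : Measure ℝ :=
  (volume.restrict (Ioi 0)).withDensity fun y => ENNReal.ofReal (c * Real.exp (-r * y))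

lemma measurable_expTilt_density (c r : ℝ) :
    Measurable fun y : ℝ => ENNReal.ofReal (c * Real.exp (-r * y)) := by fun_prop

lemma integral_expTilt {c : ℝ} (hc : 0 ≤ c) (r : ℝ) (g : ℝ → ℂ) :
    ∫ y, g y ∂expTilt c r = ∫ y in Ioi (0 : ℝ), ((c * Real.exp (-r * y) : ℝ) : ℂ) * g y := by
  rw [expTilt, integral_withDensity_eq_integral_toReal_smul (measurable_expTilt_density c r)
    (Filter.Eventually.of_forall fun _ => ENNReal.ofReal_lt_top)]
  refine integral_congr_ae (Filter.Eventually.of_forall fun y => ?_)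
  simp only [ENNReal.toReal_ofReal (mul_nonneg hc (Real.exp_pos _).le), Complex.real_smul]

lemma integral_exp_expTilt {c r : ℝ} (hc : 0 ≤ c) {z : ℂ} (hz : 0 < r + z.re) :
    ∫ y, Complex.exp (-z * y) ∂expTilt c r = c / (r + z) := by
  rw [integral_expTilt hc]
  have h1 : ∀ y : ℝ, ((c * Real.exp (-r * y) : ℝ) : ℂ) * Complex.exp (-z * y)
      = c * Complex.exp (-(r + z) * y) := fun y => by
    push_cast
    rw [mul_assoc, ← Complex.exp_add]
    ring_nf
  simp_rw [h1]
  rw [integral_const_mul, integral_exp_mul_complex_Ioi (by simp; linarith)]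
  rw [Complex.ofReal_zero, mul_zero, Complex.exp_zero, neg_div_neg_eq, mul_one_div]

lemma ae_expTilt_pos (c r : ℝ) : ∀ᵐ y ∂expTilt c r, 0 < y :=
  (withDensity_absolutelyContinuous _ _).ae_le (ae_restrict_mem measurableSet_Ioi)

lemma lintegral_expTilt_le {c r : ℝ} (hc : 0 ≤ c) (hr : 0 < r) :
    ∫⁻ y, ENNReal.ofReal y ∂expTilt c r = ENNReal.ofReal (c / r ^ 2) := by
  rw [expTilt, lintegral_withDensity_eq_lintegral_mul _ (measurable_expTilt_density c r) (by fun_prop)]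
  have hi : IntegrableOn (fun y : ℝ => y ^ (2 - 1 : ℝ) * Real.exp (-(r * y))) (Ioi 0) := by
    have := integrableOn_rpow_mul_exp_neg_mul_rpow (s := 1) (p := 1) (b := r) (by norm_num)
      one_pos hr
    norm_num at this ⊢
    exact this
  have h1 : ∫ y in Ioi (0 : ℝ), y ^ (2 - 1 : ℝ) * Real.exp (-(r * y)) = (1 / r) ^ (2 : ℝ) * Real.Gamma 2 :=
    Real.integral_rpow_mul_exp_neg_mul_Ioi (by norm_num) hr
  calc ∫⁻ y in Ioi (0 : ℝ), ((fun y => ENNReal.ofReal (c * Real.exp (-r * y))) * fun y => ENNReal.ofReal y) y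
      = ∫⁻ y in Ioi (0 : ℝ), ENNReal.ofReal (c * (y ^ (2 - 1 : ℝ) * Real.exp (-(r * y)))) := by
        refine setLIntegral_congr_fun measurableSet_Ioi fun y _ => ?_
        simp only [Pi.mul_apply]
        rw [← ENNReal.ofReal_mul (by positivity)]
        norm_num
        ring_nf
    _ = ENNReal.ofReal (∫ y in Ioi (0 : ℝ), c * (y ^ (2 - 1 : ℝ) * Real.exp (-(r * y)))) := by
        rw [ofReal_integral_eq_lintegral_ofReal (hi.const_mul c)]
        filter_upwards [ae_restrict_mem measurableSet_Ioi] with y hy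
        exact mul_nonneg hc (mul_nonneg (Real.rpow_nonneg (le_of_lt hy) _) (Real.exp_pos _).le)
    _ = _ := by
        rw [integral_const_mul, h1]
        norm_num
        ring_nf

/-- `Φ(z) = k + δ z + ∫ (1 - e^{-z y}) ν(dy)` on the closed right half-plane. -/
structure BernsteinRep (k δ : ℝ) (ν : Measure ℝ) (Φ : ℂ → ℂ) : Prop where
  k_nonneg : 0 ≤ k
  δ_nonneg : 0 ≤ δ
  sfinite : SFinite ν
  ne_zero : ν ≠ 0
  ae_pos : ∀ᵐ y ∂ν, 0 < y
  integrable : Integrable (fun y => min 1 y) ν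
  eq : ∀ z : ℂ, 0 ≤ z.re → Φ z = k + δ * z + ∫ y, (1 - Complex.exp (-z * y)) ∂ν

lemma norm_one_sub_exp_le {z : ℂ} (hz : 0 ≤ z.re) {y : ℝ} (hy : 0 < y) :
    ‖1 - Complex.exp (-z * y)‖ ≤ 2 * (1 + ‖z‖) * min 1 y := by
  have h1 : ‖1 - Complex.exp (-z * y)‖ ≤ 2 := by
    refine (norm_sub_le _ _).trans ?_
    have : ‖Complex.exp (-z * y)‖ ≤ 1 := by
      rw [Complex.norm_exp, Real.exp_le_one_iff]
      simp
      positivity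
    rw [norm_one]
    linarith
  have h2 : ‖1 - Complex.exp (-z * y)‖ ≤ 2 * (‖z‖ * y) := by
    have hn : ‖-z * (y : ℂ)‖ = ‖z‖ * y := by
      rw [norm_mul, norm_neg, Complex.norm_real, Real.norm_of_nonneg hy.le]
    rcases le_or_gt (‖z‖ * y) 1 with h | h
    · have := Complex.norm_exp_sub_one_le (x := -z * y) (by rw [hn]; exact h)
      rw [norm_sub_rev, ← hn]
      exact this
    · linarith
  have hz0 := norm_nonneg z
  rcases le_total 1 y with h | h
  · rw [min_eq_left h]; nlinarith
  · rw [min_eq_right h]; nlinarith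

lemma integrable_one_sub_exp {ν : Measure ℝ} (hpos : ∀ᵐ y ∂ν, 0 < y)
    (hi : Integrable (fun y => min 1 y) ν) {z : ℂ} (hz : 0 ≤ z.re) :
    Integrable (fun y : ℝ => 1 - Complex.exp (-z * y)) ν := by
  refine (hi.const_mul (2 * (1 + ‖z‖))).mono' ?_ ?_
  · exact Continuous.aestronglyMeasurable (by fun_prop)
  · filter_upwards [hpos] with y hy using norm_one_sub_exp_le hz hy

/-- The restriction of a Bernstein function to the real line. -/
def bernsteinReal (k δ : ℝ) (ν : Measure ℝ) (x : ℝ) : ℝ :=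
  k + δ * x + ∫ y, (1 - Real.exp (-x * y)) ∂ν

namespace BernsteinRep
variable {k δ : ℝ} {ν : Measure ℝ} {Φ : ℂ → ℂ}

lemma norm_le (h : BernsteinRep k δ ν Φ) {z : ℂ} (hz : 0 ≤ z.re) :
    ‖Φ z‖ ≤ (k + δ + 2 * ∫ y, min 1 y ∂ν) * (1 + ‖z‖) := by
  have hInt : ‖∫ y, (1 - Complex.exp (-z * y)) ∂ν‖ ≤ 2 * (1 + ‖z‖) * ∫ y, min 1 y ∂ν := by
    rw [← integral_const_mul]
    refine norm_integral_le_of_norm_le (h.integrable.const_mul _) ?_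
    filter_upwards [h.ae_pos] with y hy using norm_one_sub_exp_le hz hy
  rw [h.eq z hz]
  have hk := h.k_nonneg
  have hδ := h.δ_nonneg
  have h1 : ‖(k : ℂ) + δ * z‖ ≤ k + δ * ‖z‖ := by
    refine (norm_add_le _ _).trans ?_
    rw [norm_mul, Complex.norm_real, Complex.norm_real, Real.norm_of_nonneg hk,
      Real.norm_of_nonneg hδ]
  refine (norm_add_le _ _).trans ?_
  nlinarith [mul_nonneg hk (norm_nonneg z)]

lemma ofReal_eq (h : BernsteinRep k δ ν Φ) {x : ℝ} (hx : 0 ≤ x) :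
    Φ x = (bernsteinReal k δ ν x : ℂ) := by
  rw [h.eq x (by simpa using hx), bernsteinReal]
  push_cast
  rw [← integral_complex_ofReal]
  push_cast
  rfl

lemma integrable_real (h : BernsteinRep k δ ν Φ) {x : ℝ} (hx : 0 ≤ x) :
    Integrable (fun y : ℝ => 1 - Real.exp (-x * y)) ν := by
  have := (integrable_one_sub_exp h.ae_pos h.integrable (z := x) (by simpa using hx)).re
  refine this.congr (Filter.Eventually.of_forall fun y => ?_)
  simp only [RCLike.re_to_complex]
  rw [show -(x : ℂ) * y = ((-x * y : ℝ) : ℂ) by push_cast; rfl, Complex.sub_re, Complex.exp_ofReal_re,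
    Complex.one_re]

lemma real_nonneg (h : BernsteinRep k δ ν Φ) {x : ℝ} (hx : 0 ≤ x) : 0 ≤ bernsteinReal k δ ν x := by
  have h1 := h.k_nonneg
  have h2 := h.δ_nonneg
  have h3 : 0 ≤ ∫ y, (1 - Real.exp (-x * y)) ∂ν := by
    refine integral_nonneg_of_ae ?_
    filter_upwards [h.ae_pos] with y hy
    rw [Pi.zero_apply, sub_nonneg, Real.exp_le_one_iff]
    nlinarith
  unfold bernsteinReal
  positivity

lemma real_mono (h : BernsteinRep k δ ν Φ) {s t : ℝ} (hs : 0 ≤ s) (hst : s ≤ t) :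
    bernsteinReal k δ ν s ≤ bernsteinReal k δ ν t := by
  have h2 := h.δ_nonneg
  have h3 : ∫ y, (1 - Real.exp (-s * y)) ∂ν ≤ ∫ y, (1 - Real.exp (-t * y)) ∂ν := by
    refine integral_mono_ae (h.integrable_real hs) (h.integrable_real (hs.trans hst)) ?_
    filter_upwards [h.ae_pos] with y hy
    have : Real.exp (-t * y) ≤ Real.exp (-s * y) := Real.exp_le_exp.mpr (by nlinarith)
    linarith
  unfold bernsteinReal
  nlinarith [mul_le_mul_of_nonneg_left hst h2]

/-- Concavity together with nonnegativity, in the form used for difference quotients. -/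
lemma real_sub_mul_le (h : BernsteinRep k δ ν Φ) {r s t : ℝ} (hr : 0 ≤ r) (hrs : r < s)
    (hst : s ≤ t) : (s - r) * bernsteinReal k δ ν t ≤ (t - r) * bernsteinReal k δ ν s := by
  have h1 := h.k_nonneg
  have h2 := h.δ_nonneg
  have h3 : (s - r) * ∫ y, (1 - Real.exp (-t * y)) ∂ν
      ≤ (t - r) * ∫ y, (1 - Real.exp (-s * y)) ∂ν := by
    rw [← integral_const_mul, ← integral_const_mul]
    refine integral_mono_ae ((h.integrable_real (by linarith)).const_mul _)
      ((h.integrable_real (by linarith)).const_mul _) ?_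
    filter_upwards [h.ae_pos] with y hy
    have hb : 0 < t - r := by linarith
    have hc := convexOn_exp.2 (Set.mem_univ (-t * y)) (Set.mem_univ (-r * y))
      (show 0 ≤ (s - r) / (t - r) from div_nonneg (by linarith) hb.le)
      (show 0 ≤ (t - s) / (t - r) from div_nonneg (by linarith) hb.le) (by field_simp; ring)
    simp only [smul_eq_mul] at hc
    have e1 : (s - r) / (t - r) * (-t * y) + (t - s) / (t - r) * (-r * y) = -s * y := by
      field_simp
      ring
    have e2 : Real.exp (-r * y) ≤ 1 := Real.exp_le_one_iff.mpr (by nlinarith)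
    rw [e1] at hc
    have e3 : (t - r) * Real.exp (-s * y)
        ≤ (s - r) * Real.exp (-t * y) + (t - s) * Real.exp (-r * y) := by
      calc (t - r) * Real.exp (-s * y) ≤ (t - r) * ((s - r) / (t - r) * Real.exp (-t * y)
            + (t - s) / (t - r) * Real.exp (-r * y)) := by gcongr
        _ = _ := by field_simp
    nlinarith [mul_le_mul_of_nonneg_left e2 (sub_nonneg.mpr hst)]
  unfold bernsteinReal
  nlinarith [mul_le_mul_of_nonneg_left hst h1, mul_nonneg (mul_nonneg h2 hr) (sub_nonneg.mpr hst)]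

end BernsteinRep

/-- The poles `β(1-α+γ+n)` of `s ↦ Φ(-s)`. -/
def betaPole (α β γ : ℝ) (n : ℕ) : ℝ := β * (1 - α + γ + n)

/-- The weights in the partial fraction expansion of `s ↦ Φ(-s)`. -/
def betaWeight (c α β γ : ℝ) (n : ℕ) : ℝ := c * risingCoeff (1 + γ) n / betaPole α β γ n

section
variable {k δ c α β γ : ℝ}

lemma betaPole_pos (hβ : 0 < β) (hα : 0 < 1 - α + γ) (n : ℕ) : 0 < betaPole α β γ n := by
  unfold betaPole; positivity

lemma cauchyData_beta (hβ : 0 < β) (hc : 0 < c) (hα : 0 < 1 - α + γ) (h0 : γ ≠ 0) (h1 : γ < 1)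
    (h2 : -1 ≤ γ) : CauchyData (betaWeight c α β γ) (betaPole α β γ) where
  w_nonneg n := div_nonneg (mul_nonneg hc.le (risingCoeff_nonneg (by linarith) n))
    (betaPole_pos hβ hα n).le
  p_pos := betaPole_pos hβ hα
  summable := by
    have h := (summable_risingCoeff_div_sq hα (b := -γ) (by simpa using h0) (by linarith)
      (by linarith)).mul_left (c / β ^ 2)
    refine h.congr fun n => ?_
    have : 1 - α + γ + n ≠ 0 := by positivity
    rw [betaWeight, betaPole, sub_neg_eq_add]
    field_simp
  tendsto := by
    unfold betaPole
    exact (Filter.tendsto_atTop_add_const_left _ _ tendsto_natCast_atTop_atTop).const_mul_atTop hβ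

lemma ofReal_add_ne_neg_natCast (hβ : 0 < β) {s : ℂ} (hs : ∀ n, s ≠ betaPole α β γ n) (n : ℕ) :
    ((1 - α + γ : ℝ) : ℂ) + -s / β ≠ -n := by
  intro h
  apply hs n
  have hb : (β : ℂ) ≠ 0 := by exact_mod_cast hβ.ne'
  rw [betaPole]
  field_simp at h
  push_cast at h ⊢
  linear_combination -h

lemma ofReal_ne_neg_natCast {x : ℝ} (hx : 0 < x) (n : ℕ) : (x : ℂ) ≠ -n := by
  intro h
  have := congrArg Complex.re h
  simp at this
  have : (0 : ℝ) ≤ n := n.cast_nonneg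
  linarith

lemma hasSum_betaSub_neg (hβ : 0 < β) (hα : 0 < 1 - α + γ) (h0 : γ ≠ 0) (h1 : γ < 1)
    (h2 : -1 ≤ γ) {s : ℂ} (hs : ∀ n, s ≠ betaPole α β γ n) :
    HasSum (fun n => (c * risingCoeff (1 + γ) n : ℂ)
        * (1 / (betaPole α β γ n : ℂ) - 1 / (betaPole α β γ n - s)))
      (betaSubLaplaceExponent k δ c α β γ (-s) - k + δ * s) := by
  have h := (hasSum_cBeta_sub (ofReal_ne_neg_natCast hα) (ofReal_add_ne_neg_natCast hβ hs)
    (b := -γ) (by simpa using h0) (by linarith) (by linarith)).mul_left ((c : ℂ) / β)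
  have hb : (β : ℂ) ≠ 0 := by exact_mod_cast hβ.ne'
  have e0 : betaSubLaplaceExponent k δ c α β γ (-s) - k + δ * s = (c : ℂ) / β *
      (cBeta ((1 - α + γ : ℝ) : ℂ) ((-γ : ℝ) : ℂ)
        - cBeta (((1 - α + γ : ℝ) : ℂ) + -s / β) ((-γ : ℝ) : ℂ)) := by
    rw [betaSubLaplaceExponent]
    ring
  rw [e0]
  refine h.congr_fun fun n => ?_
  · have e1 : ((1 - α + γ : ℝ) : ℂ) + n ≠ 0 := by
      have := ofReal_ne_neg_natCast hα n
      intro h; apply this; linear_combination h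
    have e2 : ((1 - α + γ : ℝ) : ℂ) + -s / β + n ≠ 0 := by
      have := ofReal_add_ne_neg_natCast hβ hs n
      intro h; apply this; linear_combination h
    have e3 : (betaPole α β γ n : ℂ) = β * (((1 - α + γ : ℝ) : ℂ) + n) := by
      rw [betaPole]; push_cast; ring
    have e4 : β * (((1 - α + γ : ℝ) : ℂ) + n) - s = β * (((1 - α + γ : ℝ) : ℂ) + -s / β + n) := by
      field_simp
      ring
    rw [e3, e4, sub_neg_eq_add]
    field_simp

lemma betaSub_neg_eq (hβ : 0 < β) (hα : 0 < 1 - α + γ) (h0 : γ ≠ 0)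
    (h1 : γ < 1) (h2 : -1 ≤ γ) {s : ℂ} (hs : ∀ n, s ≠ betaPole α β γ n) :
    betaSubLaplaceExponent k δ c α β γ (-s)
      = k - δ * s - s * cauchySeries (betaWeight c α β γ) (betaPole α β γ) s := by
  have h := (hasSum_betaSub_neg (k := k) (δ := δ) (c := c) hβ hα h0 h1 h2 hs).tsum_eq
  have : (-s) * cauchySeries (betaWeight c α β γ) (betaPole α β γ) s
      = betaSubLaplaceExponent k δ c α β γ (-s) - k + δ * s := by
    rw [← h, cauchySeries, ← tsum_mul_left]
    refine tsum_congr fun n => ?_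
    have e1 : (betaPole α β γ n : ℂ) ≠ 0 := by exact_mod_cast (betaPole_pos hβ hα n).ne'
    have e2 : (betaPole α β γ n : ℂ) - s ≠ 0 := sub_ne_zero.mpr (hs n).symm
    rw [betaWeight]
    push_cast
    field_simp
    ring
  linear_combination -this

lemma betaSub_differentiableAt (hβ : 0 < β) {z : ℂ} (hs : ∀ n, -z ≠ betaPole α β γ n) :
    DifferentiableAt ℂ (betaSubLaplaceExponent k δ c α β γ) z := by
  have h1 := ofReal_add_ne_neg_natCast hβ hs
  rw [neg_neg] at h1
  have h2 : DifferentiableAt ℂ (fun z : ℂ => cBeta (((1 - α + γ : ℝ) : ℂ) + z / β) ((-γ : ℝ) : ℂ)) z :=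
    (differentiableAt_cBeta h1 _).comp (f := fun z : ℂ => ((1 - α + γ : ℝ) : ℂ) + z / β) z
      (by fun_prop)
  unfold betaSubLaplaceExponent
  fun_prop

lemma betaSub_differentiableAt_of_re (hβ : 0 < β) {z : ℂ}
    (hz : -(β * (1 - α + γ)) < z.re) :
    DifferentiableAt ℂ (betaSubLaplaceExponent k δ c α β γ) z := by
  refine betaSub_differentiableAt hβ fun n h => ?_
  have := congrArg Complex.re h
  simp only [Complex.neg_re, Complex.ofReal_re, betaPole] at this
  nlinarith [mul_nonneg hβ.le n.cast_nonneg]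

end

lemma integrableOn_cBeta {u : ℂ} {v : ℝ} (hu : 0 < u.re) (hv : 0 < v) :
    IntegrableOn (fun t : ℝ => (t : ℂ) ^ (u - 1) * (((1 - t) ^ (v - 1) : ℝ) : ℂ)) (Ioo 0 1) := by
  refine (integrableOn_beta hu hv).mono' ?_ ?_
  · refine AEMeasurable.aestronglyMeasurable (Measurable.aemeasurable ?_)
    fun_prop
  · filter_upwards [ae_restrict_mem measurableSet_Ioo] with t ht
    rw [norm_mul, Complex.norm_cpow_eq_rpow_re_of_pos ht.1, Complex.norm_real,
      Real.norm_of_nonneg (Real.rpow_nonneg (by linarith [ht.2]) _)]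
    simp

/-- The jump measure of a beta-subordinator with finite activity, as an image of a beta density. -/
def betaJump (c α β γ : ℝ) : Measure ℝ :=
  (((volume.restrict (Ioo 0 1)).withDensity fun t =>
    ENNReal.ofReal (c / β * (t ^ (1 - α + γ - 1) * (1 - t) ^ (-γ - 1))))).map fun t => -Real.log t / β

section
variable {k δ c α β γ : ℝ}

lemma ae_betaJump_pos (hβ : 0 < β) : ∀ᵐ y ∂betaJump c α β γ, 0 < y := by
  rw [betaJump, ae_map_iff (by fun_prop) measurableSet_Ioi]
  refine (withDensity_absolutelyContinuous _ _).ae_le ?_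
  filter_upwards [ae_restrict_mem measurableSet_Ioo] with t ht
  exact div_pos (neg_pos.mpr (Real.log_neg ht.1 ht.2)) hβ

lemma integral_betaJump (hβ : 0 < β) (hc : 0 < c) {g : ℝ → ℂ} (hg : Measurable g) :
    ∫ y, g y ∂betaJump c α β γ = ∫ t in Ioo (0 : ℝ) 1,
      ((c / β * (t ^ (1 - α + γ - 1) * (1 - t) ^ (-γ - 1)) : ℝ) : ℂ) * g (-Real.log t / β) := by
  rw [betaJump, integral_map (by fun_prop) hg.aestronglyMeasurable,
    integral_withDensity_eq_integral_toReal_smul (by fun_prop)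
    (Filter.Eventually.of_forall fun _ => ENNReal.ofReal_lt_top)]
  refine setIntegral_congr_fun measurableSet_Ioo fun t ht => ?_
  have h1 : 0 ≤ t ^ (1 - α + γ - 1) := Real.rpow_nonneg ht.1.le _
  have h2 : 0 ≤ (1 - t) ^ (-γ - 1) := Real.rpow_nonneg (by linarith [ht.2]) _
  simp only [Complex.real_smul]
  rw [ENNReal.toReal_ofReal (by positivity)]

lemma isFiniteMeasure_betaJump (hα : 0 < 1 - α + γ) (hγ : γ < 0) :
    IsFiniteMeasure (betaJump c α β γ) := by
  have hi := (integrableOn_beta hα (v := -γ) (by linarith)).const_mul (c / β)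
  have : IsFiniteMeasure ((volume.restrict (Ioo (0 : ℝ) 1)).withDensity fun t =>
      ENNReal.ofReal (c / β * (t ^ (1 - α + γ - 1) * (1 - t) ^ (-γ - 1)))) :=
    isFiniteMeasure_withDensity_ofReal hi.2
  unfold betaJump
  infer_instance

lemma bernsteinRep_betaJump (hβ : 0 < β) (hc : 0 < c) (hα : 0 < 1 - α + γ) (hγ : γ < 0)
    (hk : 0 ≤ k) (hδ : 0 ≤ δ) :
    BernsteinRep k δ (betaJump c α β γ) (betaSubLaplaceExponent k δ c α β γ) where
  k_nonneg := hk
  δ_nonneg := hδ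
  sfinite := by
    have := isFiniteMeasure_betaJump (c := c) (β := β) hα hγ
    infer_instance
  ae_pos := ae_betaJump_pos hβ
  ne_zero := by
    intro h
    rw [betaJump, Measure.map_eq_zero_iff (by fun_prop),
      withDensity_eq_zero_iff (by fun_prop), Filter.EventuallyEq,
      ae_restrict_iff' measurableSet_Ioo] at h
    have h2 : volume (Ioo (0 : ℝ) 1) = 0 := by
      refine measure_mono_null (fun t ht => ?_) (ae_iff.mp h)
      have h1 : 0 < t ^ (1 - α + γ - 1) := Real.rpow_pos_of_pos ht.1 _
      have h2 : 0 < (1 - t) ^ (-γ - 1) := Real.rpow_pos_of_pos (by linarith [ht.2]) _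
      have h3 : 0 < c / β * (t ^ (1 - α + γ - 1) * (1 - t) ^ (-γ - 1)) := by positivity
      simp only [mem_ofPred_eq, Classical.not_imp, Pi.zero_apply, ENNReal.ofReal_eq_zero, not_le]
      exact ⟨ht, h3⟩
    simp at h2
  integrable := by
    have := isFiniteMeasure_betaJump (c := c) (β := β) hα hγ
    refine (integrable_const (1 : ℝ)).mono' (by fun_prop) ?_
    filter_upwards [ae_betaJump_pos hβ] with y hy
    rw [Real.norm_of_nonneg (by positivity)]
    exact min_le_left _ _
  eq z hz := by
    have hb : (β : ℂ) ≠ 0 := by exact_mod_cast hβ.ne'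
    have hre : 0 < (((1 - α + γ : ℝ) : ℂ) + z / β).re := by
      rw [Complex.add_re, Complex.ofReal_re, Complex.div_ofReal_re]
      positivity
    rw [integral_betaJump hβ hc (by fun_prop), betaSubLaplaceExponent, cBeta, cBeta,
      cBeta_integral (by simpa using hα) (by linarith), cBeta_integral hre (by linarith)]
    rw [← integral_sub, ← integral_const_mul]
    · congr 1
      refine setIntegral_congr_fun measurableSet_Ioo fun t ht => ?_
      have ht0 : (t : ℂ) ≠ 0 := by exact_mod_cast ht.1.ne'
      have e1 : (t : ℂ) ^ (((1 - α + γ : ℝ) : ℂ) + z / β - 1)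
          = (t : ℂ) ^ (((1 - α + γ : ℝ) : ℂ) - 1) * (t : ℂ) ^ (z / β) := by
        rw [← Complex.cpow_add _ _ ht0]; ring_nf
      have e2 : (t : ℂ) ^ (((1 - α + γ : ℝ) : ℂ) - 1) = ((t ^ (1 - α + γ - 1) : ℝ) : ℂ) := by
        rw [Complex.ofReal_cpow ht.1.le]; push_cast; rfl
      have e3 : (t : ℂ) ^ (z / β) = Complex.exp (-z * ((-Real.log t / β : ℝ) : ℂ)) := by
        rw [Complex.cpow_def_of_ne_zero ht0, ← Complex.ofReal_log ht.1.le]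
        congr 1
        push_cast
        ring
      simp only [e1, e2, e3]
      push_cast
      ring
    · exact integrableOn_cBeta (by simpa using hα) (by linarith)
    · exact integrableOn_cBeta hre (by linarith)

end

lemma isFiniteMeasure_expTilt {c r : ℝ} (hr : 0 < r) : IsFiniteMeasure (expTilt c r) :=
  isFiniteMeasure_withDensity_ofReal ((exp_neg_integrableOn_Ioi 0 hr).const_mul c).2

/-- The jump measure of a beta-subordinator with infinite activity, as a mixture of exponentials. -/
def betaMixture (c α β γ : ℝ) : Measure ℝ :=
  Measure.sum fun n => expTilt (c * risingCoeff (1 + γ) n) (betaPole α β γ n)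

section
variable {k δ c α β γ : ℝ}

lemma bernsteinRep_betaMixture (hβ : 0 < β) (hc : 0 < c) (hα : 0 < 1 - α + γ) (hγ : 0 < γ)
    (hγ1 : γ < 1) (hk : 0 ≤ k) (hδ : 0 ≤ δ) :
    BernsteinRep k δ (betaMixture c α β γ) (betaSubLaplaceExponent k δ c α β γ) := by
  have hcoef : ∀ n, 0 ≤ c * risingCoeff (1 + γ) n := fun n =>
    mul_nonneg hc.le (risingCoeff_nonneg (by linarith) n)
  have hp := betaPole_pos hβ hα
  have hae : ∀ᵐ y ∂betaMixture c α β γ, 0 < y := by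
    rw [betaMixture, Measure.ae_sum_iff]
    exact fun n => ae_expTilt_pos _ _
  have hInt : Integrable (fun y : ℝ => y) (betaMixture c α β γ) := by
    refine ⟨by fun_prop, ?_⟩
    rw [hasFiniteIntegral_iff_norm]
    have : ∫⁻ y, ENNReal.ofReal ‖y‖ ∂betaMixture c α β γ
        = ∫⁻ y, ENNReal.ofReal y ∂betaMixture c α β γ := by
      refine lintegral_congr_ae ?_
      filter_upwards [hae] with y hy
      rw [Real.norm_of_nonneg hy.le]
    rw [this, betaMixture, lintegral_sum_measure]
    simp_rw [fun n => lintegral_expTilt_le (hcoef n) (hp n)]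
    rw [← ENNReal.ofReal_tsum_of_nonneg (fun n => div_nonneg (hcoef n) (sq_nonneg _))]
    · exact ENNReal.ofReal_lt_top
    · refine (cauchyData_beta hβ hc hα hγ.ne' hγ1 (by linarith)).summable.congr fun n => ?_
      rw [betaWeight, div_div, sq]
  have hmin : Integrable (fun y : ℝ => min 1 y) (betaMixture c α β γ) := by
    refine hInt.mono' (by fun_prop) ?_
    filter_upwards [hae] with y hy
    rw [Real.norm_of_nonneg (by positivity)]
    exact min_le_right _ _
  refine ⟨hk, hδ, ?_, ?_, hae, hmin, fun z hz => ?_⟩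
  · have : ∀ n, SFinite (expTilt (c * risingCoeff (1 + γ) n) (betaPole α β γ n)) := fun n => by
      unfold expTilt; infer_instance
    unfold betaMixture
    infer_instance
  · intro h
    have h1 := (Measure.sum_eq_zero).mp h 0
    have h2 := lintegral_expTilt_le (hcoef 0) (hp 0)
    rw [h1, lintegral_zero_measure] at h2
    have h3 : 0 < c * risingCoeff (1 + γ) 0 / betaPole α β γ 0 ^ 2 := by
      have := hp 0
      simp [risingCoeff]
      positivity
    exact (ENNReal.ofReal_pos.mpr h3).ne h2
  · have hs : ∀ n, -z ≠ betaPole α β γ n := fun n h => by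
      have := congrArg Complex.re h
      simp at this
      linarith [hp n]
    have h1 := hasSum_betaSub_neg (k := k) (δ := δ) (c := c) hβ hα hγ.ne' hγ1 (by linarith) hs
    have h2 := hasSum_integral_measure (integrable_one_sub_exp hae hmin hz)
    have h3 := h1.unique (h2.congr_fun fun n => ?_)
    · rw [neg_neg] at h3
      rw [betaMixture, ← h3]
      ring
    · have e0 := integral_exp_expTilt (hcoef n) (r := betaPole α β γ n) (z := z) (by linarith [hp n])
      have e1 := integral_exp_expTilt (hcoef n) (r := betaPole α β γ n) (z := 0) (by simpa using hp n)
      have i0 : Integrable (fun y : ℝ => 1 - Complex.exp (-z * y))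
          (expTilt (c * risingCoeff (1 + γ) n) (betaPole α β γ n)) :=
        (integrable_one_sub_exp hae hmin hz).mono_measure (Measure.le_sum _ n)
      have := isFiniteMeasure_expTilt (c := c * risingCoeff (1 + γ) n) (hp n)
      have i1 : Integrable (fun _ : ℝ => (1 : ℂ))
          (expTilt (c * risingCoeff (1 + γ) n) (betaPole α β γ n)) := integrable_const _
      have i2 := i1.sub i0
      rw [integral_sub i1 (i2.congr (Filter.Eventually.of_forall fun y => by simp)), e0]
      simp only [neg_zero, zero_mul, Complex.exp_zero, add_zero] at e1
      rw [e1]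
      push_cast
      ring

lemma exists_bernsteinRep (hβ : 0 < β) (hc : 0 < c) (hα : 0 < 1 - α + γ)
    (hγ : γ < 0 ∨ γ ∈ Ioo (0 : ℝ) 1) (hk : 0 ≤ k) (hδ : 0 ≤ δ) :
    ∃ ν, BernsteinRep k δ ν (betaSubLaplaceExponent k δ c α β γ) := by
  rcases hγ with h | h
  · exact ⟨_, bernsteinRep_betaJump hβ hc hα h hk hδ⟩
  · exact ⟨_, bernsteinRep_betaMixture hβ hc hα h.1 h.2 hk hδ⟩

end

/-- The function `q + d s - σ² s² / 2 + Φ₁(-s) φ(s)` on the real line, for `Φ₁(-s)` given by a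
partial fraction expansion. -/
def realExponent (q d σ k δ : ℝ) (w r : ℕ → ℝ) (φ : ℝ → ℝ) (s : ℝ) : ℝ :=
  q + d * s - σ ^ 2 * s ^ 2 / 2 + (k - δ * s - s * ∑' n, w n / (r n - s)) * φ s

lemma realExponent_strict {q d σ k₁ δ₁ k₂ δ₂ : ℝ} {w r : ℕ → ℝ} {ν : Measure ℝ} {Φ : ℂ → ℂ}
    (hq : 0 < q) (hk : 0 ≤ k₁) (hδ : 0 ≤ δ₁) (hw : CauchyData w r) (hΦ : BernsteinRep k₂ δ₂ ν Φ)
    {s t : ℝ} (hs : 0 < s) (hst : s < t) (hpole : ∀ n, w n ≠ 0 → r n < s ∨ t < r n) :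
    s * realExponent q d σ k₁ δ₁ w r (bernsteinReal k₂ δ₂ ν) t
      < t * realExponent q d σ k₁ δ₁ w r (bernsteinReal k₂ δ₂ ν) s := by
  set φ := bernsteinReal k₂ δ₂ ν
  have hs0 : 0 ≤ φ s := hΦ.real_nonneg hs.le
  have hmono : φ s ≤ φ t := hΦ.real_mono hs.le hst.le
  have hs1 : ∀ n, w n ≠ 0 → s ≠ r n := fun n hn => by
    rcases hpole n hn with h | h
    · exact h.ne'
    · exact (hst.trans h).ne
  have ht1 : ∀ n, w n ≠ 0 → t ≠ r n := fun n hn => by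
    rcases hpole n hn with h | h
    · exact (h.trans hst).ne'
    · exact h.ne
  have hsum : (∑' n, w n / (r n - s)) * φ s ≤ (∑' n, w n / (r n - t)) * φ t := by
    rw [← tsum_mul_right, ← tsum_mul_right]
    refine Summable.tsum_le_tsum (fun n => ?_) ((hw.summable_real hs1).mul_right _)
      ((hw.summable_real ht1).mul_right _)
    by_cases hn : w n = 0
    · simp [hn]
    have hwn := hw.w_nonneg n
    rw [div_mul_eq_mul_div, div_mul_eq_mul_div]
    rcases hpole n hn with h | h
    · have := hΦ.real_sub_mul_le (hw.p_pos n).le h hst.le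
      rw [← neg_div_neg_eq, ← neg_div_neg_eq (w n * φ t), div_le_div_iff₀ (by linarith) (by linarith)]
      nlinarith [mul_le_mul_of_nonneg_left this hwn]
    · rw [div_le_div_iff₀ (by linarith) (by linarith)]
      have : φ s * (r n - t) ≤ φ t * (r n - s) := by
        apply mul_le_mul hmono (by linarith) (by linarith) (by linarith)
      nlinarith [mul_le_mul_of_nonneg_left this hwn]
  have hk' := hΦ.real_sub_mul_le le_rfl hs hst.le
  simp only [sub_zero] at hk'
  have h1 := mul_le_mul_of_nonneg_left hk' hk
  have h2 := mul_le_mul_of_nonneg_left hmono (mul_nonneg hδ (mul_nonneg hs.le (hs.trans hst).le))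
  have h3 := mul_le_mul_of_nonneg_left hsum (mul_nonneg hs.le (hs.trans hst).le)
  have h4 : 0 ≤ σ ^ 2 * (s * t) * (t - s) := by
    have := hs.trans hst
    have := sub_pos.mpr hst
    positivity
  have h5 := mul_lt_mul_of_pos_left hst hq
  unfold realExponent
  nlinarith

lemma realExponent_mul_quotient_nonneg {q d σ k₁ δ₁ k₂ δ₂ : ℝ} {w r ζ : ℕ → ℝ} {ν : Measure ℝ}
    {Φ : ℂ → ℂ} (hq : 0 < q) (hk : 0 ≤ k₁) (hδ : 0 ≤ δ₁) (hw : CauchyData w r)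
    (hΦ : BernsteinRep k₂ δ₂ ν Φ) (hI : Interlacing ζ r)
    (hroot : ∀ n, realExponent q d σ k₁ δ₁ w r (bernsteinReal k₂ δ₂ ν) (ζ n) = 0)
    {x : ℝ} (hx : 0 < x) (hxζ : ∀ n, x ≠ ζ n) (hxr : ∀ n, x ≠ r n) :
    0 ≤ realExponent q d σ k₁ δ₁ w r (bernsteinReal k₂ δ₂ ν) x
      * (1 + x * ∑' k, Interlacing.coeff ζ r k / (ζ k - x)) := by
  have hex : ∃ n, x < r n := (hI.tendsto.eventually_gt_atTop x).exists
  have hlt := Nat.find_spec hex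
  have hmin : ∀ m, m < Nat.find hex → r m < x := fun m hm =>
    lt_of_le_of_ne (not_lt.mp (Nat.find_min hex hm)) (hxr m).symm
  set n := Nat.find hex
  have hup : ∀ m, n ≤ m → r n ≤ r m := fun m hm => hI.strictMono_right.monotone hm
  rcases lt_or_gt_of_ne (hxζ n) with h | h
  · have h1 := realExponent_strict (d := d) (σ := σ) hq hk hδ hw hΦ hx h fun m _ => by
      rcases lt_or_ge m n with hm | hm
      · exact Or.inl (hmin m hm)
      · exact Or.inr ((hI.lt n).trans_le (hup m hm))
    rw [hroot, mul_zero] at h1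
    refine mul_nonneg (pos_of_mul_pos_right h1 (hI.pos n).le).le ?_
    rcases Nat.eq_zero_or_eq_succ_pred n with h0 | h0
    · rw [h0] at h
      exact hI.quotient_nonneg_of_lt hx.le h
    · rw [h0] at h
      exact hI.quotient_nonneg_of_mem (hmin _ (by omega)).le h
  · have h1 := realExponent_strict (d := d) (σ := σ) hq hk hδ hw hΦ (hI.pos n) h fun m _ => by
      rcases lt_or_ge m n with hm | hm
      · exact Or.inl (hI.lt_of_lt hm)
      · exact Or.inr (hlt.trans_le (hup m hm))
    rw [hroot, mul_zero] at h1
    have h2 := hI.pos n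
    exact mul_nonneg_of_nonpos_of_nonpos (by nlinarith) (hI.quotient_nonpos_of_mem h hlt.le)

lemma limUnder_punctured_eventuallyEq {H g : ℂ → ℂ} {s : ℂ}
    (hg : ∀ᶠ z in nhds s, ContinuousAt g z) (h : H =ᶠ[nhdsWithin s {s}ᶜ] g) :
    (fun z => Filter.limUnder (nhdsWithin z {z}ᶜ) H) =ᶠ[nhds s] g := by
  have h' : ∀ᶠ z in nhds s, z ≠ s → H z = g z := eventually_nhdsWithin_iff.mp h
  filter_upwards [hg, h'.eventually_nhds] with y hgy hy
  have hev : H =ᶠ[nhdsWithin y {y}ᶜ] g := by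
    rcases eq_or_ne y s with rfl | hys
    · exact h
    · filter_upwards [nhdsWithin_le_nhds hy, nhdsWithin_le_nhds (eventually_ne_nhds hys)] with z hz hzs
      exact hz hzs
  exact Filter.Tendsto.limUnder_eq ((hgy.tendsto.mono_left nhdsWithin_le_nhds).congr' hev.symm)

/-- A simple pole multiplied by a zero is removable. -/
lemma exists_differentiable_extension {U W u v : ℂ → ℂ} {p : ℂ}
    (hU : ∀ᶠ z in nhdsWithin p {p}ᶜ, U z = u z / (p - z) + v z)
    (hW : ∀ᶠ z in nhds p, DifferentiableAt ℂ W z) (hu : ∀ᶠ z in nhds p, DifferentiableAt ℂ u z)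
    (hv : ∀ᶠ z in nhds p, DifferentiableAt ℂ v z) (hp : W p = 0) :
    ∃ g, (∀ᶠ z in nhds p, DifferentiableAt ℂ g z) ∧
      (fun z => U z * W z) =ᶠ[nhdsWithin p {p}ᶜ] g := by
  refine ⟨fun z => -u z * dslope W p z + v z * W z, ?_, ?_⟩
  · obtain ⟨O, hO, hOo, hpO⟩ := eventually_nhds_iff.mp hW
    have hd : DifferentiableOn ℂ (dslope W p) O :=
      (Complex.differentiableOn_dslope (hOo.mem_nhds hpO)).mpr
        fun z hz => (hO z hz).differentiableWithinAt
    filter_upwards [hW, hu, hv, hOo.mem_nhds hpO] with z h1 h2 h3 hz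
    exact (h2.neg.mul (hd.differentiableAt (hOo.mem_nhds hz))).add (h3.mul h1)
  · filter_upwards [hU, self_mem_nhdsWithin] with z hz hne
    have hne' : z - p ≠ 0 := sub_ne_zero.mpr hne
    rw [hz, dslope_of_ne _ hne, slope_def_field, hp, ← neg_sub z p]
    field_simp
    ring

/-- The function `q + d s - σ² s² / 2 + Φ₁(-s) Φ₂(s)` for `Φ₁(-s)` given by a partial fraction
expansion. -/
def complexExponent (q d σ k δ : ℝ) (w r : ℕ → ℝ) (Φ : ℂ → ℂ) (s : ℂ) : ℂ :=
  q + d * s - σ ^ 2 * s ^ 2 / 2 + (k - δ * s - s * cauchySeries w r s) * Φ s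

section
variable {q d σ k₁ δ₁ k₂ δ₂ : ℝ} {w r ζ : ℕ → ℝ} {ν : Measure ℝ} {Φ : ℂ → ℂ}

lemma complexExponent_ofReal (hΦ : BernsteinRep k₂ δ₂ ν Φ) {x : ℝ} (hx : 0 ≤ x) :
    complexExponent q d σ k₁ δ₁ w r Φ x
      = (realExponent q d σ k₁ δ₁ w r (bernsteinReal k₂ δ₂ ν) x : ℂ) := by
  rw [complexExponent, realExponent, CauchyData.ofReal_eq, hΦ.ofReal_eq hx]
  push_cast
  rfl

lemma complexExponent_differentiableAt (hw : CauchyData w r)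
    {s : ℂ} (hs : ∀ n, w n ≠ 0 → s ≠ r n) (hΦ : DifferentiableAt ℂ Φ s) :
    DifferentiableAt ℂ (complexExponent q d σ k₁ δ₁ w r Φ) s := by
  have := hw.differentiableAt hs
  unfold complexExponent
  fun_prop

lemma norm_complexExponent_le (hq : 0 < q) (hk : 0 ≤ k₁) (hδ : 0 ≤ δ₁) (hw : CauchyData w r)
    (hΦ : BernsteinRep k₂ δ₂ ν Φ) :
    ∃ C, 0 ≤ C ∧ ∀ s : ℂ, 0 ≤ s.re → s.im ≠ 0 →
      ‖complexExponent q d σ k₁ δ₁ w r Φ s‖ * |s.im| ≤ C * (1 + ‖s‖) ^ 3 := by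
  set D := k₂ + δ₂ + 2 * ∫ y, min 1 y ∂ν
  set W := ∑' n, w n / r n
  have hW : 0 ≤ W := tsum_nonneg fun n => div_nonneg (hw.w_nonneg n) (hw.p_pos n).le
  have hD : 0 ≤ D := by
    have := (norm_nonneg (Φ 0)).trans (hΦ.norm_le (z := 0) le_rfl)
    simpa using this
  refine ⟨q + |d| + σ ^ 2 + (k₁ + δ₁ + W) * D, by positivity, fun s hs him => ?_⟩
  have hi := abs_pos.mpr him
  have him' : |s.im| ≤ ‖s‖ := Complex.abs_im_le_norm s
  set n := ‖s‖
  have hn : 0 ≤ n := norm_nonneg s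
  have h1 : ‖cauchySeries w r s‖ * |s.im| ≤ n * W := by
    have := hw.norm_le_of_im_ne_zero him
    calc _ ≤ (n / |s.im| * W) * |s.im| := by gcongr
      _ = n * W := by field_simp
  have h2 : ‖((k₁ : ℂ) - δ₁ * s - s * cauchySeries w r s)‖ * |s.im|
      ≤ (k₁ + δ₁ + W) * (1 + n) ^ 2 := by
    have : ‖((k₁ : ℂ) - δ₁ * s - s * cauchySeries w r s)‖
        ≤ k₁ + δ₁ * n + n * ‖cauchySeries w r s‖ := by
      refine (norm_sub_le _ _).trans (add_le_add ((norm_sub_le _ _).trans ?_) (norm_mul_le _ _))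
      rw [norm_mul, Complex.norm_real, Complex.norm_real, Real.norm_of_nonneg hk,
        Real.norm_of_nonneg hδ]
    calc _ ≤ (k₁ + δ₁ * n + n * ‖cauchySeries w r s‖) * |s.im| := by gcongr
      _ = k₁ * |s.im| + δ₁ * (n * |s.im|) + n * (‖cauchySeries w r s‖ * |s.im|) := by ring
      _ ≤ k₁ * n + δ₁ * (n * n) + n * (n * W) := by gcongr
      _ ≤ _ := by nlinarith [mul_nonneg hk hn, mul_nonneg hδ hn, mul_nonneg hW hn,
        mul_nonneg hk (mul_nonneg hn hn)]
  have h3 := hΦ.norm_le hs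
  have h4 : ‖(q : ℂ) + d * s - σ ^ 2 * s ^ 2 / 2‖ ≤ (q + |d| + σ ^ 2) * (1 + n) ^ 2 := by
    have : ‖(q : ℂ) + d * s - σ ^ 2 * s ^ 2 / 2‖ ≤ q + |d| * n + σ ^ 2 * n ^ 2 / 2 := by
      refine (norm_sub_le _ _).trans (add_le_add ((norm_add_le _ _).trans ?_) ?_)
      · rw [norm_mul, Complex.norm_real, Complex.norm_real, Real.norm_of_nonneg hq.le,
          Real.norm_eq_abs]
      · rw [norm_div, norm_mul, norm_pow, norm_pow, Complex.norm_real, Real.norm_eq_abs, sq_abs]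
        simp [n]
    nlinarith [mul_nonneg hq.le hn, mul_nonneg (abs_nonneg d) hn, mul_nonneg (sq_nonneg σ) hn,
      mul_nonneg hq.le (mul_nonneg hn hn), mul_nonneg (abs_nonneg d) (mul_nonneg hn hn),
      mul_nonneg (sq_nonneg σ) (mul_nonneg hn hn)]
  have h5 : ‖complexExponent q d σ k₁ δ₁ w r Φ s‖
      ≤ ‖(q : ℂ) + d * s - σ ^ 2 * s ^ 2 / 2‖
        + ‖((k₁ : ℂ) - δ₁ * s - s * cauchySeries w r s)‖ * ‖Φ s‖ := by
    unfold complexExponent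
    exact (norm_add_le _ _).trans (add_le_add le_rfl (norm_mul_le _ _))
  calc _ ≤ (‖(q : ℂ) + d * s - σ ^ 2 * s ^ 2 / 2‖
        + ‖((k₁ : ℂ) - δ₁ * s - s * cauchySeries w r s)‖ * ‖Φ s‖) * |s.im| := by gcongr
    _ = ‖(q : ℂ) + d * s - σ ^ 2 * s ^ 2 / 2‖ * |s.im|
        + (‖((k₁ : ℂ) - δ₁ * s - s * cauchySeries w r s)‖ * |s.im|) * ‖Φ s‖ := by ring
    _ ≤ (q + |d| + σ ^ 2) * (1 + n) ^ 2 * (1 + n)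
        + ((k₁ + δ₁ + W) * (1 + n) ^ 2) * (D * (1 + n)) := by
        gcongr
        linarith
    _ = _ := by ring

/-- The product of the exponent and the interlacing quotient extends holomorphically. -/
lemma exists_differentiable_extension_exponent (hw : CauchyData w r) (hI : Interlacing ζ r)
    (hΦ : ∀ z : ℂ, 0 < z.re → DifferentiableAt ℂ Φ z)
    (hroot : ∀ n, complexExponent q d σ k₁ δ₁ w r Φ (ζ n) = 0) {s : ℂ} (hs : 0 < s.re) :
    ∃ g, (∀ᶠ z in nhds s, DifferentiableAt ℂ g z) ∧
      (fun z => complexExponent q d σ k₁ δ₁ w r Φ z * interlacingQuotient ζ r z)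
        =ᶠ[nhdsWithin s {s}ᶜ] g := by
  have hc := hI.cauchyData_coeff
  have hΦe : ∀ᶠ z in nhds s, DifferentiableAt ℂ Φ z := by
    filter_upwards [(isOpen_lt continuous_const Complex.continuous_re).mem_nhds hs] with z hz
    exact hΦ z hz
  have hne : ∀ m n, r m ≠ ζ n := fun m n => by
    rcases lt_or_ge m n with h | h
    · exact (hI.lt_of_lt h).ne
    · exact (hI.lt_of_le h).ne'
  have hN : (∀ n, Interlacing.coeff ζ r n ≠ 0 → s ≠ ζ n) →
      ∀ᶠ z in nhds s, DifferentiableAt ℂ (interlacingQuotient ζ r) z := fun h => by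
    filter_upwards [hc.eventually_ne_pole h] with z hz
    exact (differentiableAt_id.mul (hc.differentiableAt hz)).const_add 1
  have hf : (∀ n, w n ≠ 0 → s ≠ r n) →
      ∀ᶠ z in nhds s, DifferentiableAt ℂ (complexExponent q d σ k₁ δ₁ w r Φ) z := fun h => by
    filter_upwards [hw.eventually_ne_pole h, hΦe] with z hz hz2
    exact complexExponent_differentiableAt hw hz hz2
  by_cases h1 : ∃ n, w n ≠ 0 ∧ s = r n
  · obtain ⟨n, -, rfl⟩ := h1
    have hupd : ∀ m, Function.update w n 0 m ≠ 0 → (r n : ℂ) ≠ r m := fun m hm h => by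
      have : n = m := hI.strictMono_right.injective (by exact_mod_cast h)
      subst this
      simp at hm
    refine exists_differentiable_extension (u := fun z => -z * w n * Φ z)
      (v := complexExponent q d σ k₁ δ₁ (Function.update w n 0) r Φ) ?_
      (hN fun m _ => by exact_mod_cast hne n m) ?_ ?_ (hI.quotient_right n)
    · filter_upwards [nhdsWithin_le_nhds ((hw.update n).eventually_ne_pole hupd),
        self_mem_nhdsWithin] with z hz hzn
      have hz' : ∀ m, w m ≠ 0 → z ≠ r m := fun m hm => by
        rcases eq_or_ne m n with rfl | hmn
        · exact hzn
        · exact hz m (by simpa [hmn] using hm)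
      unfold complexExponent
      rw [hw.eq_add_update n hz']
      ring
    · filter_upwards [hΦe] with z hz
      fun_prop
    · filter_upwards [hΦe, (hw.update n).eventually_ne_pole hupd] with z hz hz2
      exact complexExponent_differentiableAt (hw.update n) hz2 hz
  by_cases h2 : ∃ n, Interlacing.coeff ζ r n ≠ 0 ∧ s = ζ n
  · obtain ⟨n, -, rfl⟩ := h2
    have hupd : ∀ m, Function.update (Interlacing.coeff ζ r) n 0 m ≠ 0 → (ζ n : ℂ) ≠ ζ m :=
      fun m hm h => by
        have : n = m := hI.strictMono.injective (by exact_mod_cast h)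
        subst this
        simp at hm
    have hU : ∀ᶠ z in nhdsWithin (ζ n : ℂ) {(ζ n : ℂ)}ᶜ, interlacingQuotient ζ r z
        = z * Interlacing.coeff ζ r n / (ζ n - z)
          + (1 + z * cauchySeries (Function.update (Interlacing.coeff ζ r) n 0) ζ z) := by
      filter_upwards [nhdsWithin_le_nhds ((hc.update n).eventually_ne_pole hupd),
        self_mem_nhdsWithin] with z hz hzn
      have hz' : ∀ m, Interlacing.coeff ζ r m ≠ 0 → z ≠ ζ m := fun m hm => by
        rcases eq_or_ne m n with rfl | hmn
        · exact hzn
        · exact hz m (by simpa [hmn] using hm)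
      rw [interlacingQuotient, hc.eq_add_update n hz']
      ring
    have hv : ∀ᶠ z in nhds (ζ n : ℂ), DifferentiableAt ℂ (fun z =>
        1 + z * cauchySeries (Function.update (Interlacing.coeff ζ r) n 0) ζ z) z := by
      filter_upwards [(hc.update n).eventually_ne_pole hupd] with z hz
      exact (differentiableAt_id.mul ((hc.update n).differentiableAt hz)).const_add 1
    obtain ⟨g, hg, hg'⟩ := exists_differentiable_extension hU
      (hf fun m _ => by exact_mod_cast (hne m n).symm) (Filter.Eventually.of_forall fun z => by
        fun_prop) hv (hroot n)
    exact ⟨g, hg, by simpa only [mul_comm] using hg'⟩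
  · push Not at h1 h2
    refine ⟨_, ?_, Filter.EventuallyEq.rfl⟩
    filter_upwards [hf h1, hN h2] with z hz1 hz2
    exact hz1.mul hz2

end

namespace Interlacing
variable {ζ r : ℕ → ℝ}

lemma quotient_nonneg_of_nonpos (h : Interlacing ζ r) {x : ℝ} (hx : x ≤ 0) :
    0 ≤ 1 + x * ∑' k, coeff ζ r k / (ζ k - x) := by
  have h1 : -x * ∑' k, coeff ζ r k / (ζ k - x) ≤ ∑' k, coeff ζ r k := by
    rw [← tsum_mul_left]
    have hle : ∀ k, -x * (coeff ζ r k / (ζ k - x)) ≤ coeff ζ r k := fun k => by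
      have hz := h.pos k
      have hc := h.coeff_nonneg k
      rw [mul_div_assoc', div_le_iff₀ (by linarith)]
      nlinarith [mul_nonneg hc hz.le]
    refine Summable.tsum_le_tsum hle ?_ h.summable_coeff
    refine h.summable_coeff.of_nonneg_of_le (fun k => ?_) hle
    have hz := h.pos k
    exact mul_nonneg (by linarith) (div_nonneg (h.coeff_nonneg k) (by linarith))
  linarith [h.tsum_coeff_le_one]

end Interlacing

section
variable {q d σ k₁ δ₁ k₂ δ₂ : ℝ} {w r ζ : ℕ → ℝ} {ν : Measure ℝ} {Φ : ℂ → ℂ}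

/-- Identification of the positive Wiener-Hopf factor with the interlacing quotient. -/
theorem factor_eq_interlacingQuotient (hq : 0 < q) (hk : 0 ≤ k₁) (hδ : 0 ≤ δ₁)
    (hw : CauchyData w r) (hΦ : BernsteinRep k₂ δ₂ ν Φ) (hI : Interlacing ζ r)
    (hΦd : ∀ z : ℂ, 0 ≤ z.re → DifferentiableAt ℂ Φ z)
    (hroot : ∀ n, complexExponent q d σ k₁ δ₁ w r Φ (ζ n) = 0)
    {p m : ℂ → ℂ} (hpc : ContinuousOn p {s | s.re ≤ 0})
    (hpd : ∀ s : ℂ, s.re < 0 → DifferentiableAt ℂ p s) {C : ℝ}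
    (hpb : ∀ s : ℂ, s.re ≤ 0 → 1 ≤ C * (1 + ‖s‖) * ‖p s‖) (hp0 : p 0 = 1)
    (hpr : ∀ x : ℝ, x ≤ 0 → ∃ y : ℝ, 0 < y ∧ p x = y)
    (hmc : ContinuousOn m {s | 0 ≤ s.re})
    (hmd : ∀ s : ℂ, 0 < s.re → DifferentiableAt ℂ m s) (hmb : ∀ s : ℂ, 0 ≤ s.re → ‖m s‖ ≤ 1)
    (hmr : ∀ x : ℝ, 0 ≤ x → ∃ y : ℝ, 0 ≤ y ∧ m x = y)
    (hpm : ∀ s : ℂ, s.re = 0 → complexExponent q d σ k₁ δ₁ w r Φ s * (p s * m s) = q)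
    {s : ℂ} (hs : s.re ≤ 0) : p s = interlacingQuotient ζ r s := by
  set f := complexExponent q d σ k₁ δ₁ w r Φ with hf
  set N := interlacingQuotient ζ r with hN
  have hqC : (q : ℂ) ≠ 0 := by exact_mod_cast hq.ne'
  have hp_ne : ∀ s : ℂ, s.re ≤ 0 → p s ≠ 0 := fun s hs h => by
    have := hpb s hs
    rw [h, norm_zero, mul_zero] at this
    linarith
  have hNd : ∀ s : ℂ, (∀ n, s ≠ ζ n) → DifferentiableAt ℂ N s := fun s hs =>
    hI.quotient_differentiableAt hs
  have hre : ∀ (x : ℝ) (s : ℂ), 0 < x → s.re ≤ 0 → s ≠ x := fun x s hx hs h => by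
    rw [h, Complex.ofReal_re] at hs
    linarith
  have hfd : ∀ s : ℂ, 0 ≤ s.re → (∀ n, s ≠ r n) → DifferentiableAt ℂ f s := fun s hs hsr =>
    complexExponent_differentiableAt hw (fun n _ => hsr n) (hΦd s hs)
  set H : ℂ → ℂ := fun z => f z * N z with hH
  set HH : ℂ → ℂ := fun z => Filter.limUnder (nhdsWithin z {z}ᶜ) H with hHH
  have hHH_eq : ∀ s : ℂ, 0 ≤ s.re → (∀ n, s ≠ r n) → (∀ n, s ≠ ζ n) → HH s = H s :=
    fun s hs h1 h2 => by
      have hc : ContinuousAt H s := ((hfd s hs h1).mul (hNd s h2)).continuousAt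
      exact Filter.Tendsto.limUnder_eq (hc.tendsto.mono_left nhdsWithin_le_nhds)
  have hHH_d : ∀ s : ℂ, 0 < s.re → DifferentiableAt ℂ HH s := fun s hs => by
    obtain ⟨g, hg, hg'⟩ := exists_differentiable_extension_exponent hw hI
      (fun z hz => hΦd z hz.le) hroot hs
    exact (limUnder_punctured_eventuallyEq (hg.mono fun z hz => hz.continuousAt)
      hg').differentiableAt_iff.mpr hg.self_of_nhds
  have hHH_im : ∀ s : ℂ, s.re = 0 → HH s = H s ∧ ContinuousWithinAt HH {s | 0 ≤ s.re} s :=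
    fun s hs => by
      have h1 : ∀ n, s ≠ r n := fun n => hre _ s (hI.pos_right n) hs.le
      have h2 : ∀ n, s ≠ ζ n := fun n => hre _ s (hI.pos n) hs.le
      refine ⟨hHH_eq s hs.ge h1 h2, ?_⟩
      have hc : ContinuousAt H s := ((hfd s hs.ge h1).mul (hNd s h2)).continuousAt
      refine hc.continuousWithinAt.congr_of_eventuallyEq ?_ (hHH_eq s hs.ge h1 h2)
      have e1 : ∀ᶠ z : ℂ in nhds s, z.re < r 0 ∧ z.re < ζ 0 :=
        ((Complex.continuous_re.tendsto s).eventually_lt_const (by rw [hs]; exact hI.pos_right 0)).and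
        ((Complex.continuous_re.tendsto s).eventually_lt_const (by rw [hs]; exact hI.pos 0))
      filter_upwards [self_mem_nhdsWithin, nhdsWithin_le_nhds e1] with z hz hz2
      refine hHH_eq z hz (fun n h => ?_) fun n h => ?_
      · have := hI.strictMono_right.monotone (Nat.zero_le n)
        rw [h, Complex.ofReal_re] at hz2
        linarith
      · have := hI.strictMono.monotone (Nat.zero_le n)
        rw [h, Complex.ofReal_re] at hz2
        linarith
  obtain ⟨Cf, hCf0, hCf⟩ := norm_complexExponent_le (d := d) (σ := σ) hq hk hδ hw hΦ
  have hC0 : 0 ≤ C := by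
    have := hpb 0 le_rfl
    rw [hp0] at this
    simp at this
    linarith
  obtain ⟨u, v, hL, hR⟩ : ∃ u v : ℂ, (∀ s : ℂ, s.re ≤ 0 → N s / p s = u + v * s) ∧
      ∀ s : ℂ, 0 ≤ s.re → m s * HH s / q = u + v * s := by
    refine affine_of_glue_half_planes (L := fun s => N s / p s) (R := fun s => m s * HH s / q)
      (C := 2 * C + 2 * Cf / q) (k := 4) ?_ ?_ ?_ ?_ ?_ (by norm_num) ?_ ?_
    · exact ContinuousOn.div (fun z hz => (hNd z fun n => hre _ z (hI.pos n) hz).continuousAt.continuousWithinAt)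
        hpc fun z hz => hp_ne z hz
    · exact fun z hz => (hNd z fun n => hre _ z (hI.pos n) hz.le).div (hpd z hz) (hp_ne z hz.le)
    · refine ContinuousOn.div_const (hmc.mul fun z hz => ?_) _
      rcases eq_or_lt_of_le (show 0 ≤ z.re from hz) with h | h
      · exact (hHH_im z h.symm).2
      · exact (hHH_d z h).continuousAt.continuousWithinAt
    · exact fun z hz => ((hmd z hz).mul (hHH_d z hz)).div_const _
    · intro z hz
      have h1 := hpm z hz
      rw [(hHH_im z hz).1, div_eq_div_iff (hp_ne z hz.le) hqC, ← h1]
      ring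
    · intro z hz
      have h1 := hpb z hz
      have h2 := hI.norm_quotient_le_of_re_nonpos hz
      have hpos : 0 < ‖p z‖ := norm_pos_iff.mpr (hp_ne z hz)
      rw [norm_div, div_le_iff₀ hpos]
      have : 0 ≤ 2 * Cf / q * (1 + ‖z‖) * ‖p z‖ := by positivity
      nlinarith
    · intro z hz him
      have hne : ∀ x : ℝ, z ≠ x := fun x h => him (by rw [h, Complex.ofReal_im])
      rw [hHH_eq z hz (fun n => hne _) (fun n => hne _), norm_div, norm_mul, norm_mul,
        Complex.norm_real, Real.norm_of_nonneg hq.le, ← sq_abs z.im]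
      have h1 : ‖f z‖ * |z.im| ≤ Cf * (1 + ‖z‖) ^ 3 := hCf z hz him
      have h2 : ‖N z‖ * |z.im| ≤ 2 * (1 + ‖z‖) := by linarith [hI.norm_quotient_le_of_im_ne_zero him]
      have h3 := hmb z hz
      calc ‖m z‖ * (‖f z‖ * ‖N z‖) / q * |z.im| ^ 2
          = ‖m z‖ * ((‖f z‖ * |z.im|) * (‖N z‖ * |z.im|)) / q := by ring
        _ ≤ 1 * ((Cf * (1 + ‖z‖) ^ 3) * (2 * (1 + ‖z‖))) / q := by
          gcongr
        _ = 2 * Cf / q * (1 + ‖z‖) ^ 4 := by ring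
        _ ≤ _ := by
          gcongr
          linarith
  have hu : u = 1 := by
    have := hL 0 le_rfl
    rw [hp0, hN, Interlacing.quotient_zero] at this
    simpa using this.symm
  have hLx : ∀ x : ℝ, x ≤ 0 → ∃ y : ℝ, 0 ≤ y ∧ 1 + v * x = y := fun x hx => by
    obtain ⟨y, hy, hpy⟩ := hpr x hx
    have := hL x (by simpa using hx)
    rw [hpy, hN, Interlacing.quotient_ofReal, hu] at this
    exact ⟨_, div_nonneg (hI.quotient_nonneg_of_nonpos hx) hy.le, by rw [← this]; push_cast; rfl⟩
  obtain ⟨y, -, hy⟩ := hLx (-1) (by norm_num)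
  have hv : v = ((1 - y : ℝ) : ℂ) := by
    push_cast at hy ⊢
    linear_combination -hy
  have hv1 : 1 - y ≤ 0 := by
    by_contra hcon
    push Not at hcon
    obtain ⟨y', hy', he⟩ := hLx (-(2 / (1 - y))) (by simp; positivity)
    rw [hv, ← Complex.ofReal_mul, ← Complex.ofReal_one, ← Complex.ofReal_add,
      Complex.ofReal_inj] at he
    have : (1 - y) * -(2 / (1 - y)) = -2 := by field_simp
    linarith
  have hv2 : 0 ≤ 1 - y := by
    by_contra hcon
    push Not at hcon
    have hcount : (Set.range r ∪ Set.range ζ).Countable :=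
      (Set.countable_range _).union (Set.countable_range _)
    obtain ⟨x, hx, hxm⟩ := hcount.dense_compl ℝ |>.inter_open_nonempty (Ioi (1 / -(1 - y))) isOpen_Ioi
      ⟨1 / -(1 - y) + 1, by simp⟩
    have hx0 : 0 < x := lt_trans (by apply div_pos <;> linarith) hx
    have hxr : ∀ n, x ≠ r n := fun n h => hxm (Or.inl ⟨n, h.symm⟩)
    have hxζ : ∀ n, x ≠ ζ n := fun n h => hxm (Or.inr ⟨n, h.symm⟩)
    obtain ⟨y', hy', hmy⟩ := hmr x hx0.le
    have h1 := hR x (by simpa using hx0.le)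
    have hroot' : ∀ n, realExponent q d σ k₁ δ₁ w r (bernsteinReal k₂ δ₂ ν) (ζ n) = 0 := fun n => by
      have := hroot n
      rw [hf, complexExponent_ofReal hΦ (hI.pos n).le] at this
      exact_mod_cast this
    have h2 := realExponent_mul_quotient_nonneg hq hk hδ hw hΦ hI hroot' hx0 hxζ hxr
    rw [hHH_eq x (by simpa using hx0.le) (fun n => by exact_mod_cast hxr n)
      (fun n => by exact_mod_cast hxζ n), hH, hmy, hu, hv] at h1
    simp only [hf, hN] at h1
    rw [complexExponent_ofReal hΦ hx0.le, Interlacing.quotient_ofReal] at h1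
    have h3 : y' * (realExponent q d σ k₁ δ₁ w r (bernsteinReal k₂ δ₂ ν) x
      * (1 + x * ∑' k, Interlacing.coeff ζ r k / (ζ k - x))) / q = 1 + (1 - y) * x := by
      exact_mod_cast h1
    have h4 : 0 ≤ 1 + (1 - y) * x := by rw [← h3]; positivity
    have h5 : 1 < x * -(1 - y) := by
      have := hx
      rw [mem_Ioi, div_lt_iff₀ (by linarith)] at this
      exact this
    linarith
  have h0 : 1 - y = 0 := le_antisymm hv1 hv2
  have := hL s hs
  rw [hu, hv, h0, Complex.ofReal_zero, zero_mul, add_zero, div_eq_one_iff_eq (hp_ne s hs)] at this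
  exact this.symm

end

section
variable {c ζ : ℕ → ℝ}

/-- The mixture of an atom at zero and exponential laws with rates `ζ k` and weights `c k`. -/
def expMixture (c ζ : ℕ → ℝ) : Measure ℝ :=
  ENNReal.ofReal (1 - ∑' k, c k) • Measure.dirac 0
    + Measure.sum fun k => expTilt (c k * ζ k) (ζ k)

lemma expTilt_univ {c r : ℝ} (hc : 0 ≤ c) (hr : 0 < r) :
    expTilt (c * r) r univ = ENNReal.ofReal c := by
  have := isFiniteMeasure_expTilt (c := c * r) hr
  have h := integral_exp_expTilt (c := c * r) (mul_nonneg hc hr.le) (r := r) (z := 0) (by simpa using hr)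
  have hrC : (r : ℂ) ≠ 0 := by exact_mod_cast hr.ne'
  simp only [neg_zero, zero_mul, Complex.exp_zero, integral_const, add_zero, Complex.ofReal_mul,
    mul_div_cancel_right₀ _ hrC, Complex.real_smul, mul_one] at h
  have h2 : (expTilt (c * r) r).real univ = c := by exact_mod_cast h
  rw [← ENNReal.ofReal_toReal (measure_ne_top (expTilt (c * r) r) univ), ← measureReal_def, h2]

lemma isFiniteMeasure_sum_expTilt (hc : ∀ k, 0 ≤ c k) (hζ : ∀ k, 0 < ζ k) (hs : Summable c) :
    IsFiniteMeasure (Measure.sum fun k => expTilt (c k * ζ k) (ζ k)) := by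
  refine ⟨?_⟩
  rw [Measure.sum_apply _ MeasurableSet.univ]
  simp_rw [fun k => expTilt_univ (hc k) (hζ k)]
  rw [← ENNReal.ofReal_tsum_of_nonneg hc hs]
  exact ENNReal.ofReal_lt_top

lemma charFun_expMixture (hc : ∀ k, 0 ≤ c k) (hζ : ∀ k, 0 < ζ k) (hs : Summable c)
    (h1 : ∑' k, c k ≤ 1) (θ : ℝ) :
    charFun (expMixture c ζ) θ = 1 + (θ * Complex.I) * cauchySeries c ζ (θ * Complex.I) := by
  have := isFiniteMeasure_sum_expTilt hc hζ hs
  have hexp : ∀ (μ : Measure ℝ) [IsFiniteMeasure μ],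
      Integrable (fun x : ℝ => Complex.exp (θ * x * Complex.I)) μ := fun μ _ => by
    refine (integrable_const (1 : ℝ)).mono' (Continuous.aestronglyMeasurable (by fun_prop)) ?_
    refine Filter.Eventually.of_forall fun x => ?_
    rw [← Complex.ofReal_mul, Complex.norm_exp_ofReal_mul_I]
  have hne : ∀ k, (ζ k : ℂ) - θ * Complex.I ≠ 0 := fun k h => by
    have := congrArg Complex.re h
    simp at this
    exact (hζ k).ne' this
  have hsC : Summable fun k => (c k : ℂ) := Complex.summable_ofReal.mpr hs
  have hk := hasSum_integral_measure (hexp (Measure.sum fun k => expTilt (c k * ζ k) (ζ k)))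
  have hk' : HasSum (fun k => (c k : ℂ) + (θ * Complex.I) * (c k / (ζ k - θ * Complex.I)))
      (∫ x : ℝ, Complex.exp (θ * x * Complex.I) ∂(Measure.sum fun k => expTilt (c k * ζ k) (ζ k))) := by
    refine hk.congr_fun fun k => ?_
    have h := integral_exp_expTilt (c := c k * ζ k) (mul_nonneg (hc k) (hζ k).le) (r := ζ k)
      (z := -(θ * Complex.I)) (by simpa using hζ k)
    simp only [neg_neg] at h
    simp_rw [mul_right_comm _ _ Complex.I]
    rw [h, ← sub_eq_add_neg]
    have := hne k
    push_cast
    field_simp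
    ring
  have hs2 := hk'.sub hsC.hasSum
  simp only [add_sub_cancel_left] at hs2
  have hs3 := hs2.tsum_eq
  rw [tsum_mul_left] at hs3
  have : IsFiniteMeasure (ENNReal.ofReal (1 - ∑' k, c k) • (Measure.dirac 0 : Measure ℝ)) :=
    Measure.smul_finite _ ENNReal.ofReal_ne_top
  rw [charFun_apply_real, expMixture, integral_add_measure ((hexp _)) (hexp _),
    integral_smul_measure, integral_dirac, ENNReal.toReal_ofReal (by linarith), cauchySeries, hs3]
  simp only [Complex.ofReal_zero, mul_zero, zero_mul, Complex.exp_zero, Complex.real_smul, mul_one]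
  push_cast
  ring

lemma expMixture_apply (hc : ∀ k, 0 ≤ c k) (hζ : ∀ k, 0 < ζ k) (hs : Summable c)
    {A : Set ℝ} (hA : MeasurableSet A) (hA0 : A ⊆ Ioi 0) :
    expMixture c ζ A = ENNReal.ofReal (∫ x in A, ∑' k, c k * ζ k * Real.exp (-ζ k * x)) := by
  have := isFiniteMeasure_sum_expTilt hc hζ hs
  have hnn : ∀ k x, 0 ≤ c k * ζ k * Real.exp (-ζ k * x) := fun k x =>
    mul_nonneg (mul_nonneg (hc k) (hζ k).le) (Real.exp_pos _).le
  have hsum : ∀ x ∈ A, Summable fun k => c k * ζ k * Real.exp (-ζ k * x) := fun x hx => by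
    have hx0 : 0 < x := hA0 hx
    refine (hs.mul_right x⁻¹).of_nonneg_of_le (fun k => hnn k x) fun k => ?_
    rw [mul_assoc]
    refine mul_le_mul_of_nonneg_left ?_ (hc k)
    have h1 := Real.add_one_le_exp (ζ k * x)
    rw [neg_mul, Real.exp_neg, ← div_eq_mul_inv, div_le_iff₀ (Real.exp_pos _),
      inv_mul_eq_div, le_div_iff₀ hx0]
    linarith
  have h0 : ∀ k, expTilt (c k * ζ k) (ζ k) A
      = ∫⁻ x in A, ENNReal.ofReal (c k * ζ k * Real.exp (-ζ k * x)) := fun k => by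
    rw [expTilt, withDensity_apply _ hA, Measure.restrict_restrict hA,
      Set.inter_eq_left.mpr hA0]
  have hmeas : ∀ k, Measurable fun x : ℝ => ENNReal.ofReal (c k * ζ k * Real.exp (-ζ k * x)) :=
    fun k => by fun_prop
  have h1 : (Measure.sum fun k => expTilt (c k * ζ k) (ζ k)) A
      = ∫⁻ x in A, ENNReal.ofReal (∑' k, c k * ζ k * Real.exp (-ζ k * x)) := by
    rw [Measure.sum_apply _ hA]
    simp_rw [h0]
    rw [← lintegral_tsum fun k => (hmeas k).aemeasurable]
    refine setLIntegral_congr_fun hA fun x hx => ?_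
    exact (ENNReal.ofReal_tsum_of_nonneg (fun k => hnn k x) (hsum x hx)).symm
  have hmt : Measurable fun x : ℝ => ∑' k, c k * ζ k * Real.exp (-ζ k * x) :=
    Measurable.tsum fun k => by fun_prop
  have h2 : IntegrableOn (fun x : ℝ => ∑' k, c k * ζ k * Real.exp (-ζ k * x)) A := by
    refine ⟨hmt.aestronglyMeasurable, ?_⟩
    rw [hasFiniteIntegral_iff_ofReal (Filter.Eventually.of_forall fun x => tsum_nonneg fun k => hnn k x),
      ← h1]
    exact measure_lt_top _ _
  rw [expMixture, Measure.add_apply, Measure.smul_apply, Measure.dirac_apply' _ hA,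
    indicator_of_notMem (fun h => lt_irrefl (0 : ℝ) (hA0 h)), smul_zero, zero_add, h1,
    ofReal_integral_eq_lintegral_ofReal h2
      (Filter.Eventually.of_forall fun x => tsum_nonneg fun k => hnn k x)]

lemma apply_eq_of_charFun {ζ r : ℕ → ℝ} (hI : Interlacing ζ r) (μ : Measure ℝ) [IsFiniteMeasure μ]
    (hμ : ∀ θ : ℝ, charFun μ θ = interlacingQuotient ζ r (θ * Complex.I))
    {A : Set ℝ} (hA : MeasurableSet A) (hA0 : A ⊆ Ioi 0) :
    μ A = ENNReal.ofReal
      (∫ x in A, ∑' k, Interlacing.coeff ζ r k * ζ k * Real.exp (-ζ k * x)) := by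
  have := isFiniteMeasure_sum_expTilt hI.coeff_nonneg hI.pos hI.summable_coeff
  have hfin : IsFiniteMeasure (expMixture (Interlacing.coeff ζ r) ζ) := by
    have : IsFiniteMeasure (ENNReal.ofReal (1 - ∑' k, Interlacing.coeff ζ r k) •
        (Measure.dirac 0 : Measure ℝ)) := Measure.smul_finite _ ENNReal.ofReal_ne_top
    unfold expMixture
    infer_instance
  have : μ = expMixture (Interlacing.coeff ζ r) ζ := by
    refine Measure.ext_of_charFun (funext fun θ => ?_)
    rw [hμ, charFun_expMixture hI.coeff_nonneg hI.pos hI.summable_coeff hI.tsum_coeff_le_one]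
    rfl
  rw [this, expMixture_apply hI.coeff_nonneg hI.pos hI.summable_coeff hA hA0]

end

/-- The law of the maximum of `0, S₁, …, Sₙ` for a random walk with step law `μ`. -/
def lindley (μ : Measure ℝ) : ℕ → Measure ℝ
  | 0 => Measure.dirac 0
  | n + 1 => (μ.prod (lindley μ n)).map fun z => max 0 (z.1 + z.2)

/-- The law of the maximum of a random walk up to an independent geometric time. -/
def geomLindley (μ : Measure ℝ) (r : ℝ) : Measure ℝ :=
  Measure.sum fun n => ENNReal.ofReal ((1 - r) * r ^ n) • lindley μ n

section
variable {μ : Measure ℝ} {r : ℝ}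

instance isProbabilityMeasure_lindley [IsProbabilityMeasure μ] (n : ℕ) : IsProbabilityMeasure (lindley μ n) := by
  induction n with
  | zero => exact Measure.dirac.isProbabilityMeasure
  | succ n ih => exact Measure.isProbabilityMeasure_map (by fun_prop)

lemma ae_lindley_nonneg (n : ℕ) : ∀ᵐ x ∂lindley μ n, 0 ≤ x := by
  cases n with
  | zero => exact (ae_dirac_iff measurableSet_Ici).mpr le_rfl
  | succ n =>
    rw [lindley, ae_map_iff (by fun_prop) measurableSet_Ici]
    exact Filter.Eventually.of_forall fun z => le_max_left _ _

lemma hasSum_geom (h0 : 0 ≤ r) (h1 : r < 1) : HasSum (fun n : ℕ => (1 - r) * r ^ n) 1 := by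
  have := (hasSum_geometric_of_lt_one h0 h1).mul_left (1 - r)
  rwa [mul_inv_cancel₀ (by linarith)] at this

lemma isProbabilityMeasure_geomLindley [IsProbabilityMeasure μ] (h0 : 0 ≤ r) (h1 : r < 1) :
    IsProbabilityMeasure (geomLindley μ r) := by
  refine ⟨?_⟩
  have hnn : ∀ n : ℕ, 0 ≤ (1 - r) * r ^ n := fun n => mul_nonneg (by linarith) (pow_nonneg h0 n)
  rw [geomLindley, Measure.sum_apply _ MeasurableSet.univ]
  simp only [Measure.smul_apply, measure_univ, smul_eq_mul, mul_one]
  rw [← ENNReal.ofReal_tsum_of_nonneg hnn (hasSum_geom h0 h1).summable,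
    (hasSum_geom h0 h1).tsum_eq, ENNReal.ofReal_one]

lemma ae_geomLindley_nonneg : ∀ᵐ x ∂geomLindley μ r, 0 ≤ x := by
  rw [geomLindley, Measure.ae_sum_iff]
  exact fun n => Measure.ae_smul_measure (ae_lindley_nonneg n) _

lemma hasSum_integral_geomLindley [IsProbabilityMeasure μ] (h0 : 0 ≤ r) (h1 : r < 1) {g : ℝ → ℂ} (hg : Measurable g)
    {C : ℝ} (hb : ∀ x, 0 ≤ x → ‖g x‖ ≤ C) :
    HasSum (fun n : ℕ => ((1 - r) * r ^ n : ℂ) * ∫ x, g x ∂lindley μ n)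
      (∫ x, g x ∂geomLindley μ r) := by
  have := isProbabilityMeasure_geomLindley (μ := μ) h0 h1
  have hi : Integrable g (geomLindley μ r) := by
    refine (integrable_const C).mono' hg.aestronglyMeasurable ?_
    filter_upwards [ae_geomLindley_nonneg] with x hx using hb x hx
  refine (hasSum_integral_measure hi).congr_fun fun n => ?_
  rw [integral_smul_measure, ENNReal.toReal_ofReal (mul_nonneg (by linarith) (pow_nonneg h0 n)),
    Complex.real_smul]
  push_cast
  rfl

lemma integral_lindley_succ [IsProbabilityMeasure μ] (n : ℕ) {g : ℝ → ℂ} (hg : Measurable g)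
    {C : ℝ} (hb : ∀ x, 0 ≤ x → ‖g x‖ ≤ C) :
    ∫ x, g x ∂lindley μ (n + 1) = ∫ y, (∫ x, g (max 0 (x + y)) ∂μ) ∂lindley μ n := by
  rw [lindley, integral_map (by fun_prop) hg.aestronglyMeasurable, integral_prod_symm]
  refine (integrable_const C).mono' (hg.comp (by fun_prop)).aestronglyMeasurable ?_
  exact Filter.Eventually.of_forall fun z => hb _ (le_max_left _ _)

/-- The fixed point equation for the maximum up to a geometric time. -/
lemma integral_geomLindley [IsProbabilityMeasure μ] (h0 : 0 ≤ r) (h1 : r < 1) {g : ℝ → ℂ} (hg : Measurable g)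
    {C : ℝ} (hb : ∀ x, 0 ≤ x → ‖g x‖ ≤ C) :
    ∫ x, g x ∂geomLindley μ r
      = (1 - r) * g 0 + r * ∫ y, (∫ x, g (max 0 (x + y)) ∂μ) ∂geomLindley μ r := by
  have hG : Measurable fun y : ℝ => ∫ x, g (max 0 (x + y)) ∂μ := by
    have : StronglyMeasurable fun z : ℝ × ℝ => g (max 0 (z.2 + z.1)) :=
      (hg.comp (by fun_prop)).stronglyMeasurable
    exact this.integral_prod_right.measurable
  have hGb : ∀ y : ℝ, 0 ≤ y → ‖∫ x, g (max 0 (x + y)) ∂μ‖ ≤ C := fun y _ => by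
    refine (norm_integral_le_of_norm_le_const (C := C)
      (Filter.Eventually.of_forall fun x => hb _ (le_max_left _ _))).trans ?_
    simp
  have hs := hasSum_integral_geomLindley (μ := μ) h0 h1 hg hb
  have hs2 := (hasSum_integral_geomLindley (μ := μ) h0 h1 hG hGb).mul_left (r : ℂ)
  rw [← hasSum_nat_add_iff' 1] at hs
  have hs3 := hs2.unique (hs.congr_fun fun n => ?_)
  · rw [hs3]
    simp [lindley]
  · rw [integral_lindley_succ n hg hb]
    ring

end

section
variable {ρ : Measure ℝ}

lemma norm_exp_mul_le_one {s : ℂ} (hs : s.re ≤ 0) {x : ℝ} (hx : 0 ≤ x) :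
    ‖Complex.exp (s * x)‖ ≤ 1 := by
  rw [Complex.norm_exp, Real.exp_le_one_iff, Complex.re_mul_ofReal]
  exact mul_nonpos_of_nonpos_of_nonneg hs hx

lemma integrable_exp_mul [IsFiniteMeasure ρ] (hρ : ∀ᵐ x ∂ρ, 0 ≤ x) {s : ℂ} (hs : s.re ≤ 0) :
    Integrable (fun x : ℝ => Complex.exp (s * x)) ρ :=
  (integrable_const (1 : ℝ)).mono' (by fun_prop) <| by
    filter_upwards [hρ] with x hx using norm_exp_mul_le_one hs hx

lemma norm_complexMGF_le_one [IsProbabilityMeasure ρ] (hρ : ∀ᵐ x ∂ρ, 0 ≤ x) {s : ℂ}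
    (hs : s.re ≤ 0) : ‖complexMGF id ρ s‖ ≤ 1 := by
  refine (norm_integral_le_of_norm_le_const (C := 1) ?_).trans (by simp)
  filter_upwards [hρ] with x hx using norm_exp_mul_le_one hs hx

lemma continuousOn_complexMGF [IsFiniteMeasure ρ] (hρ : ∀ᵐ x ∂ρ, 0 ≤ x) :
    ContinuousOn (complexMGF id ρ) {s | s.re ≤ 0} := by
  intro s _
  refine continuousWithinAt_of_dominated (bound := fun _ => 1) ?_ ?_ (integrable_const _) ?_
  · exact Filter.Eventually.of_forall fun z => by fun_prop
  · filter_upwards [self_mem_nhdsWithin] with z hz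
    filter_upwards [hρ] with x hx using norm_exp_mul_le_one hz hx
  · refine Filter.Eventually.of_forall fun x => Continuous.continuousWithinAt ?_
    fun_prop

lemma differentiableAt_complexMGF_of_re_neg [IsFiniteMeasure ρ] (hρ : ∀ᵐ x ∂ρ, 0 ≤ x) {s : ℂ}
    (hs : s.re < 0) : DifferentiableAt ℂ (complexMGF id ρ) s := by
  refine (hasDerivAt_complexMGF ?_).differentiableAt
  refine mem_interior_iff_mem_nhds.mpr ?_
  filter_upwards [Iio_mem_nhds hs] with t ht
  have := integrable_exp_mul hρ (s := t) (by simpa using le_of_lt ht)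
  refine this.norm.congr (Filter.Eventually.of_forall fun x => ?_)
  simp [Complex.norm_exp]

lemma exists_ofReal_complexMGF [IsProbabilityMeasure ρ] (hρ : ∀ᵐ x ∂ρ, 0 ≤ x) {t : ℝ} (ht : t ≤ 0) :
    ∃ y : ℝ, 0 < y ∧ complexMGF id ρ t = y := by
  refine ⟨mgf id ρ t, ?_, complexMGF_ofReal t⟩
  refine mgf_pos ?_
  have := integrable_exp_mul hρ (s := t) (by simpa using ht)
  refine this.norm.congr (Filter.Eventually.of_forall fun x => ?_)
  simp [Complex.norm_exp]

lemma complexMGF_id_zero [IsProbabilityMeasure ρ] : complexMGF id ρ 0 = 1 := by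
  simp [complexMGF]

lemma min_one_le_two_mul {w : ℝ} (hw : 0 ≤ w) : min 1 w ≤ 2 * (1 - Real.exp (-w)) := by
  have h1 : Real.exp (-w) ≤ 1 / (1 + w) := by
    rw [Real.exp_neg, ← one_div]
    exact one_div_le_one_div_of_le (by linarith) (by linarith [Real.add_one_le_exp w])
  have h2 : min 1 w ≤ 2 * (1 - 1 / (1 + w)) := by
    have : 2 * (1 - 1 / (1 + w)) = 2 * w / (1 + w) := by field_simp; ring
    rw [this, le_div_iff₀ (by linarith)]
    rcases le_total 1 w with h | h
    · rw [min_eq_left h]; linarith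
    · rw [min_eq_right h]; nlinarith
  linarith

lemma norm_one_sub_complexMGF_le [IsProbabilityMeasure ρ] (hρ : ∀ᵐ x ∂ρ, 0 ≤ x) {s : ℂ}
    (hs : s.re ≤ 0) :
    ‖1 - complexMGF id ρ s‖ ≤ 4 * (1 + ‖s‖) * (1 - mgf id ρ (-1)) := by
  have hi1 := integrable_exp_mul hρ (s := (-1 : ℝ)) (by simp)
  have hir : Integrable (fun x : ℝ => Real.exp (-x)) ρ := by
    refine hi1.norm.congr (Filter.Eventually.of_forall fun x => ?_)
    simp [Complex.norm_exp]
  have h1 : 1 - complexMGF id ρ s = ∫ x : ℝ, (1 - Complex.exp (s * x)) ∂ρ := by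
    rw [integral_sub (integrable_const _) (integrable_exp_mul hρ hs)]
    simp [complexMGF]
  have h2 : 1 - mgf id ρ (-1) = ∫ x : ℝ, (1 - Real.exp (-x)) ∂ρ := by
    rw [integral_sub (integrable_const _) hir]
    simp [mgf]
  rw [h1, h2, ← integral_const_mul]
  refine norm_integral_le_of_norm_le (((integrable_const _).sub hir).const_mul _) ?_
  filter_upwards [hρ] with x hx
  rcases hx.eq_or_lt with h | h
  · simp [← h]
  · have := norm_one_sub_exp_le (z := -s) (by simpa using hs) h
    rw [neg_neg, norm_neg] at this
    refine this.trans ?_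
    have := mul_le_mul_of_nonneg_left (min_one_le_two_mul hx)
      (show 0 ≤ 2 * (1 + ‖s‖) by positivity)
    linarith

end

section
variable {μ : Measure ℝ} {r : ℝ}

/-- The Lindley equation on the imaginary axis. -/
lemma exists_geomLindley_mul [IsProbabilityMeasure μ] (h0 : 0 ≤ r) (h1 : r < 1) :
    ∃ ρ : Measure ℝ, IsProbabilityMeasure ρ ∧ (∀ᵐ x ∂ρ, 0 ≤ x) ∧ ∀ s : ℂ, s.re = 0 →
      complexMGF id (geomLindley μ r) s * (1 - r * complexMGF id μ s)
        = 1 - r * complexMGF id ρ (-s) := by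
  have := isProbabilityMeasure_geomLindley (μ := μ) h0 h1
  set m := geomLindley μ r
  refine ⟨(m.prod μ).map fun z => max 0 (-(z.2 + z.1)),
    Measure.isProbabilityMeasure_map (by fun_prop), ?_, fun s hs => ?_⟩
  · rw [ae_map_iff (by fun_prop) measurableSet_Ici]
    exact Filter.Eventually.of_forall fun z => le_max_left _ _
  have hn : ∀ x : ℝ, ‖Complex.exp (s * x)‖ ≤ 1 := fun x => by
    rw [Complex.norm_exp]; simp [hs]
  have hI : ∀ f : ℝ × ℝ → ℝ, Measurable f →
      Integrable (fun z => Complex.exp (s * f z)) (m.prod μ) := fun f hf =>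
    (integrable_const (1 : ℝ)).mono' (by fun_prop)
      (Filter.Eventually.of_forall fun z => hn _)
  have e1 := integral_geomLindley (μ := μ) h0 h1 (g := fun x : ℝ => Complex.exp (s * x))
    (by fun_prop) (C := 1) (fun x _ => hn x)
  have e2 : ∫ y, (∫ x, Complex.exp (s * (max 0 (x + y) : ℝ)) ∂μ) ∂m
      = ∫ z, Complex.exp (s * (max 0 (z.2 + z.1) : ℝ)) ∂(m.prod μ) :=
    (integral_prod _ (hI (fun z => max 0 (z.2 + z.1)) (by fun_prop))).symm
  have e3 : complexMGF id ((m.prod μ).map fun z => max 0 (-(z.2 + z.1))) (-s)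
      = ∫ z, Complex.exp (s * (min 0 (z.2 + z.1) : ℝ)) ∂(m.prod μ) := by
    rw [complexMGF, integral_map (by fun_prop) (by fun_prop)]
    congr with z
    congr 1
    have : min 0 (z.2 + z.1) = - max 0 (-(z.2 + z.1)) := by
      rw [← neg_zero, max_neg_neg]; simp
    rw [this, id]; push_cast; ring
  have e4 : complexMGF id m s * complexMGF id μ s
      = ∫ z, Complex.exp (s * (z.2 + z.1 : ℝ)) ∂(m.prod μ) := by
    rw [complexMGF, complexMGF, ← integral_prod_mul]
    congr with z
    rw [← Complex.exp_add]
    congr 1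
    simp only [id]; push_cast; ring
  have e5 : ∫ z, Complex.exp (s * (max 0 (z.2 + z.1) : ℝ)) ∂(m.prod μ)
      = (∫ z, Complex.exp (s * (z.2 + z.1 : ℝ)) ∂(m.prod μ)) + 1
        - ∫ z, Complex.exp (s * (min 0 (z.2 + z.1) : ℝ)) ∂(m.prod μ) := by
    have h1 : (1 : ℂ) = ∫ z, (1 : ℂ) ∂(m.prod μ) := by simp
    have hS : Integrable (fun z : ℝ × ℝ => Complex.exp (s * (z.2 + z.1 : ℝ)) + 1) (m.prod μ) :=
      (hI (fun z => z.2 + z.1) (by fun_prop)).add (integrable_const 1)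
    rw [h1, ← integral_add (hI _ (by fun_prop)) (integrable_const _),
      ← integral_sub hS (hI (fun z => min 0 (z.2 + z.1)) (by fun_prop))]
    congr with z
    rcases le_total 0 (z.2 + z.1) with h | h
    · simp [h]
    · simp [h]
  have e6 : complexMGF id m s = ∫ x : ℝ, Complex.exp (s * x) ∂m := rfl
  rw [e2, e5, ← e3, ← e4, ← e6] at e1
  simp only [Complex.ofReal_zero, mul_zero, Complex.exp_zero] at e1
  linear_combination e1

lemma complexMGF_map_neg (s : ℂ) : complexMGF id (μ.map fun x => -x) s = complexMGF id μ (-s) := by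
  rw [complexMGF, integral_map (by fun_prop) (by fun_prop), complexMGF]
  congr with x
  simp

lemma norm_complexMGF_le_one_of_re_eq_zero [IsProbabilityMeasure μ] {s : ℂ} (hs : s.re = 0) : ‖complexMGF id μ s‖ ≤ 1 := by
  refine (norm_integral_le_of_norm_le_const (C := 1) ?_).trans (by simp)
  exact Filter.Eventually.of_forall fun x => by rw [Complex.norm_exp]; simp [hs]

/-- Wiener–Hopf factorisation for a random walk killed at a geometric time, together with a
lower bound for the ascending factor. -/
lemma geomLindley_wienerHopf [IsProbabilityMeasure μ] (h0 : 0 < r) (h1 : r < 1) :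
    (∀ s : ℂ, s.re = 0 → complexMGF id (geomLindley μ r) s
      * complexMGF id (geomLindley (μ.map fun x => -x) r) (-s) * (1 - r * complexMGF id μ s)
        = 1 - r) ∧
    ∀ s : ℂ, s.re ≤ 0 → 1 ≤ (1 + 4 * (1 + ‖s‖) * ((mgf id (geomLindley μ r) (-1))⁻¹ - 1))
      * ‖complexMGF id (geomLindley μ r) s‖ := by
  have := isProbabilityMeasure_geomLindley (μ := μ) h0.le h1
  have hμ' : IsProbabilityMeasure (μ.map fun x => -x) :=
    Measure.isProbabilityMeasure_map (by fun_prop)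
  have := isProbabilityMeasure_geomLindley (μ := μ.map fun x => -x) h0.le h1
  obtain ⟨ρ, hρ, hρ0, hD⟩ := exists_geomLindley_mul (μ := μ) h0.le h1
  obtain ⟨ρ', hρ', hρ0', hK⟩ := exists_geomLindley_mul (μ := μ.map fun x => -x) h0.le h1
  have hm0 := ae_geomLindley_nonneg (μ := μ) (r := r)
  have hm0' := ae_geomLindley_nonneg (μ := μ.map fun x => -x) (r := r)
  set m := geomLindley μ r
  set m' := geomLindley (μ.map fun x => -x) r
  have hK' : ∀ s : ℂ, s.re = 0 →
      complexMGF id m' (-s) * (1 - r * complexMGF id μ s) = 1 - r * complexMGF id ρ' s := by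
    intro s hs
    have := hK (-s) (by simpa using hs)
    rwa [complexMGF_map_neg, neg_neg] at this
  have hbound : ∀ z : ℂ, ‖z‖ ≤ 1 → ‖1 - r * z‖ ≤ 2 := fun z hz => by
    refine (norm_sub_le _ _).trans ?_
    rw [norm_mul, norm_one, Complex.norm_real, Real.norm_of_nonneg h0.le]
    nlinarith [norm_nonneg z]
  have hprod : ∀ z w : ℂ, ‖z‖ ≤ 1 → ‖w‖ ≤ 1 → ‖z * (1 - r * w)‖ ≤ 2 := fun z w hz hw => by
    rw [norm_mul]
    nlinarith [norm_nonneg z, hbound w hw, norm_nonneg (1 - r * w)]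
  have hneg : MapsTo (fun s : ℂ => -s) {s | 0 ≤ s.re} {s | s.re ≤ 0} := fun s hs => by
    simpa using hs
  obtain ⟨u, v, hL, -⟩ : ∃ u v : ℂ,
      (∀ s : ℂ, s.re ≤ 0 → complexMGF id m s * (1 - r * complexMGF id ρ' s) = u + v * s) ∧
      (∀ s : ℂ, 0 ≤ s.re →
        complexMGF id m' (-s) * (1 - r * complexMGF id ρ (-s)) = u + v * s) := by
    refine affine_of_glue_half_planes (C := 2) (k := 3) ?_ ?_ ?_ ?_ ?_ le_rfl ?_ ?_
    · exact (continuousOn_complexMGF hm0).mul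
        (continuousOn_const.sub (continuousOn_const.mul (continuousOn_complexMGF hρ0')))
    · exact fun s hs => (differentiableAt_complexMGF_of_re_neg hm0 hs).mul
        ((differentiableAt_const _).sub
          ((differentiableAt_complexMGF_of_re_neg hρ0' hs).const_mul _))
    · exact ((continuousOn_complexMGF hm0').comp continuousOn_neg hneg).mul
        (continuousOn_const.sub
          (continuousOn_const.mul ((continuousOn_complexMGF hρ0).comp continuousOn_neg hneg)))
    · intro s hs
      have hs' : (-s).re < 0 := by simpa using hs
      have a1 := (differentiableAt_complexMGF_of_re_neg hm0' hs').comp s differentiableAt_id.neg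
      have a2 := (differentiableAt_complexMGF_of_re_neg hρ0 hs').comp s differentiableAt_id.neg
      exact a1.mul ((differentiableAt_const _).sub (a2.const_mul _))
    · intro s hs
      have hne : (1 - r * complexMGF id μ s) ≠ 0 := fun h => by
        have h2 : (1 : ℝ) = ‖(r : ℂ) * complexMGF id μ s‖ := by
          rw [← sub_eq_zero.mp h, norm_one]
        rw [norm_mul, Complex.norm_real, Real.norm_of_nonneg h0.le] at h2
        nlinarith [norm_complexMGF_le_one_of_re_eq_zero (μ := μ) hs]
      rw [← hK' s hs, ← hD s hs]
      ring
    · intro s hs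
      refine (hprod _ _ (norm_complexMGF_le_one hm0 hs) (norm_complexMGF_le_one hρ0' hs)).trans ?_
      nlinarith [norm_nonneg s]
    · intro s hs _
      have hs' : (-s).re ≤ 0 := by simpa using hs
      have a1 := hprod _ _ (norm_complexMGF_le_one hm0' hs') (norm_complexMGF_le_one hρ0 hs')
      have a2 : s.im ^ 2 ≤ (1 + ‖s‖) ^ 2 := by
        rw [← sq_abs]
        have := Complex.abs_im_le_norm s
        exact pow_le_pow_left₀ (abs_nonneg _) (by linarith) 2
      have a3 : (1 + ‖s‖) ^ 2 ≤ (1 + ‖s‖) ^ 3 :=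
        pow_le_pow_right₀ (by linarith [norm_nonneg s]) (by norm_num)
      calc _ ≤ 2 * s.im ^ 2 := mul_le_mul_of_nonneg_right a1 (sq_nonneg _)
        _ ≤ _ := by linarith
  have hu : u = 1 - r := by
    have := hL 0 (by simp)
    simpa [complexMGF_id_zero] using this.symm
  have hv : v = 0 := by
    by_contra hv
    have hvp : 0 < ‖v‖ := norm_pos_iff.mpr hv
    set t : ℝ := 4 / ‖v‖
    have ht : 0 < t := by positivity
    have hre : (-(t : ℂ)).re ≤ 0 := by simpa using ht.le
    have a1 := hL (-(t : ℂ)) hre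
    have a2 := hprod _ _ (norm_complexMGF_le_one hm0 hre) (norm_complexMGF_le_one hρ0' hre)
    rw [a1, hu] at a2
    have a3 : ‖v * t‖ = 4 := by
      rw [norm_mul, Complex.norm_real, Real.norm_of_nonneg ht.le]
      simp only [t]; field_simp
    have a4 : ‖v * t‖ ≤ ‖(1 : ℂ) - r‖ + ‖(1 : ℂ) - r + v * -t‖ := by
      refine le_trans (le_of_eq ?_) (norm_sub_le _ _)
      congr 1; ring
    have a5 : ‖(1 : ℂ) - r‖ = 1 - r := by
      rw [← Complex.ofReal_one, ← Complex.ofReal_sub, Complex.norm_real,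
        Real.norm_of_nonneg (by linarith)]
    linarith
  have hpk : ∀ s : ℂ, s.re ≤ 0 →
      complexMGF id m s * (1 - r * complexMGF id ρ' s) = 1 - r := fun s hs => by
    rw [hL s hs, hu, hv]; ring
  refine ⟨fun s hs => ?_, fun s hs => ?_⟩
  · rw [mul_assoc, hK' s hs, hpk s hs.le]
  · have b1 : mgf id m (-1) * (1 - r * mgf id ρ' (-1)) = 1 - r := by
      have := hpk ((-1 : ℝ) : ℂ) (by simp)
      rw [complexMGF_ofReal, complexMGF_ofReal] at this
      exact_mod_cast this
    have b2 : 0 < mgf id m (-1) := by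
      obtain ⟨y, hy, hy2⟩ := exists_ofReal_complexMGF hm0 (show (-1 : ℝ) ≤ 0 by norm_num)
      rw [complexMGF_ofReal] at hy2
      rwa [Complex.ofReal_inj.mp hy2]
    have b3 : r * (1 - mgf id ρ' (-1)) = (1 - r) * ((mgf id m (-1))⁻¹ - 1) := by
      have : (1 - r) * (mgf id m (-1))⁻¹ = 1 - r * mgf id ρ' (-1) := by
        rw [← b1]; field_simp
      linarith
    have b4 : ‖1 - r * complexMGF id ρ' s‖
        ≤ (1 - r) * (1 + 4 * (1 + ‖s‖) * ((mgf id m (-1))⁻¹ - 1)) := by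
      have : 1 - r * complexMGF id ρ' s = ((1 - r : ℝ) : ℂ) + r * (1 - complexMGF id ρ' s) := by
        push_cast; ring
      rw [this]
      refine (norm_add_le _ _).trans ?_
      rw [norm_mul, Complex.norm_real, Complex.norm_real, Real.norm_of_nonneg h0.le,
        Real.norm_of_nonneg (by linarith)]
      have := mul_le_mul_of_nonneg_left (norm_one_sub_complexMGF_le hρ0' hs) h0.le
      linear_combination this + 4 * (1 + ‖s‖) * b3
    have b5 : ‖complexMGF id m s‖ * ‖1 - r * complexMGF id ρ' s‖ = 1 - r := by
      rw [← norm_mul, hpk s hs, ← Complex.ofReal_one, ← Complex.ofReal_sub, Complex.norm_real,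
        Real.norm_of_nonneg (by linarith)]
    have b6 := mul_le_mul_of_nonneg_left b4 (norm_nonneg (complexMGF id m s))
    rw [b5] at b6
    have : 0 < 1 - r := by linarith
    refine le_of_mul_le_mul_left ?_ this
    linarith

end

/-- The maximum of `f k - f 0` over `k ≤ n`. -/
def walkMax (f : ℕ → ℝ) : ℕ → ℝ
  | 0 => 0
  | n + 1 => max 0 (f 1 - f 0 + walkMax (fun k => f (k + 1)) n)

lemma sub_le_walkMax (f : ℕ → ℝ) {n k : ℕ} (hk : k ≤ n) : f k - f 0 ≤ walkMax f n := by
  induction n generalizing f k with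
  | zero => simp [Nat.le_zero.mp hk, walkMax]
  | succ n ih =>
    cases k with
    | zero => simp [walkMax]
    | succ k =>
      have := ih (fun k => f (k + 1)) (Nat.le_of_succ_le_succ hk)
      refine le_max_of_le_right ?_
      simp only [zero_add] at this
      linarith

lemma exists_walkMax_eq (f : ℕ → ℝ) (n : ℕ) : ∃ k ≤ n, walkMax f n = f k - f 0 := by
  induction n generalizing f with
  | zero => exact ⟨0, le_rfl, by simp [walkMax]⟩
  | succ n ih =>
    obtain ⟨k, hk, h⟩ := ih fun k => f (k + 1)
    rcases le_total 0 (f 1 - f 0 + walkMax (fun k => f (k + 1)) n) with h0 | h0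
    · refine ⟨k + 1, Nat.succ_le_succ hk, ?_⟩
      rw [walkMax, max_eq_right h0, h]
      simp
    · exact ⟨0, Nat.zero_le _, by rw [walkMax, max_eq_left h0, sub_self]⟩

lemma walkMax_sub_const (f : ℕ → ℝ) (a : ℝ) (n : ℕ) :
    walkMax (fun k => f k - a) n = walkMax f n := by
  induction n generalizing f with
  | zero => rfl
  | succ n ih =>
    rw [walkMax, walkMax, ih fun k => f (k + 1)]
    simp

lemma measurable_walkMax (n : ℕ) : Measurable fun f : ℕ → ℝ => walkMax f n := by
  induction n with
  | zero => exact measurable_const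
  | succ n ih =>
    have : Measurable fun f : ℕ → ℝ => walkMax (fun k => f (k + 1)) n :=
      ih.comp (measurable_pi_lambda _ fun k => measurable_pi_apply (k + 1))
    exact measurable_const.max
      (((measurable_pi_apply 1).sub (measurable_pi_apply 0)).add this)

lemma measurable_walkMax_prod : Measurable fun z : (ℕ → ℝ) × ℕ => walkMax z.1 z.2 :=
  measurable_from_prod_countable_left measurable_walkMax

section
variable {Ω : Type*} [MeasurableSpace Ω] {P : Measure Ω}

lemma map_walkMax [IsProbabilityMeasure P] {μ : Measure ℝ} {Y : ℕ → Ω → ℝ} (hY : ∀ k, Measurable (Y k))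
    (hinc : ∀ j, P.map (fun ω => Y (j + 1) ω - Y j ω) = μ)
    (hind : ∀ j, IndepFun (fun ω => Y (j + 1) ω - Y j ω)
      (fun ω k => Y (j + 1 + k) ω - Y (j + 1) ω) P) (n j : ℕ) :
    P.map (fun ω => walkMax (fun k => Y (j + k) ω) n) = lindley μ n := by
  induction n generalizing j with
  | zero => simp [walkMax, lindley, Measure.map_const]
  | succ n ih =>
    have hM : Measurable fun ω => walkMax (fun k => Y (j + 1 + k) ω) n :=
      (measurable_walkMax n).comp (measurable_pi_lambda _ fun k => hY _)
    have hD : Measurable fun ω => Y (j + 1) ω - Y j ω := (hY _).sub (hY _)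
    have hI : IndepFun (fun ω => Y (j + 1) ω - Y j ω)
        (fun ω => walkMax (fun k => Y (j + 1 + k) ω) n) P := by
      have := (hind j).comp measurable_id (measurable_walkMax n)
      refine this.congr (Filter.EventuallyEq.rfl) (Filter.Eventually.of_forall fun ω => ?_)
      exact walkMax_sub_const (fun k => Y (j + 1 + k) ω) _ n
    have hpair := (indepFun_iff_map_prod_eq_prod_map_map hD.aemeasurable hM.aemeasurable).mp hI
    rw [hinc, ih (j + 1)] at hpair
    rw [lindley, ← hpair, Measure.map_map (by fun_prop) (hD.prodMk hM)]
    congr with ω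
    simp only [walkMax, Function.comp, add_zero]
    congr 3
    ext k
    rw [add_assoc, add_comm 1 k]

variable {X : ℝ → Ω → ℝ}

lemma IsLevyProcess.neg (hX : IsLevyProcess P X) : IsLevyProcess P fun t ω => -X t ω where
  measurable t := (hX.measurable t).neg
  init := by filter_upwards [hX.init] with ω h using by rw [h, neg_zero]
  cadlag := by
    filter_upwards [hX.cadlag] with ω h
    refine ⟨fun t ht => (h.1 t ht).neg, fun t ht => ?_⟩
    obtain ⟨l, hl⟩ := h.2 t ht
    exact ⟨-l, hl.neg⟩
  stationary s t hs ht := by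
    have h := congrArg (Measure.map fun x : ℝ => -x) (hX.stationary s t hs ht)
    have hm : Measurable fun ω => X (t + s) ω - X t ω := (hX.measurable _).sub (hX.measurable _)
    rw [Measure.map_map (by fun_prop) hm,
      Measure.map_map (by fun_prop) (hX.measurable _)] at h
    convert! h using 2
    ext ω
    simp only [Function.comp]
    ring
  indep_past t ht := by
    have := (hX.indep_past t ht).comp
      (φ := fun f : Icc (0 : ℝ) t → ℝ => fun u => -f u)
      (ψ := fun f : {s : ℝ // 0 ≤ s} → ℝ => fun u => -f u)
      (measurable_pi_lambda _ fun u => (measurable_pi_apply u).neg)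
      (measurable_pi_lambda _ fun u => (measurable_pi_apply u).neg)
    refine this.congr Filter.EventuallyEq.rfl (Filter.Eventually.of_forall fun ω => ?_)
    ext u
    simp only [Function.comp]
    ring

lemma IsLevyProcess.map_walkMax [IsProbabilityMeasure P] (hX : IsLevyProcess P X) {h : ℝ} (hh : 0 ≤ h) (n : ℕ) :
    P.map (fun ω => walkMax (fun k => X (k * h) ω) n) = lindley (P.map (X h)) n := by
  have := _root_.map_walkMax (P := P) (μ := P.map (X h)) (Y := fun k => X (k * h))
    (fun k => hX.measurable _) (fun j => ?_) (fun j => ?_) n 0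
  · simpa using this
  · rw [← hX.stationary h (j * h) hh (by positivity)]
    congr with ω
    push_cast
    ring_nf
  · have h0 : (0 : ℝ) ≤ ((j + 1 : ℕ) : ℝ) * h := by positivity
    have h1 : (j : ℝ) * h ∈ Icc 0 (((j + 1 : ℕ) : ℝ) * h) := ⟨by positivity, by gcongr; simp⟩
    have := (hX.indep_past (((j + 1 : ℕ) : ℝ) * h) h0).comp
      (φ := fun f => f ⟨((j + 1 : ℕ) : ℝ) * h, h0, le_rfl⟩ - f ⟨(j : ℝ) * h, h1⟩)
      (ψ := fun f => fun k : ℕ => f ⟨(k : ℝ) * h, by positivity⟩)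
      (by fun_prop)
      (measurable_pi_lambda _ fun k => measurable_pi_apply _)
    refine this.congr Filter.EventuallyEq.rfl (Filter.Eventually.of_forall fun ω => ?_)
    ext k
    simp only [Function.comp]
    push_cast
    ring_nf

end

lemma bddAbove_image_of_cadlag {f : ℝ → ℝ} (hr : ∀ t : ℝ, 0 ≤ t → ContinuousWithinAt f (Ici t) t)
    (hl : ∀ t : ℝ, 0 < t → ∃ l : ℝ, Filter.Tendsto f (nhdsWithin t (Ico 0 t)) (nhds l)) (e : ℝ) :
    BddAbove (f '' Icc 0 e) := by
  refine isCompact_Icc.induction_on (p := fun s => BddAbove (f '' s)) ?_ ?_ ?_ ?_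
  · simp
  · exact fun s t hst ht => ht.mono (image_mono hst)
  · intro s t hs ht
    rw [image_union]
    exact hs.union ht
  · intro t ht
    have key : ∀ {F : Filter ℝ} {l : ℝ}, Filter.Tendsto f F (nhds l) → ∀ᶠ s in F, f s ≤ l + 1 :=
      fun h => (h.eventually_lt_const (lt_add_one _)).mono fun _ h => h.le
    have h1 := key (hr t ht.1)
    rcases ht.1.eq_or_lt with h0 | h0
    · refine ⟨{s | f s ≤ f t + 1}, ?_, ⟨f t + 1, by rintro _ ⟨s, hs, rfl⟩; exact hs⟩⟩
      refine nhdsWithin_mono t ?_ h1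
      rw [← h0]
      exact Icc_subset_Ici_self
    · obtain ⟨l, hl⟩ := hl t h0
      have h2 := key hl
      refine ⟨{s | f s ≤ max (f t + 1) (l + 1)}, ?_,
        ⟨max (f t + 1) (l + 1), by rintro _ ⟨s, hs, rfl⟩; exact hs⟩⟩
      have hsub : Icc 0 e ⊆ Ici t ∪ Ico 0 t := fun s hs => by
        rcases le_or_gt t s with h | h
        · exact Or.inl h
        · exact Or.inr ⟨hs.1, h⟩
      refine nhdsWithin_mono t hsub ?_
      rw [nhdsWithin_union]
      exact Filter.mem_sup.mpr ⟨h1.mono fun s hs => hs.trans (le_max_left _ _),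
        h2.mono fun s hs => hs.trans (le_max_right _ _)⟩

lemma tendsto_ceil_mul {f : ℝ → ℝ} {t : ℝ} (ht : 0 ≤ t) (hr : ContinuousWithinAt f (Ici t) t)
    {h : ℕ → ℝ} (hpos : ∀ N, 0 < h N) (hh : Filter.Tendsto h Filter.atTop (nhds 0)) :
    Filter.Tendsto (fun N => f (⌈t / h N⌉₊ * h N)) Filter.atTop (nhds (f t)) := by
  have h1 : ∀ N, t ≤ ⌈t / h N⌉₊ * h N := fun N => by
    rw [← div_le_iff₀ (hpos N)]; exact Nat.le_ceil _
  have h2 : ∀ N, ⌈t / h N⌉₊ * h N ≤ t + h N := fun N => by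
    have := (Nat.ceil_lt_add_one (div_nonneg ht (hpos N).le)).le
    calc _ ≤ (t / h N + 1) * h N := mul_le_mul_of_nonneg_right this (hpos N).le
      _ = t + h N := by rw [add_mul, div_mul_cancel₀ _ (hpos N).ne', one_mul]
  refine Filter.Tendsto.comp hr (tendsto_nhdsWithin_iff.mpr ⟨?_, Filter.Eventually.of_forall h1⟩)
  refine tendsto_of_tendsto_of_tendsto_of_le_of_le tendsto_const_nhds ?_ h1 h2
  simpa using tendsto_const_nhds.add hh

/-- Maxima over fine grids converge to the running supremum of a càdlàg path. -/
lemma tendsto_walkMax_of_cadlag {f : ℝ → ℝ} (h0 : f 0 = 0)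
    (hr : ∀ t : ℝ, 0 ≤ t → ContinuousWithinAt f (Ici t) t)
    (hl : ∀ t : ℝ, 0 < t → ∃ l : ℝ, Filter.Tendsto f (nhdsWithin t (Ico 0 t)) (nhds l))
    {e : ℝ} (he : 0 ≤ e)
    {h : ℕ → ℝ} (hpos : ∀ N, 0 < h N) (hh : Filter.Tendsto h Filter.atTop (nhds 0)) :
    Filter.Tendsto (fun N => walkMax (fun k => f (k * h N)) ⌈e / h N⌉₊) Filter.atTop
      (nhds (sSup (f '' Icc 0 e))) := by
  have hb := bddAbove_image_of_cadlag hr hl e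
  have hle : ∀ t ∈ Icc 0 e, f t ≤ sSup (f '' Icc 0 e) := fun t ht =>
    le_csSup hb (mem_image_of_mem f ht)
  refine tendsto_order.mpr ⟨fun a ha => ?_, fun a ha => ?_⟩
  · obtain ⟨_, ⟨t, ht, rfl⟩, hat⟩ := exists_lt_of_lt_csSup
      ((nonempty_Icc.mpr he).image f) ha
    filter_upwards [(tendsto_ceil_mul ht.1 (hr t ht.1) hpos hh).eventually_const_lt hat] with N hN
    refine hN.trans_le ?_
    have hk : ⌈t / h N⌉₊ ≤ ⌈e / h N⌉₊ :=
      Nat.ceil_mono (div_le_div_of_nonneg_right ht.2 (hpos N).le)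
    simpa [h0] using sub_le_walkMax (fun k : ℕ => f (k * h N)) hk
  · have hfe : f e < a := (hle e ⟨he, le_rfl⟩).trans_lt ha
    filter_upwards [(tendsto_ceil_mul he (hr e he) hpos hh).eventually_lt_const hfe] with N hN
    obtain ⟨k, hk, hM⟩ := exists_walkMax_eq (fun k : ℕ => f (k * h N)) ⌈e / h N⌉₊
    rw [hM]
    simp only [Nat.cast_zero, zero_mul, h0, sub_zero]
    rcases hk.eq_or_lt with h | h
    · rwa [h]
    · refine (hle _ ⟨mul_nonneg (Nat.cast_nonneg _) (hpos N).le, ?_⟩).trans_lt ha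
      rw [← le_div_iff₀ (hpos N)]
      exact (Nat.lt_ceil.mp h).le

section
variable {Ω : Type*} [MeasurableSpace Ω] {P : Measure Ω} [IsProbabilityMeasure P]

lemma expMeasure_real_Iic {q x : ℝ} (hq : 0 < q) (hx : 0 ≤ x) :
    (expMeasure q).real (Iic x) = 1 - Real.exp (-(q * x)) := by
  have := isProbabilityMeasure_expMeasure hq
  rw [← cdf_eq_real, cdf_expMeasure_eq hq, if_pos hx]

lemma expMeasure_real_ceil {q h : ℝ} (hq : 0 < q) (hh : 0 < h) (n : ℕ) :
    (expMeasure q).real {e | ⌈e / h⌉₊ = n + 1}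
      = (1 - Real.exp (-(q * h))) * Real.exp (-(q * h)) ^ n := by
  have := isProbabilityMeasure_expMeasure hq
  have hset : {e : ℝ | ⌈e / h⌉₊ = n + 1} = Iic (((n + 1 : ℕ) : ℝ) * h) \ Iic (n * h) := by
    ext e
    simp only [mem_ofPred_eq, mem_sdiff, mem_Iic, ← div_le_iff₀ hh]
    rw [Nat.ceil_eq_iff (Nat.succ_ne_zero n)]
    simp [and_comm]
  rw [hset, measureReal_sdiff (Iic_subset_Iic.mpr (by gcongr; simp)) measurableSet_Iic,
    expMeasure_real_Iic hq (by positivity), expMeasure_real_Iic hq (by positivity),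
    ← Real.exp_nat_mul]
  have : Real.exp (-(q * (((n + 1 : ℕ) : ℝ) * h)))
      = Real.exp (-(q * h)) * Real.exp (n * -(q * h)) := by
    rw [← Real.exp_add]; congr 1; push_cast; ring
  rw [this, show -(q * (n * h)) = n * -(q * h) by ring]
  ring

lemma expMeasure_real_ceil_zero {q h : ℝ} (hq : 0 < q) (hh : 0 < h) :
    (expMeasure q).real {e | ⌈e / h⌉₊ = 0} = 0 := by
  have hset : {e : ℝ | ⌈e / h⌉₊ = 0} = Iic 0 := by
    ext e
    simp only [mem_ofPred_eq, mem_Iic, Nat.ceil_eq_zero, div_le_iff₀ hh, zero_mul]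
  rw [hset, expMeasure_real_Iic hq le_rfl]
  simp

variable {X : ℝ → Ω → ℝ} {E : Ω → ℝ} {q : ℝ}

lemma IsLevyProcess.integral_geomLindley_eq (hX : IsLevyProcess P X) (hq : 0 < q)
    (hE : Measurable E) (hE_law : Measure.map E P = expMeasure q)
    (hE_indep : IndepFun E (fun ω => (fun t : ℝ => X t ω)) P) {h : ℝ} (hh : 0 < h)
    {g : ℝ → ℂ} (hg : Measurable g) {C : ℝ} (hb : ∀ x, 0 ≤ x → ‖g x‖ ≤ C) :
    ∫ x, g x ∂geomLindley (P.map (X h)) (Real.exp (-(q * h)))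
      = (1 - Real.exp (-(q * h))) * g 0 + Real.exp (-(q * h))
        * ∫ ω, g (walkMax (fun k => X (k * h) ω) ⌈E ω / h⌉₊) ∂P := by
  have hμ : IsProbabilityMeasure (P.map (X h)) :=
    Measure.isProbabilityMeasure_map (hX.measurable h).aemeasurable
  have hν := isProbabilityMeasure_expMeasure hq
  set r := Real.exp (-(q * h)) with hr
  have hr0 : 0 ≤ r := (Real.exp_pos _).le
  have hr1 : r < 1 := by rw [hr, Real.exp_lt_one_iff]; nlinarith
  set W : Ω → ℕ → ℝ := fun ω k => X (k * h) ω
  have hW : Measurable W := measurable_pi_lambda _ fun k => hX.measurable _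
  set T : ℝ → ℕ := fun e => ⌈e / h⌉₊
  have hT : Measurable T := Nat.measurable_ceil.comp (by fun_prop)
  have hI : IndepFun E W P := hE_indep.comp measurable_id
    (measurable_pi_lambda (fun (f : ℝ → ℝ) (k : ℕ) => f (k * h)) fun k => measurable_pi_apply _)
  have hpair := (indepFun_iff_map_prod_eq_prod_map_map hE.aemeasurable hW.aemeasurable).mp hI
  rw [hE_law] at hpair
  have := Measure.isProbabilityMeasure_map (μ := P) hW.aemeasurable
  have hwm : Measurable fun z : ℝ × (ℕ → ℝ) => g (walkMax z.2 (T z.1)) :=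
    hg.comp (measurable_walkMax_prod.comp (measurable_snd.prodMk (hT.comp measurable_fst)))
  have hwn : ∀ f n, 0 ≤ walkMax f n := fun f n => by
    simpa using sub_le_walkMax f (Nat.zero_le n)
  set G : ℕ → ℂ := fun n => ∫ x, g x ∂lindley (P.map (X h)) n with hG
  have hGb : ∀ n, ‖G n‖ ≤ C := fun n => by
    refine (norm_integral_le_of_norm_le_const (C := C) ?_).trans (by simp)
    filter_upwards [ae_lindley_nonneg n] with x hx using hb x hx
  have e1 : ∫ ω, g (walkMax (W ω) (T (E ω))) ∂P = ∫ e, G (T e) ∂expMeasure q := by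
    have a1 : ∫ ω, g (walkMax (W ω) (T (E ω))) ∂P
        = ∫ z, g (walkMax z.2 (T z.1)) ∂(P.map fun ω => (E ω, W ω)) :=
      (integral_map (hE.prodMk hW).aemeasurable hwm.aestronglyMeasurable).symm
    rw [a1, hpair, integral_prod]
    · congr with e
      rw [hG]
      simp only
      have hwW : Measurable fun ω => walkMax (fun k : ℕ => X (k * h) ω) (T e) :=
        (measurable_walkMax _).comp hW
      rw [← hX.map_walkMax hh.le, integral_map hwW.aemeasurable hg.aestronglyMeasurable]
      exact integral_map hW.aemeasurable (hg.comp (measurable_walkMax _)).aestronglyMeasurable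
    · refine (integrable_const C).mono' hwm.aestronglyMeasurable ?_
      exact Filter.Eventually.of_forall fun z => hb _ (hwn _ _)
  have e2 : HasSum (fun n : ℕ => ((1 - r) * r ^ n : ℂ) * G (n + 1)) (∫ e, G (T e) ∂expMeasure q) := by
    have := Measure.isProbabilityMeasure_map (μ := expMeasure q) hT.aemeasurable
    have hi : Integrable G ((expMeasure q).map T) :=
      (integrable_const C).mono' (by fun_prop) (Filter.Eventually.of_forall hGb)
    have a1 : ∫ e, G (T e) ∂expMeasure q = ∫ n, G n ∂((expMeasure q).map T) :=
      (integral_map hT.aemeasurable (by fun_prop)).symm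
    have hms : ∀ n : ℕ, ((expMeasure q).map T).real {n} = (expMeasure q).real {e | T e = n} :=
      fun n => by rw [map_measureReal_apply hT (measurableSet_singleton n)]; rfl
    have a2 : HasSum (fun n : ℕ => ((expMeasure q).map T).real {n} • G n)
        (∫ n, G n ∂((expMeasure q).map T)) := by
      have := hasSum_integral_iUnion (f := G) (μ := (expMeasure q).map T)
        (s := fun n : ℕ => ({n} : Set ℕ))
        (fun n => measurableSet_singleton n)
        (fun i j hij => by simpa [Function.onFun] using hij) hi.integrableOn
      rw [iUnion_of_singleton, setIntegral_univ] at this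
      refine this.congr_fun fun n => ?_
      rw [integral_singleton]
    rw [← hasSum_nat_add_iff' 1] at a2
    rw [a1]
    simp only [Finset.sum_range_one, hms] at a2
    rw [show (expMeasure q).real {e | T e = 0} = 0 from expMeasure_real_ceil_zero hq hh, zero_smul,
      sub_zero] at a2
    refine a2.congr_fun fun n => ?_
    rw [show (expMeasure q).real {e | T e = n + 1} = _ from expMeasure_real_ceil hq hh n, ← hr,
      Complex.real_smul]
    push_cast
    rfl
  have e3 := hasSum_integral_geomLindley (μ := P.map (X h)) hr0 hr1 hg hb
  rw [← hasSum_nat_add_iff' 1] at e3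
  have e4 := (e2.mul_left (r : ℂ)).unique (e3.congr_fun fun n => by simp only [hG]; ring)
  rw [← e1] at e4
  change _ = _ + (r : ℂ) * ∫ ω, g (walkMax (W ω) (T (E ω))) ∂P
  rw [e4]
  simp [lindley]

end

lemma tendsto_one_sub_exp_div {h : ℕ → ℝ} (hpos : ∀ N, 0 < h N)
    (hh : Filter.Tendsto h Filter.atTop (nhds 0)) (z : ℂ) :
    Filter.Tendsto (fun N => (1 - Complex.exp (-(h N) * z)) / h N) Filter.atTop (nhds z) := by
  have hd : HasDerivAt (fun t : ℝ => Complex.exp (-t * z)) (-z) 0 := by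
    have h1 : HasDerivAt (fun t : ℝ => -(t : ℂ) * z) (-1 * z) 0 :=
      ((Complex.ofRealCLM.hasDerivAt (x := (0 : ℝ))).neg).mul_const z
    have := h1.cexp
    simpa using this
  have hs := hd.tendsto_slope_zero
  have hN : Filter.Tendsto h Filter.atTop (nhdsWithin 0 {0}ᶜ) :=
    tendsto_nhdsWithin_iff.mpr ⟨hh, Filter.Eventually.of_forall fun N => (hpos N).ne'⟩
  have := (hs.comp hN).neg
  rw [neg_neg] at this
  refine this.congr fun N => ?_
  simp only [Function.comp, zero_add, Complex.ofReal_zero, neg_zero, zero_mul, Complex.exp_zero,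
    Complex.real_smul, Complex.ofReal_inv]
  ring

section
variable {Ω : Type*} [MeasurableSpace Ω] {P : Measure Ω}
  {X : ℝ → Ω → ℝ} {E : Ω → ℝ} {q : ℝ}

/-- The running supremum of `X` at time `E`. -/
def supAt (X : ℝ → Ω → ℝ) (E : Ω → ℝ) (ω : Ω) : ℝ := sSup ((fun s => X s ω) '' Icc 0 (E ω))

lemma ae_nonneg_of_expMeasure (hq : 0 < q) (hE : Measurable E)
    (hE_law : Measure.map E P = expMeasure q) : ∀ᵐ ω ∂P, 0 ≤ E ω := by
  have hν := isProbabilityMeasure_expMeasure hq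
  have h1 : ∀ᵐ e ∂(P.map E), 0 ≤ e := by
    rw [hE_law, ae_iff]
    refine measure_mono_null (t := Iic 0) (fun x hx => le_of_lt (not_le.mp hx)) ?_
    have := expMeasure_real_Iic hq (le_refl (0 : ℝ))
    simpa [measureReal_eq_zero_iff] using this
  exact (ae_map_iff hE.aemeasurable measurableSet_Ici).mp h1

lemma IsLevyProcess.tendsto_walkMax (hX : IsLevyProcess P X) (hq : 0 < q) (hE : Measurable E)
    (hE_law : Measure.map E P = expMeasure q) {h : ℕ → ℝ} (hpos : ∀ N, 0 < h N)
    (hh : Filter.Tendsto h Filter.atTop (nhds 0)) :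
    ∀ᵐ ω ∂P, Filter.Tendsto (fun N => walkMax (fun k => X (k * h N) ω) ⌈E ω / h N⌉₊) Filter.atTop
      (nhds (supAt X E ω)) := by
  filter_upwards [hX.init, hX.cadlag, ae_nonneg_of_expMeasure hq hE hE_law] with ω h0 hc he
  exact tendsto_walkMax_of_cadlag h0 hc.1 hc.2 he hpos hh

lemma IsLevyProcess.measurable_walkMax_ceil (hX : IsLevyProcess P X) (hE : Measurable E) (h : ℝ) :
    Measurable fun ω => walkMax (fun k => X (k * h) ω) ⌈E ω / h⌉₊ :=
  measurable_walkMax_prod.comp ((measurable_pi_lambda _ fun k => hX.measurable _).prodMk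
    (Nat.measurable_ceil.comp (by fun_prop)))

lemma walkMax_nonneg (f : ℕ → ℝ) (n : ℕ) : 0 ≤ walkMax f n := by
  simpa using sub_le_walkMax f (Nat.zero_le n)

lemma tendsto_inv_succ : Filter.Tendsto (fun N : ℕ => 1 / ((N : ℝ) + 1)) Filter.atTop (nhds 0) :=
  tendsto_one_div_add_atTop_nhds_zero_nat

lemma IsLevyProcess.aemeasurable_supAt (hX : IsLevyProcess P X) (hq : 0 < q) (hE : Measurable E)
    (hE_law : Measure.map E P = expMeasure q) : AEMeasurable (supAt X E) P :=
  aemeasurable_of_tendsto_metrizable_ae Filter.atTop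
    (fun N => (hX.measurable_walkMax_ceil hE _).aemeasurable)
    (hX.tendsto_walkMax hq hE hE_law (fun N => by positivity) tendsto_inv_succ)

lemma IsLevyProcess.ae_supAt_nonneg (hX : IsLevyProcess P X) (hq : 0 < q) (hE : Measurable E)
    (hE_law : Measure.map E P = expMeasure q) : ∀ᵐ x ∂(P.map (supAt X E)), 0 ≤ x := by
  rw [ae_map_iff (hX.aemeasurable_supAt hq hE hE_law) measurableSet_Ici]
  filter_upwards [hX.tendsto_walkMax hq hE hE_law (fun N : ℕ => by positivity) tendsto_inv_succ]
    with ω h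
  exact ge_of_tendsto' h fun N => walkMax_nonneg _ _

lemma IsLevyProcess.tendsto_complexMGF [IsProbabilityMeasure P] (hX : IsLevyProcess P X) (hq : 0 < q) (hE : Measurable E)
    (hE_law : Measure.map E P = expMeasure q)
    (hE_indep : IndepFun E (fun ω => (fun t : ℝ => X t ω)) P)
    {h : ℕ → ℝ} (hpos : ∀ N, 0 < h N) (hh : Filter.Tendsto h Filter.atTop (nhds 0))
    {s : ℂ} (hs : s.re ≤ 0) :
    Filter.Tendsto (fun N => complexMGF id
        (geomLindley (P.map (X (h N))) (Real.exp (-(q * h N)))) s) Filter.atTop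
      (nhds (complexMGF id (P.map (supAt X E)) s)) := by
  have hlim : Filter.Tendsto (fun N => ∫ ω, Complex.exp
      (s * (walkMax (fun k => X (k * h N) ω) ⌈E ω / h N⌉₊ : ℝ)) ∂P) Filter.atTop
      (nhds (∫ ω, Complex.exp (s * (supAt X E ω : ℝ)) ∂P)) := by
    refine tendsto_integral_of_dominated_convergence (fun _ => 1) (fun N => ?_)
      (integrable_const _) (fun N => ?_) ?_
    · have := hX.measurable_walkMax_ceil hE (h N)
      exact (Measurable.cexp (by fun_prop)).aestronglyMeasurable
    · exact Filter.Eventually.of_forall fun ω => norm_exp_mul_le_one hs (walkMax_nonneg _ _)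
    · filter_upwards [hX.tendsto_walkMax hq hE hE_law hpos hh] with ω hω
      exact ((Complex.continuous_exp.comp
        (continuous_const.mul Complex.continuous_ofReal)).tendsto _).comp hω
  have hr : Filter.Tendsto (fun N => (Real.exp (-(q * h N)) : ℂ)) Filter.atTop (nhds 1) := by
    have : Continuous fun t : ℝ => (Real.exp (-(q * t)) : ℂ) := by fun_prop
    have := (this.tendsto 0).comp hh
    simpa [Function.comp_def] using this
  have e1 : complexMGF id (P.map (supAt X E)) s = ∫ ω, Complex.exp (s * (supAt X E ω : ℝ)) ∂P := by
    rw [complexMGF_id_map (hX.aemeasurable_supAt hq hE hE_law)]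
    rfl
  have e2 := ((tendsto_const_nhds (x := (1 : ℂ))).sub hr).mul
    (tendsto_const_nhds (x := Complex.exp (s * (0 : ℝ)))) |>.add (hr.mul hlim)
  rw [e1]
  refine (e2.congr fun N => ?_).trans (by simp)
  exact (hX.integral_geomLindley_eq hq hE hE_law hE_indep (hpos N)
    (g := fun x : ℝ => Complex.exp (s * x)) (by fun_prop) (C := 1)
    (fun x hx => norm_exp_mul_le_one hs hx)).symm

lemma indepFun_neg (hE_indep : IndepFun E (fun ω => (fun t : ℝ => X t ω)) P) :
    IndepFun E (fun ω => (fun t : ℝ => -X t ω)) P :=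
  hE_indep.comp measurable_id
    (measurable_pi_lambda (fun (f : ℝ → ℝ) (t : ℝ) => -f t) fun t => (measurable_pi_apply t).neg)

/-- Wiener–Hopf factorisation of a Lévy process at an independent exponential time. -/
lemma IsLevyProcess.wienerHopf [IsProbabilityMeasure P] (hX : IsLevyProcess P X) (hq : 0 < q) (hE : Measurable E)
    (hE_law : Measure.map E P = expMeasure q)
    (hE_indep : IndepFun E (fun ω => (fun t : ℝ => X t ω)) P) {Ψ : ℝ → ℂ}
    (hchar : ∀ θ t : ℝ, 0 ≤ t → ∫ ω, Complex.exp (Complex.I * θ * X t ω) ∂P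
      = Complex.exp (-(t : ℂ) * Ψ θ)) :
    (∀ θ : ℝ, (q + Ψ θ) * (complexMGF id (P.map (supAt X E)) (θ * Complex.I)
      * complexMGF id (P.map (supAt (fun t ω => -X t ω) E)) (-(θ * Complex.I))) = q) ∧
    ∃ C : ℝ, ∀ s : ℂ, s.re ≤ 0 →
      1 ≤ C * (1 + ‖s‖) * ‖complexMGF id (P.map (supAt X E)) s‖ := by
  set h : ℕ → ℝ := fun N => 1 / ((N : ℝ) + 1)
  have hpos : ∀ N, 0 < h N := fun N => by positivity
  have hh : Filter.Tendsto h Filter.atTop (nhds 0) := tendsto_inv_succ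
  have hlimX := fun {s : ℂ} (hs : s.re ≤ 0) =>
    hX.tendsto_complexMGF hq hE hE_law hE_indep hpos hh hs
  have hlimY := fun {s : ℂ} (hs : s.re ≤ 0) =>
    hX.neg.tendsto_complexMGF hq hE hE_law (indepFun_neg hE_indep) hpos hh hs
  have hprob : ∀ N, IsProbabilityMeasure (P.map (X (h N))) := fun N =>
    Measure.isProbabilityMeasure_map (hX.measurable _).aemeasurable
  have hmapneg : ∀ N, P.map (fun ω => -X (h N) ω) = (P.map (X (h N))).map fun x => -x := fun N => by
    rw [Measure.map_map (by fun_prop) (hX.measurable _)]; rfl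
  have hr1 : ∀ N, Real.exp (-(q * h N)) < 1 := fun N => by
    rw [Real.exp_lt_one_iff]; nlinarith [hpos N]
  have hWH := fun N => geomLindley_wienerHopf (μ := P.map (X (h N))) (Real.exp_pos _) (hr1 N)
  have hpS := Measure.isProbabilityMeasure_map (hX.aemeasurable_supAt hq hE hE_law)
  constructor
  · intro θ
    have hθ : (θ * Complex.I : ℂ).re = 0 := by simp
    have hθ' : (-(θ * Complex.I) : ℂ).re ≤ 0 := by simp
    have hφ : ∀ N, 1 - Real.exp (-(q * h N)) * complexMGF id (P.map (X (h N))) (θ * Complex.I)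
        = 1 - Complex.exp (-(h N) * (q + Ψ θ)) := fun N => by
      have : complexMGF id (P.map (X (h N))) (θ * Complex.I)
          = Complex.exp (-(h N : ℂ) * Ψ θ) := by
        rw [complexMGF_id_map (hX.measurable _).aemeasurable, complexMGF, ← hchar θ _ (hpos N).le]
        congr with ω
        ring_nf
      rw [this, Complex.ofReal_exp, ← Complex.exp_add]
      congr 2
      push_cast
      ring
    have hq' : ∀ N, (1 : ℂ) - Real.exp (-(q * h N)) = 1 - Complex.exp (-(h N) * q) := fun N => by
      rw [Complex.ofReal_exp]
      congr 2
      push_cast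
      ring
    have l1 := (tendsto_one_sub_exp_div hpos hh (q + Ψ θ)).mul ((hlimX hθ.le).mul (hlimY hθ'))
    have l2 := tendsto_one_sub_exp_div hpos hh q
    refine tendsto_nhds_unique l1 (l2.congr fun N => ?_)
    have := (hWH N).1 _ hθ
    rw [hφ, hq', ← hmapneg] at this
    rw [← this]
    ring
  · set y := mgf id (P.map (supAt X E)) (-1)
    have hy : 0 < y := by
      obtain ⟨z, hz, hz2⟩ := exists_ofReal_complexMGF (hX.ae_supAt_nonneg hq hE hE_law)
        (show (-1 : ℝ) ≤ 0 by norm_num)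
      rw [complexMGF_ofReal] at hz2
      rwa [← Complex.ofReal_inj.mp hz2] at hz
    have hlim1 : Filter.Tendsto (fun N => mgf id
        (geomLindley (P.map (X (h N))) (Real.exp (-(q * h N)))) (-1)) Filter.atTop (nhds y) := by
      have := hlimX (s := ((-1 : ℝ) : ℂ)) (by simp)
      simp only [complexMGF_ofReal] at this
      exact Filter.tendsto_ofReal_iff.mp this
    have hy1 : y ≤ 1 := by
      have := norm_complexMGF_le_one (hX.ae_supAt_nonneg hq hE hE_law) (s := ((-1 : ℝ) : ℂ))
        (by simp)
      rw [complexMGF_ofReal, Complex.norm_real] at this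
      exact (le_abs_self _).trans this
    have hyi : 1 ≤ y⁻¹ := (one_le_inv₀ hy).mpr hy1
    refine ⟨1 + 4 * (y⁻¹ - 1), fun s hs => ?_⟩
    have l : Filter.Tendsto (fun N => (1 + 4 * (1 + ‖s‖) * ((mgf id
        (geomLindley (P.map (X (h N))) (Real.exp (-(q * h N)))) (-1))⁻¹ - 1))
        * ‖complexMGF id (geomLindley (P.map (X (h N))) (Real.exp (-(q * h N)))) s‖) Filter.atTop
        (nhds ((1 + 4 * (1 + ‖s‖) * (y⁻¹ - 1)) * ‖complexMGF id (P.map (supAt X E)) s‖)) :=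
      (tendsto_const_nhds.add (((hlim1.inv₀ hy.ne').sub_const 1).const_mul _)).mul (hlimX hs).norm
    have := ge_of_tendsto' l fun N => (hWH N).2 s hs
    refine this.trans (mul_le_mul_of_nonneg_right ?_ (norm_nonneg _))
    nlinarith [norm_nonneg s]

end

lemma integrableOn_pow_mul_exp_neg (n : ℕ) {z : ℂ} (hz : 0 < z.re) :
    IntegrableOn (fun x : ℝ => (x : ℂ) ^ n * Complex.exp (-z * x)) (Ioi 0) := by
  have h := integrableOn_rpow_mul_exp_neg_mul_rpow (s := n) (p := 1) (b := z.re)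
    (by linarith [(Nat.cast_nonneg n : (0 : ℝ) ≤ n)]) one_pos hz
  refine h.mono' (by fun_prop) ?_
  filter_upwards [ae_restrict_mem measurableSet_Ioi] with x hx
  rw [norm_mul, norm_pow, Complex.norm_exp, Complex.norm_real, Real.norm_of_nonneg (le_of_lt hx)]
  simp

lemma integral_pow_mul_exp_neg (n : ℕ) {z : ℂ} (hz : 0 < z.re) :
    ∫ x : ℝ in Ioi 0, (x : ℂ) ^ n * Complex.exp (-z * x) = n.factorial / z ^ (n + 1) := by
  have hz0 : z ≠ 0 := fun h => by simp [h] at hz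
  induction n with
  | zero =>
    have := integral_exp_mul_complex_Ioi (a := -z) (by simpa using hz) 0
    simpa using this
  | succ n ih =>
    have hd : ∀ x ∈ Ici (0 : ℝ), HasDerivAt
        (fun x : ℝ => (x : ℂ) ^ (n + 1) * Complex.exp (-z * x))
        ((n + 1) * ((x : ℂ) ^ n * Complex.exp (-z * x))
          - z * ((x : ℂ) ^ (n + 1) * Complex.exp (-z * x))) x := fun x _ => by
      have h1 : HasDerivAt (fun x : ℝ => (x : ℂ)) 1 x := Complex.ofRealCLM.hasDerivAt
      have h2 := (h1.pow (n + 1)).mul ((h1.const_mul (-z)).cexp)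
      refine h2.congr_deriv ?_
      simp only [Pi.pow_apply, Nat.add_sub_cancel]
      push_cast
      ring
    have hi := ((integrableOn_pow_mul_exp_neg n hz).const_mul (n + 1 : ℂ)).sub
      ((integrableOn_pow_mul_exp_neg (n + 1) hz).const_mul z)
    have hlim : Filter.Tendsto (fun x : ℝ => (x : ℂ) ^ (n + 1) * Complex.exp (-z * x))
        Filter.atTop (nhds 0) := by
      rw [tendsto_zero_iff_norm_tendsto_zero]
      have := Real.tendsto_pow_mul_exp_neg_atTop_nhds_zero (n + 1)
      have h3 := ((this.comp (Filter.tendsto_id.const_mul_atTop hz)).const_mul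
        ((z.re ^ (n + 1))⁻¹))
      rw [mul_zero] at h3
      refine h3.congr' ?_
      filter_upwards [Filter.eventually_ge_atTop 0] with x hx
      rw [norm_mul, norm_pow, Complex.norm_exp, Complex.norm_real, Real.norm_of_nonneg hx]
      simp only [Function.comp, id, mul_pow]
      rw [← mul_assoc, inv_mul_cancel_left₀ (pow_ne_zero _ hz.ne')]
      simp
    have key := integral_Ioi_of_hasDerivAt_of_tendsto' hd hi hlim
    rw [integral_sub ((integrableOn_pow_mul_exp_neg n hz).const_mul (n + 1 : ℂ))
      ((integrableOn_pow_mul_exp_neg (n + 1) hz).const_mul z),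
      integral_const_mul, integral_const_mul, ih] at key
    simp only [Complex.ofReal_zero, zero_pow (Nat.succ_ne_zero n), zero_mul, sub_zero] at key
    have : z * ∫ x : ℝ in Ioi 0, (x : ℂ) ^ (n + 1) * Complex.exp (-z * x)
        = (n + 1) * (n.factorial / z ^ (n + 1)) := (sub_eq_zero.mp key).symm
    rw [Nat.factorial_succ, eq_div_iff (pow_ne_zero _ hz0), pow_succ, mul_comm, mul_assoc, this]
    push_cast
    field_simp

/-- The kernel `x₊ⁿ e^{-l x} / n!`. -/
def gammaKernel (l : ℝ) (n : ℕ) (x : ℝ) : ℝ := max x 0 ^ n * Real.exp (-l * x) / n.factorial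

/-- The frequency `2πiξ`. -/
def freq (ξ : ℝ) : ℂ := ((2 * Real.pi * ξ : ℝ) : ℂ) * Complex.I

section
variable {l : ℝ} {n : ℕ}

@[fun_prop]
lemma continuous_gammaKernel : Continuous (gammaKernel l n) := by
  unfold gammaKernel; fun_prop

@[fun_prop]
lemma continuous_freq : Continuous freq := by unfold freq; fun_prop

lemma gammaKernel_nonneg (x : ℝ) : 0 ≤ gammaKernel l n x := by
  unfold gammaKernel; positivity

lemma gammaKernel_of_nonpos (hn : n ≠ 0) {x : ℝ} (hx : x ≤ 0) : gammaKernel l n x = 0 := by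
  simp [gammaKernel, max_eq_right hx, hn]

lemma gammaKernel_of_nonneg {x : ℝ} (hx : 0 ≤ x) :
    gammaKernel l n x = x ^ n * Real.exp (-l * x) / n.factorial := by
  rw [gammaKernel, max_eq_left hx]

@[simp] lemma freq_re (ξ : ℝ) : (freq ξ).re = 0 := by simp [freq]

lemma freq_im (ξ : ℝ) : (freq ξ).im = 2 * Real.pi * ξ := by simp [freq]

lemma norm_freq (ξ : ℝ) : ‖freq ξ‖ = 2 * Real.pi * |ξ| := by
  rw [freq, norm_mul, Complex.norm_I, mul_one, Complex.norm_real, Real.norm_eq_abs, abs_mul,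
    abs_of_pos (by positivity)]

lemma add_freq_ne_zero (hl : 0 < l) (ξ : ℝ) : (l + freq ξ : ℂ) ≠ 0 := fun h => by
  have := congrArg Complex.re h
  simp at this
  exact hl.ne' this

lemma gammaKernel_integrable (hl : 0 < l) (hn : n ≠ 0) : Integrable (gammaKernel l n) := by
  have h : IntegrableOn (gammaKernel l n) (Ioi 0) := by
    refine IntegrableOn.congr_fun (((integrableOn_pow_mul_exp_neg n (z := l)
      (by simpa using hl)).norm).div_const (n.factorial : ℝ)) (fun x hx => ?_) measurableSet_Ioi
    rw [gammaKernel_of_nonneg (le_of_lt hx), norm_mul, norm_pow, Complex.norm_exp,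
      Complex.norm_real, Real.norm_of_nonneg (le_of_lt hx)]
    simp
  refine (integrableOn_iff_integrable_of_support_subset fun x hx => ?_).mp h
  by_contra h'
  exact hx (gammaKernel_of_nonpos hn (not_lt.mp h'))

lemma integral_gammaKernel_mul_exp (hn : n ≠ 0) {w : ℂ} (hw : 0 < l + w.re) :
    ∫ x : ℝ, Complex.exp (-w * x) * gammaKernel l n x = 1 / (l + w) ^ (n + 1) := by
  have h1 : ∫ x : ℝ, Complex.exp (-w * x) * gammaKernel l n x
      = ∫ x : ℝ in Ioi 0, Complex.exp (-w * x) * gammaKernel l n x := by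
    refine (setIntegral_eq_integral_of_forall_compl_eq_zero fun x hx => ?_).symm
    rw [gammaKernel_of_nonpos hn (not_lt.mp hx)]
    simp
  have h2 : ∫ x : ℝ in Ioi 0, Complex.exp (-w * x) * gammaKernel l n x
      = ∫ x : ℝ in Ioi 0, ((x : ℂ) ^ n * Complex.exp (-(l + w) * x)) / n.factorial := by
    refine setIntegral_congr_fun measurableSet_Ioi fun x hx => ?_
    simp only [gammaKernel_of_nonneg (le_of_lt hx)]
    push_cast
    rw [show -((l : ℂ) + w) * x = -w * x + -l * x by ring, Complex.exp_add]
    ring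
  rw [h1, h2, integral_div, integral_pow_mul_exp_neg n (by simpa using hw)]
  have : (n.factorial : ℂ) ≠ 0 := by exact_mod_cast n.factorial_ne_zero
  field_simp

lemma one_le_norm_add_freq (hl : 1 ≤ l) (ξ : ℝ) : 1 ≤ ‖(l + freq ξ : ℂ)‖ :=
  hl.trans (by simpa using Complex.re_le_norm (l + freq ξ : ℂ))

lemma one_add_norm_freq_le (hl : 1 ≤ l) (ξ : ℝ) : 1 + ‖freq ξ‖ ≤ 2 * ‖(l + freq ξ : ℂ)‖ := by
  have h1 := one_le_norm_add_freq hl ξ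
  have h2 : ‖freq ξ‖ ≤ ‖(l + freq ξ : ℂ)‖ := by
    have := Complex.abs_im_le_norm (l + freq ξ : ℂ)
    rw [norm_freq]
    simpa [freq_im, abs_mul, abs_of_pos Real.pi_pos] using this
  linarith

/-- Functions of growth of order `n` are integrable against `(l + 2πiξ)^(-(n + 2))`. -/
lemma integrable_div_add_freq (hl : 1 ≤ l) {f : ℝ → ℂ} (hf : AEStronglyMeasurable f) {C : ℝ}
    (hb : ∀ ξ, ‖f ξ‖ ≤ C * (1 + ‖freq ξ‖) ^ n) :
    Integrable fun ξ => f ξ / (l + freq ξ) ^ (n + 2) := by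
  have hC : 0 ≤ C := by
    have := (norm_nonneg _).trans (hb 0)
    simpa [freq] using this
  have hd : Continuous fun ξ : ℝ => ((l + freq ξ : ℂ) ^ (n + 2))⁻¹ :=
    Continuous.inv₀ (by fun_prop) fun ξ => pow_ne_zero _ (add_freq_ne_zero (by linarith) ξ)
  refine (integrable_inv_one_add_sq.const_mul (C * 2 ^ n)).mono'
    ((hf.mul hd.aestronglyMeasurable).congr (Filter.Eventually.of_forall fun ξ => by
      simp [div_eq_mul_inv])) ?_
  refine Filter.Eventually.of_forall fun ξ => ?_
  have h1 := one_add_norm_freq_le hl ξ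
  have h0 := one_le_norm_add_freq hl ξ
  have hp : 0 < ‖(l + freq ξ : ℂ)‖ := by linarith
  have h2 : 1 + ξ ^ 2 ≤ ‖(l + freq ξ : ℂ)‖ ^ 2 := by
    have e1 : ‖(l + freq ξ : ℂ)‖ ^ 2 = l ^ 2 + (2 * Real.pi * ξ) ^ 2 := by
      rw [← Complex.normSq_eq_norm_sq, Complex.normSq_apply]
      simp [freq_im]
      ring
    have : 1 ≤ (2 * Real.pi) ^ 2 := one_le_pow₀ (by linarith [Real.pi_gt_three])
    rw [e1]
    nlinarith [sq_nonneg ξ]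
  rw [norm_div, norm_pow, div_le_iff₀ (by positivity)]
  calc ‖f ξ‖ ≤ C * (1 + ‖freq ξ‖) ^ n := hb ξ
    _ ≤ C * (2 * ‖(l + freq ξ : ℂ)‖) ^ n := by gcongr
    _ = C * 2 ^ n * ((1 + ξ ^ 2)⁻¹ * (‖(l + freq ξ : ℂ)‖ ^ n * (1 + ξ ^ 2))) := by
      rw [mul_pow]; field_simp
    _ ≤ C * 2 ^ n * ((1 + ξ ^ 2)⁻¹ * (‖(l + freq ξ : ℂ)‖ ^ n * ‖(l + freq ξ : ℂ)‖ ^ 2)) := by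
      gcongr
    _ = _ := by ring

open FourierTransform in
/-- Fourier inversion for the Gamma kernel. -/
lemma integral_exp_div_add_freq (hl : 1 ≤ l) (hn : n ≠ 0) (x : ℝ) :
    ∫ ξ : ℝ, Complex.exp (freq ξ * x) / (l + freq ξ) ^ (n + 1) = gammaKernel l n x := by
  have hl0 : 0 < l := by linarith
  set g : ℝ → ℂ := fun x => gammaKernel l n x
  have hF : 𝓕 g = fun ξ : ℝ => 1 / (l + freq ξ : ℂ) ^ (n + 1) := by
    ext ξ
    rw [Real.fourier_real_eq_integral_exp_smul,
      ← integral_gammaKernel_mul_exp hn (w := freq ξ) (by simpa using hl0)]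
    congr with x
    rw [smul_eq_mul, freq]
    congr 2
    push_cast
    ring
  have hgi : Integrable g := (gammaKernel_integrable hl0 hn).ofReal
  have hFi : Integrable (𝓕 g) := by
    rw [hF]
    obtain ⟨m, rfl⟩ := Nat.exists_eq_succ_of_ne_zero hn
    refine integrable_div_add_freq (n := m) hl (f := fun _ => 1) (by fun_prop) (C := 1) fun ξ => ?_
    rw [norm_one, one_mul]
    exact one_le_pow₀ (by linarith [norm_nonneg (freq ξ)])
  have hgc : Continuous g := by fun_prop
  have := congrFun (hgc.fourierInv_fourier_eq hgi hFi) x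
  rw [hF, Real.fourierInv_eq'] at this
  rw [show (gammaKernel l n x : ℂ) = g x from rfl, ← this]
  congr with ξ
  rw [smul_eq_mul, mul_one_div, freq]
  congr 2
  simp
  ring

end

section
variable {l : ℝ} {n : ℕ}

lemma integrable_exp_div_add_freq (hl : 1 ≤ l) (hn : n ≠ 0) (μ : Measure ℝ) [IsFiniteMeasure μ]
    (y : ℝ) :
    Integrable (fun p : ℝ × ℝ => Complex.exp (freq p.1 * (p.2 - y)) / (l + freq p.1) ^ (n + 1))
      (volume.prod μ) := by
  obtain ⟨m, rfl⟩ := Nat.exists_eq_succ_of_ne_zero hn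
  have h1 : Integrable fun ξ : ℝ => (1 : ℂ) / (l + freq ξ) ^ (m + 2) :=
    integrable_div_add_freq hl (f := fun _ => 1) (by fun_prop) (C := 1) fun ξ => by
      rw [norm_one, one_mul]
      exact one_le_pow₀ (by linarith [norm_nonneg (freq ξ)])
  have h2 := h1.mul_prod (integrable_const (1 : ℂ) (μ := μ))
  refine (h2.bdd_mul (c := 1) (f := fun p : ℝ × ℝ => Complex.exp (freq p.1 * (p.2 - y)))
    (Continuous.aestronglyMeasurable (by fun_prop)) (Filter.Eventually.of_forall fun p => ?_)).congr
    (Filter.Eventually.of_forall fun p => ?_)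
  · rw [Complex.norm_exp, Real.exp_le_one_iff]
    simp [← Complex.ofReal_sub]
  · simp [div_eq_mul_inv]

/-- Fourier inversion for the convolution of a finite measure with the Gamma kernel. -/
lemma integral_transform_div_add_freq (hl : 1 ≤ l) (hn : n ≠ 0) (μ : Measure ℝ)
    [IsFiniteMeasure μ] (y : ℝ) :
    ∫ ξ : ℝ, Complex.exp (-freq ξ * y) * (∫ x : ℝ, Complex.exp (freq ξ * x) ∂μ)
      / (l + freq ξ) ^ (n + 1) = ((∫ x, gammaKernel l n (x - y) ∂μ : ℝ) : ℂ) := by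
  have h1 : ∀ ξ : ℝ, Complex.exp (-freq ξ * y) * (∫ x : ℝ, Complex.exp (freq ξ * x) ∂μ)
      / (l + freq ξ) ^ (n + 1)
      = ∫ x : ℝ, Complex.exp (freq ξ * (x - y)) / (l + freq ξ) ^ (n + 1) ∂μ := fun ξ => by
    rw [integral_div, ← integral_const_mul]
    congr 2 with x
    rw [← Complex.exp_add]
    ring_nf
  simp_rw [h1]
  rw [integral_integral_swap (integrable_exp_div_add_freq hl hn μ y), ← integral_complex_ofReal]
  congr with x
  rw [← integral_exp_div_add_freq hl hn]
  push_cast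
  rfl

/-- The Fourier-side expression of the fact that a positive-definite exponent generates
positive kernels. -/
lemma integral_exponent_div_add_freq_re_nonpos {Ω : Type*} [MeasurableSpace Ω] {P : Measure Ω}
    [IsProbabilityMeasure P] {X : ℝ → Ω → ℝ} (hX : ∀ t, Measurable (X t)) {Ψ : ℝ → ℂ}
    (hchar : ∀ θ t : ℝ, 0 ≤ t → ∫ ω, Complex.exp (Complex.I * θ * X t ω) ∂P
      = Complex.exp (-(t : ℂ) * Ψ θ))
    (hc : Continuous Ψ) {C : ℝ}
    (hb : ∀ ξ : ℝ, ‖Ψ (2 * Real.pi * ξ)‖ ≤ C * (1 + ‖freq ξ‖) ^ n) (hl : 1 ≤ l) :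
    (∫ ξ : ℝ, Ψ (2 * Real.pi * ξ) / (l + freq ξ) ^ (n + 2)).re ≤ 0 := by
  have hl0 : 0 < l := by linarith
  have hre : ∀ θ, 0 ≤ (Ψ θ).re := fun θ => by
    have h1 : ‖∫ ω, Complex.exp (Complex.I * θ * X 1 ω) ∂P‖ ≤ 1 := by
      refine (norm_integral_le_of_norm_le_const (C := 1)
        (Filter.Eventually.of_forall fun ω => ?_)).trans (by simp)
      rw [Complex.norm_exp, Real.exp_le_one_iff]
      simp
    rw [hchar θ 1 zero_le_one, Complex.norm_exp, Real.exp_le_one_iff] at h1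
    simpa using h1
  obtain ⟨h, hpos, hh⟩ : ∃ h : ℕ → ℝ, (∀ N, 0 < h N) ∧ Filter.Tendsto h Filter.atTop (nhds 0) :=
    ⟨fun N => 1 / ((N : ℝ) + 1), fun N => by positivity, tendsto_inv_succ⟩
  have hcΨ : Continuous fun ξ : ℝ => Ψ (2 * Real.pi * ξ) := hc.comp (by fun_prop)
  have hC : 0 ≤ C := by
    have := (norm_nonneg _).trans (hb 0)
    simpa [freq] using this
  have hF : Integrable fun ξ : ℝ => (1 : ℂ) / (l + freq ξ) ^ (n + 2) :=
    integrable_div_add_freq hl (f := fun _ => 1) (by fun_prop) (C := 1) fun ξ => by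
      rw [norm_one, one_mul]
      exact one_le_pow₀ (by linarith [norm_nonneg (freq ξ)])
  have hFd : Continuous fun ξ : ℝ => (l + freq ξ : ℂ) ^ (n + 2) := by fun_prop
  have hne : ∀ ξ : ℝ, (l + freq ξ : ℂ) ^ (n + 2) ≠ 0 := fun ξ =>
    pow_ne_zero _ (add_freq_ne_zero hl0 ξ)
  have hexp : ∀ N (ξ : ℝ), ‖Complex.exp (-(h N : ℂ) * Ψ (2 * Real.pi * ξ))‖ ≤ 1 := fun N ξ => by
    rw [Complex.norm_exp, Real.exp_le_one_iff]
    have := mul_nonneg (hpos N).le (hre (2 * Real.pi * ξ))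
    simpa using this
  have hlim : Filter.Tendsto (fun N => ∫ ξ : ℝ,
      (1 - Complex.exp (-(h N : ℂ) * Ψ (2 * Real.pi * ξ))) / h N / (l + freq ξ) ^ (n + 2))
      Filter.atTop (nhds (∫ ξ : ℝ, Ψ (2 * Real.pi * ξ) / (l + freq ξ) ^ (n + 2))) := by
    have hB : Integrable fun ξ : ℝ => ((2 * (1 + C) * (1 + ‖freq ξ‖) ^ n : ℝ) : ℂ)
        / (l + freq ξ) ^ (n + 2) :=
      integrable_div_add_freq hl (Continuous.aestronglyMeasurable (by fun_prop)) (C := 2 * (1 + C))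
        fun ξ => by
          rw [Complex.norm_real, Real.norm_of_nonneg (by positivity)]
    refine tendsto_integral_of_dominated_convergence _ (fun N => ?_) hB.norm (fun N => ?_) ?_
    · exact Continuous.aestronglyMeasurable (by fun_prop (disch := assumption))
    · refine Filter.Eventually.of_forall fun ξ => ?_
      have h1 := norm_one_sub_exp_le (hre (2 * Real.pi * ξ)) (hpos N)
      have h2 : ‖(1 - Complex.exp (-(h N : ℂ) * Ψ (2 * Real.pi * ξ))) / h N‖
          ≤ 2 * (1 + C) * (1 + ‖freq ξ‖) ^ n := by
        rw [norm_div, Complex.norm_real, Real.norm_of_nonneg (hpos N).le, div_le_iff₀ (hpos N)]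
        rw [neg_mul, mul_comm (h N : ℂ), ← neg_mul]
        have h3 : 1 ≤ (1 + ‖freq ξ‖) ^ n := one_le_pow₀ (by linarith [norm_nonneg (freq ξ)])
        calc _ ≤ _ := h1
          _ ≤ 2 * ((1 + ‖freq ξ‖) ^ n + C * (1 + ‖freq ξ‖) ^ n) * h N := by
            gcongr
            · exact (lt_min one_pos (hpos N)).le
            · exact hb ξ
            · exact min_le_right _ _
          _ = _ := by ring
      refine (norm_div _ _).trans_le (le_trans ?_ (norm_div _ _).ge)
      rw [Complex.norm_real, Real.norm_of_nonneg (by positivity)]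
      gcongr
    · exact Filter.Eventually.of_forall fun ξ =>
        (tendsto_one_sub_exp_div hpos hh (Ψ (2 * Real.pi * ξ))).div_const _
  refine le_of_tendsto ((Complex.continuous_re.tendsto _).comp hlim)
    (Filter.Eventually.of_forall fun N => ?_)
  have hE : ∫ ξ : ℝ, Complex.exp (-(h N : ℂ) * Ψ (2 * Real.pi * ξ)) / (l + freq ξ) ^ (n + 2)
      = ((∫ x, gammaKernel l (n + 1) (x - 0) ∂(P.map (X (h N))) : ℝ) : ℂ) := by
    have hprob : IsProbabilityMeasure (P.map (X (h N))) :=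
      Measure.isProbabilityMeasure_map (hX _).aemeasurable
    rw [← integral_transform_div_add_freq hl n.succ_ne_zero]
    congr with ξ
    rw [Complex.ofReal_zero, mul_zero, Complex.exp_zero, one_mul, ← hchar _ _ (hpos N).le,
      integral_map (hX _).aemeasurable (Continuous.aestronglyMeasurable (by fun_prop))]
    congr 2 with ω
    rw [freq]
    push_cast
    ring_nf
  have h0 : ∫ ξ : ℝ, (1 : ℂ) / (l + freq ξ) ^ (n + 2) = 0 := by
    have := integral_exp_div_add_freq hl n.succ_ne_zero 0
    rw [gammaKernel_of_nonpos n.succ_ne_zero le_rfl] at this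
    simpa using this
  have hEi : Integrable fun ξ : ℝ =>
      Complex.exp (-(h N : ℂ) * Ψ (2 * Real.pi * ξ)) / (l + freq ξ) ^ (n + 2) := by
    refine hF.norm.mono' (Continuous.aestronglyMeasurable (by fun_prop (disch := assumption)))
      (Filter.Eventually.of_forall fun ξ => ?_)
    rw [norm_div, norm_div, norm_one]
    gcongr
    exact hexp N ξ
  have hEq : ∫ ξ : ℝ,
      (1 - Complex.exp (-(h N : ℂ) * Ψ (2 * Real.pi * ξ))) / h N / (l + freq ξ) ^ (n + 2)
      = ((-(∫ x, gammaKernel l (n + 1) (x - 0) ∂(P.map (X (h N)))) / h N : ℝ) : ℂ) := by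
    have h1 := integral_sub hF hEi
    rw [h0, hE, zero_sub] at h1
    rw [Complex.ofReal_div, Complex.ofReal_neg, ← h1, ← integral_div]
    congr with ξ
    ring
  simp only [Function.comp]
  rw [hEq, Complex.ofReal_re]
  exact div_nonpos_of_nonpos_of_nonneg
    (neg_nonpos.mpr (integral_nonneg fun x => gammaKernel_nonneg _)) (hpos N).le

end

section
variable {l : ℝ} {n : ℕ}

lemma norm_integral_exp_freq_le (μ : Measure ℝ) [IsFiniteMeasure μ] (ξ : ℝ) :
    ‖∫ x : ℝ, Complex.exp (freq ξ * x) ∂μ‖ ≤ μ.real univ := by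
  refine (norm_integral_le_of_norm_le_const (C := 1)
    (Filter.Eventually.of_forall fun x => ?_)).trans (by simp)
  rw [Complex.norm_exp, Real.exp_le_one_iff]
  simp

lemma stronglyMeasurable_integral_exp_freq (μ : Measure ℝ) [IsFiniteMeasure μ] :
    StronglyMeasurable fun ξ : ℝ => ∫ x : ℝ, Complex.exp (freq ξ * x) ∂μ :=
  StronglyMeasurable.integral_prod_right
    (f := fun (ξ x : ℝ) => Complex.exp (freq ξ * x))
    (Continuous.stronglyMeasurable (by unfold Function.uncurry; fun_prop))

lemma integrable_mul_transform (hl : 1 ≤ l) (μ : Measure ℝ) [IsFiniteMeasure μ] {f : ℝ → ℂ}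
    (hf : AEStronglyMeasurable f) {C : ℝ} (hb : ∀ ξ, ‖f ξ‖ ≤ C * (1 + ‖freq ξ‖) ^ n) :
    Integrable fun ξ => f ξ * (∫ x : ℝ, Complex.exp (freq ξ * x) ∂μ) / (l + freq ξ) ^ (n + 2) :=
  integrable_div_add_freq hl (hf.mul (stronglyMeasurable_integral_exp_freq μ).aestronglyMeasurable)
    (C := C * μ.real univ) fun ξ => by
      rw [norm_mul, mul_right_comm]
      exact mul_le_mul (hb ξ) (norm_integral_exp_freq_le μ ξ) (norm_nonneg _)
        ((norm_nonneg _).trans (hb ξ))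

namespace BernsteinRep
variable {k δ : ℝ} {ν : Measure ℝ} {Φ : ℂ → ℂ}

/-- The action of a Bernstein function of the derivative on the convolution of a finite measure
with the Gamma kernel. -/
lemma integral_mul_transform (h : BernsteinRep k δ ν Φ) (hl : 1 ≤ l) (μ : Measure ℝ)
    [IsFiniteMeasure μ] :
    Integrable (fun y => ∫ x, gammaKernel l (n + 2) (x - 0) ∂μ
      - ∫ x, gammaKernel l (n + 2) (x - y) ∂μ) ν ∧
    ∫ ξ : ℝ, Φ (freq ξ) * (∫ x : ℝ, Complex.exp (freq ξ * x) ∂μ) / (l + freq ξ) ^ (n + 3)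
      = ((k * ∫ x, gammaKernel l (n + 2) (x - 0) ∂μ
        + δ * (∫ x, gammaKernel l (n + 1) (x - 0) ∂μ - l * ∫ x, gammaKernel l (n + 2) (x - 0) ∂μ)
        + ∫ y, (∫ x, gammaKernel l (n + 2) (x - 0) ∂μ
          - ∫ x, gammaKernel l (n + 2) (x - y) ∂μ) ∂ν : ℝ) : ℂ) := by
  have := h.sfinite
  have hl0 : 0 < l := by linarith
  set M : ℝ → ℂ := fun ξ => ∫ x : ℝ, Complex.exp (freq ξ * x) ∂μ
  have hone : ∀ ξ (m : ℕ), 1 ≤ (1 + ‖freq ξ‖) ^ m := fun ξ m =>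
    one_le_pow₀ (by linarith [norm_nonneg (freq ξ)])
  have hpow : ∀ ξ, 1 + ‖freq ξ‖ ≤ (1 + ‖freq ξ‖) ^ (n + 1) := fun ξ =>
    le_self_pow₀ (by linarith [norm_nonneg (freq ξ)]) n.succ_ne_zero
  have hi0 : ∀ m, Integrable fun ξ => M ξ / (l + freq ξ) ^ (m + 2) := fun m => by
    have := integrable_mul_transform (n := m) hl μ (f := fun _ => 1) (by fun_prop) (C := 1)
      fun ξ => by rw [norm_one, one_mul]; exact hone ξ m
    simpa only [one_mul] using this
  have hexp : ∀ (y : ℝ), Integrable fun ξ =>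
      Complex.exp (-freq ξ * y) * M ξ / (l + freq ξ) ^ (n + 3) := fun y =>
    integrable_mul_transform (n := n + 1) hl μ (C := 1)
      (Continuous.aestronglyMeasurable (by fun_prop)) fun ξ => by
        rw [Complex.norm_exp, one_mul]
        refine le_trans ?_ (hone ξ (n + 1))
        rw [Real.exp_le_one_iff]
        simp
  have hJ : ∀ y : ℝ, ∫ ξ : ℝ, (1 - Complex.exp (-freq ξ * y)) * M ξ / (l + freq ξ) ^ (n + 3)
      = ((∫ x, gammaKernel l (n + 2) (x - 0) ∂μ - ∫ x, gammaKernel l (n + 2) (x - y) ∂μ : ℝ) : ℂ) :=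
    fun y => by
      rw [Complex.ofReal_sub, ← integral_transform_div_add_freq hl (Nat.succ_ne_zero _) μ 0,
        ← integral_transform_div_add_freq hl (Nat.succ_ne_zero _) μ y,
        ← integral_sub (hexp 0) (hexp y)]
      congr with ξ
      simp only [Complex.ofReal_zero, mul_zero, Complex.exp_zero, M]
      ring
  have hprod : Integrable (fun p : ℝ × ℝ =>
      (1 - Complex.exp (-freq p.1 * p.2)) * M p.1 / (l + freq p.1) ^ (n + 3)) (volume.prod ν) := by
    have h1 := integrable_mul_transform (n := n + 1) hl μ (C := 1)
      (f := fun ξ => ((1 + ‖freq ξ‖ : ℝ) : ℂ)) (Continuous.aestronglyMeasurable (by fun_prop))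
      fun ξ => by
        rw [one_mul, Complex.norm_real, Real.norm_of_nonneg (by positivity)]
        exact hpow ξ
    refine ((h1.norm.mul_prod h.integrable).const_mul 2).mono' ?_ ?_
    · refine Measurable.aestronglyMeasurable ?_
      have hm : Measurable M := (stronglyMeasurable_integral_exp_freq μ).measurable
      have hf : Measurable freq := continuous_freq.measurable
      fun_prop
    · have hpos : ∀ᵐ p ∂(volume.prod ν : Measure (ℝ × ℝ)), 0 < p.2 :=
        Measure.quasiMeasurePreserving_snd.ae h.ae_pos
      filter_upwards [hpos] with p hp
      have h2 := norm_one_sub_exp_le (z := freq p.1) (by simp) hp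
      simp only [norm_div, norm_mul, Complex.norm_real, Real.norm_eq_abs]
      rw [abs_of_nonneg (by positivity : 0 ≤ 1 + ‖freq p.1‖)]
      calc _ ≤ 2 * (1 + ‖freq p.1‖) * min 1 p.2 * ‖M p.1‖ / ‖((l + freq p.1) ^ (n + 3) : ℂ)‖ := by
            gcongr
        _ = _ := by ring
  have hswap := integral_integral_swap (μ := volume) (ν := ν)
    (f := fun ξ y : ℝ => (1 - Complex.exp (-freq ξ * y)) * M ξ / (l + freq ξ) ^ (n + 3)) hprod
  have hInt := hprod.integral_prod_right
  simp only [hJ] at hInt hswap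
  refine ⟨by simpa using hInt.re, ?_⟩
  have hν : Integrable fun ξ => ∫ y, (1 - Complex.exp (-freq ξ * y)) * M ξ
      / (l + freq ξ) ^ (n + 3) ∂ν := hprod.integral_prod_left
  have hi1 : Integrable fun ξ => k * (M ξ / (l + freq ξ) ^ (n + 3)) :=
    (hi0 (n + 1)).const_mul _
  have hi2 : Integrable fun ξ => δ * (M ξ / (l + freq ξ) ^ (n + 2)
      - l * (M ξ / (l + freq ξ) ^ (n + 3))) :=
    ((hi0 n).sub ((hi0 (n + 1)).const_mul _)).const_mul _
  have hval : ∀ m, ∫ ξ, M ξ / (l + freq ξ) ^ (m + 2)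
      = ((∫ x, gammaKernel l (m + 1) (x - 0) ∂μ : ℝ) : ℂ) := fun m => by
    rw [← integral_transform_div_add_freq hl (Nat.succ_ne_zero _) μ 0]
    simp [M]
  have hdec : ∀ ξ, Φ (freq ξ) * M ξ / (l + freq ξ) ^ (n + 3)
      = k * (M ξ / (l + freq ξ) ^ (n + 3)) + δ * (M ξ / (l + freq ξ) ^ (n + 2)
        - l * (M ξ / (l + freq ξ) ^ (n + 3)))
        + ∫ y, (1 - Complex.exp (-freq ξ * y)) * M ξ / (l + freq ξ) ^ (n + 3) ∂ν := fun ξ => by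
    have hne := add_freq_ne_zero hl0 ξ
    rw [integral_div, integral_mul_const, h.eq _ (by simp), pow_succ _ (n + 2)]
    field_simp
    ring
  have h12 : Integrable fun ξ => k * (M ξ / (l + freq ξ) ^ (n + 3))
      + δ * (M ξ / (l + freq ξ) ^ (n + 2) - l * (M ξ / (l + freq ξ) ^ (n + 3))) := hi1.add hi2
  have hl1 : Integrable fun ξ => l * (M ξ / (l + freq ξ) ^ (n + 3)) := (hi0 (n + 1)).const_mul _
  calc ∫ ξ : ℝ, Φ (freq ξ) * M ξ / (l + freq ξ) ^ (n + 3)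
      = ∫ ξ : ℝ, (k * (M ξ / (l + freq ξ) ^ (n + 3)) + δ * (M ξ / (l + freq ξ) ^ (n + 2)
        - l * (M ξ / (l + freq ξ) ^ (n + 3)))
        + ∫ y, (1 - Complex.exp (-freq ξ * y)) * M ξ / (l + freq ξ) ^ (n + 3) ∂ν) := by
        simp_rw [hdec]
    _ = _ := by
        rw [integral_add h12 hν, integral_add hi1 hi2, integral_const_mul, integral_const_mul,
          integral_sub (hi0 n) hl1, integral_const_mul, hswap, hval (n + 1), hval n,
          integral_complex_ofReal]
        push_cast
        rfl

end BernsteinRep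
end

section
variable {l : ℝ}

lemma integral_one_div_add_freq (hl : 1 ≤ l) (n : ℕ) :
    ∫ ξ : ℝ, (1 : ℂ) / (l + freq ξ) ^ (n + 2) = 0 := by
  have := integral_exp_div_add_freq hl n.succ_ne_zero 0
  rw [gammaKernel_of_nonpos n.succ_ne_zero le_rfl] at this
  simpa using this

lemma integrable_one_div_add_freq (hl : 1 ≤ l) (n : ℕ) :
    Integrable fun ξ : ℝ => (1 : ℂ) / (l + freq ξ) ^ (n + 2) :=
  integrable_div_add_freq hl (f := fun _ => 1) (by fun_prop) (C := 1) fun ξ => by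
    rw [norm_one, one_mul]
    exact one_le_pow₀ (by linarith [norm_nonneg (freq ξ)])

namespace BernsteinRep
variable {k δ : ℝ} {ν : Measure ℝ} {Φ : ℂ → ℂ}

lemma integrable_div_add_freq (h : BernsteinRep k δ ν Φ) (hl : 1 ≤ l)
    (hc : Continuous fun ξ => Φ (freq ξ)) (n : ℕ) :
    Integrable fun ξ : ℝ => Φ (freq ξ) / (l + freq ξ) ^ (n + 3) := by
  have hC : 0 ≤ k + δ + 2 * ∫ y, min 1 y ∂ν := by
    have := (norm_nonneg _).trans (h.norm_le (z := 0) le_rfl)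
    simpa using this
  refine _root_.integrable_div_add_freq (n := n + 1) hl hc.aestronglyMeasurable fun ξ =>
    (h.norm_le (by simp)).trans (mul_le_mul_of_nonneg_left
      (le_self_pow₀ (by linarith [norm_nonneg (freq ξ)]) n.succ_ne_zero) hC)

lemma integral_div_add_freq (h : BernsteinRep k δ ν Φ) (hl : 1 ≤ l) (n : ℕ) :
    ∫ ξ : ℝ, Φ (freq ξ) / (l + freq ξ) ^ (n + 3) = 0 := by
  have h1 := (h.integral_mul_transform (n := n) hl (Measure.dirac 0)).2
  have h2 : ∫ y, (∫ x, gammaKernel l (n + 2) (x - 0) ∂(Measure.dirac 0)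
      - ∫ x, gammaKernel l (n + 2) (x - y) ∂(Measure.dirac 0)) ∂ν = 0 := by
    refine integral_eq_zero_of_ae ?_
    filter_upwards [h.ae_pos] with y hy
    simp only [integral_dirac]
    rw [gammaKernel_of_nonpos (by simp) (by linarith), gammaKernel_of_nonpos (by simp) (by linarith)]
    simp
  rw [h2] at h1
  simp only [integral_dirac] at h1
  rw [gammaKernel_of_nonpos (by simp) (by simp), gammaKernel_of_nonpos (by simp) (by simp)] at h1
  simpa using h1

/-- Positivity of the jump part of a Lévy exponent of the form
`d iθ + σ²θ²/2 + Φ₁(-iθ) Φ₂(iθ)` when the jump measure of `Φ₁` is finite. -/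
lemma jump_nonneg {k₁ δ₁ d σ : ℝ} {μ : Measure ℝ} [IsFiniteMeasure μ] {Φ₁ : ℂ → ℂ}
    (h₁ : BernsteinRep k₁ δ₁ μ Φ₁) (h : BernsteinRep k δ ν Φ)
    (hc₁ : Continuous fun θ : ℝ => Φ₁ (-Complex.I * θ))
    (hc : Continuous fun θ : ℝ => Φ (Complex.I * θ))
    {Ω : Type*} [MeasurableSpace Ω] {P : Measure Ω} [IsProbabilityMeasure P] {X : ℝ → Ω → ℝ}
    (hX : ∀ t, Measurable (X t))
    (hchar : ∀ θ t : ℝ, 0 ≤ t → ∫ ω, Complex.exp (Complex.I * θ * X t ω) ∂P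
      = Complex.exp (-(t : ℂ) * (d * Complex.I * θ + (σ : ℂ) ^ 2 * (θ : ℂ) ^ 2 / 2
        + Φ₁ (-Complex.I * θ) * Φ (Complex.I * θ)))) (hl : 1 ≤ l) :
    0 ≤ k * ∫ x, gammaKernel l 4 (x - 0) ∂μ
        + δ * (∫ x, gammaKernel l 3 (x - 0) ∂μ - l * ∫ x, gammaKernel l 4 (x - 0) ∂μ)
        + ∫ y, (∫ x, gammaKernel l 4 (x - 0) ∂μ - ∫ x, gammaKernel l 4 (x - y) ∂μ) ∂ν := by
  have hl0 : 0 < l := by linarith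
  set Ψ : ℝ → ℂ := fun θ => d * Complex.I * θ + (σ : ℂ) ^ 2 * (θ : ℂ) ^ 2 / 2
        + Φ₁ (-Complex.I * θ) * Φ (Complex.I * θ)
  set M : ℝ → ℂ := fun ξ => ∫ x : ℝ, Complex.exp (freq ξ * x) ∂μ
  have hΨc : Continuous Ψ := (by fun_prop : Continuous fun θ : ℝ =>
    (d * Complex.I * θ + (σ : ℂ) ^ 2 * (θ : ℂ) ^ 2 / 2 : ℂ)).add (hc₁.mul hc)
  have hfreq : ∀ ξ : ℝ, freq ξ = Complex.I * ((2 * Real.pi * ξ : ℝ) : ℂ) := fun ξ => by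
    rw [freq, mul_comm]
  have hΨ : ∀ ξ : ℝ, Ψ (2 * Real.pi * ξ) = d * freq ξ - (σ : ℂ) ^ 2 * freq ξ ^ 2 / 2
      + Φ₁ (-freq ξ) * Φ (freq ξ) := fun ξ => by
    simp only [Ψ]
    rw [neg_mul, ← hfreq, freq, mul_pow, Complex.I_sq]
    ring
  have hcΦ : Continuous fun ξ => Φ (freq ξ) := by
    simp_rw [hfreq]
    exact hc.comp (by fun_prop : Continuous fun ξ : ℝ => 2 * Real.pi * ξ)
  have hb : ∃ C : ℝ, ∀ ξ : ℝ, ‖Ψ (2 * Real.pi * ξ)‖ ≤ C * (1 + ‖freq ξ‖) ^ 3 := by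
    refine ⟨|d| + σ ^ 2 + (k₁ + δ₁ + 2 * ∫ y, min 1 y ∂μ) * (k + δ + 2 * ∫ y, min 1 y ∂ν),
      fun ξ => ?_⟩
    have e1 := h₁.norm_le (z := -freq ξ) (by simp)
    have e2 := h.norm_le (z := freq ξ) (by simp)
    rw [norm_neg] at e1
    set u := ‖freq ξ‖
    have hu : 0 ≤ u := norm_nonneg _
    have hp := mul_le_mul e1 e2 (norm_nonneg _) ((norm_nonneg _).trans e1)
    set a := k₁ + δ₁ + 2 * ∫ y, min 1 y ∂μ
    set b := k + δ + 2 * ∫ y, min 1 y ∂ν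
    have hab : 0 ≤ a * b := by
      have : 0 ≤ a * (1 + u) := (norm_nonneg _).trans e1
      have ha : 0 ≤ a := nonneg_of_mul_nonneg_left this (by positivity)
      have : 0 ≤ b * (1 + u) := (norm_nonneg _).trans e2
      exact mul_nonneg ha (nonneg_of_mul_nonneg_left this (by positivity))
    rw [hΨ]
    have e3 : ‖(d : ℂ) * freq ξ - (σ : ℂ) ^ 2 * freq ξ ^ 2 / 2‖ ≤ |d| * u + σ ^ 2 * u ^ 2 / 2 := by
      refine (norm_sub_le _ _).trans ?_
      simp [u]
    refine (norm_add_le _ _).trans ?_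
    rw [norm_mul]
    have c1 : u ≤ (1 + u) ^ 3 := by nlinarith [pow_nonneg hu 2, pow_nonneg hu 3]
    have c2 : u ^ 2 / 2 ≤ (1 + u) ^ 3 := by nlinarith [pow_nonneg hu 2, pow_nonneg hu 3]
    have c3 : (1 + u) ^ 2 ≤ (1 + u) ^ 3 := pow_le_pow_right₀ (by linarith) (by norm_num)
    have d1 := mul_le_mul_of_nonneg_left c1 (abs_nonneg d)
    have d2 := mul_le_mul_of_nonneg_left c2 (sq_nonneg σ)
    have d3 := mul_le_mul_of_nonneg_left c3 hab
    nlinarith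
  obtain ⟨C, hb⟩ := hb
  have hneg : (∫ ξ : ℝ, Ψ (2 * Real.pi * ξ) / (l + freq ξ) ^ 5).re ≤ 0 :=
    integral_exponent_div_add_freq_re_nonpos hX hchar hΨc hb hl
  have hM := (h.integral_mul_transform (n := 2) hl μ).2
  have hMi : Integrable fun ξ => Φ (freq ξ) * M ξ / (l + freq ξ) ^ 5 :=
    integrable_mul_transform (n := 3) hl μ hcΦ.aestronglyMeasurable
      (C := k + δ + 2 * ∫ y, min 1 y ∂ν) fun ξ => by
        refine (h.norm_le (by simp)).trans (mul_le_mul_of_nonneg_left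
          (le_self_pow₀ (by linarith [norm_nonneg (freq ξ)]) (by norm_num)) ?_)
        have := (norm_nonneg _).trans (h.norm_le (z := 0) le_rfl)
        simpa using this
  set K : ℂ := k₁ + μ.real univ
  have hΦ₁ : ∀ ξ, Φ₁ (-freq ξ) = K - δ₁ * freq ξ - M ξ := fun ξ => by
    have hi : Integrable (fun x : ℝ => Complex.exp (freq ξ * x)) μ := by
      refine (integrable_const (1 : ℝ)).mono' (Continuous.aestronglyMeasurable (by fun_prop))
        (Filter.Eventually.of_forall fun x => ?_)
      rw [Complex.norm_exp, Real.exp_le_one_iff]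
      simp
    rw [h₁.eq _ (by simp)]
    simp only [neg_neg]
    rw [integral_sub (integrable_const _) hi, integral_const]
    simp only [K, M, Complex.real_smul, mul_one]
    ring
  have hdec : ∀ ξ, Ψ (2 * Real.pi * ξ) / (l + freq ξ) ^ 5
      = (d * (1 / (l + freq ξ) ^ 4 - l * (1 / (l + freq ξ) ^ 5))
        - σ ^ 2 / 2 * (1 / (l + freq ξ) ^ 3 - 2 * l * (1 / (l + freq ξ) ^ 4)
          + l ^ 2 * (1 / (l + freq ξ) ^ 5))
        + K * (Φ (freq ξ) / (l + freq ξ) ^ 5)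
        - δ₁ * (Φ (freq ξ) / (l + freq ξ) ^ 4 - l * (Φ (freq ξ) / (l + freq ξ) ^ 5)))
        - Φ (freq ξ) * M ξ / (l + freq ξ) ^ 5 := fun ξ => by
    have hne := add_freq_ne_zero hl0 ξ
    rw [hΨ, hΦ₁]
    field_simp
    ring
  have i3 := integrable_one_div_add_freq hl 1
  have i4 := integrable_one_div_add_freq hl 2
  have i5 := integrable_one_div_add_freq hl 3
  have j4 := h.integrable_div_add_freq hl hcΦ 1
  have j5 := h.integrable_div_add_freq hl hcΦ 2
  have z3 := integral_one_div_add_freq hl 1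
  have z4 := integral_one_div_add_freq hl 2
  have z5 := integral_one_div_add_freq hl 3
  have y4 := h.integral_div_add_freq hl 1
  have y5 := h.integral_div_add_freq hl 2
  norm_num only [] at i3 i4 i5 j4 j5 z3 z4 z5 y4 y5 hM
  have t1i : Integrable fun ξ => (1 / (l + freq ξ) ^ 4 - l * (1 / (l + freq ξ) ^ 5) : ℂ) :=
    i4.sub (i5.const_mul _)
  have t1 : ∫ ξ, (1 / (l + freq ξ) ^ 4 - l * (1 / (l + freq ξ) ^ 5) : ℂ) = 0 := by
    rw [integral_sub i4 (i5.const_mul _), integral_const_mul, z4, z5, mul_zero, sub_zero]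
  have t2i' : Integrable fun ξ => (1 / (l + freq ξ) ^ 3 - 2 * l * (1 / (l + freq ξ) ^ 4) : ℂ) :=
    i3.sub (i4.const_mul _)
  have t2i : Integrable fun ξ => (1 / (l + freq ξ) ^ 3 - 2 * l * (1 / (l + freq ξ) ^ 4)
      + l ^ 2 * (1 / (l + freq ξ) ^ 5) : ℂ) := t2i'.add (i5.const_mul _)
  have t2 : ∫ ξ, (1 / (l + freq ξ) ^ 3 - 2 * l * (1 / (l + freq ξ) ^ 4)
      + l ^ 2 * (1 / (l + freq ξ) ^ 5) : ℂ) = 0 := by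
    rw [integral_add t2i' (i5.const_mul _), integral_sub i3 (i4.const_mul _), integral_const_mul,
      integral_const_mul, z3, z4, z5]
    ring
  have t3i : Integrable fun ξ => Φ (freq ξ) / (l + freq ξ) ^ 4
      - l * (Φ (freq ξ) / (l + freq ξ) ^ 5) := j4.sub (j5.const_mul _)
  have t3 : ∫ ξ, (Φ (freq ξ) / (l + freq ξ) ^ 4 - l * (Φ (freq ξ) / (l + freq ξ) ^ 5)) = 0 := by
    rw [integral_sub j4 (j5.const_mul _), integral_const_mul, y4, y5, mul_zero, sub_zero]
  have s1i : Integrable fun ξ => (d * (1 / (l + freq ξ) ^ 4 - l * (1 / (l + freq ξ) ^ 5))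
      - σ ^ 2 / 2 * (1 / (l + freq ξ) ^ 3 - 2 * l * (1 / (l + freq ξ) ^ 4)
        + l ^ 2 * (1 / (l + freq ξ) ^ 5)) : ℂ) := (t1i.const_mul _).sub (t2i.const_mul _)
  have s2i : Integrable fun ξ => d * (1 / (l + freq ξ) ^ 4 - l * (1 / (l + freq ξ) ^ 5))
      - σ ^ 2 / 2 * (1 / (l + freq ξ) ^ 3 - 2 * l * (1 / (l + freq ξ) ^ 4)
        + l ^ 2 * (1 / (l + freq ξ) ^ 5))
      + K * (Φ (freq ξ) / (l + freq ξ) ^ 5) := s1i.add (j5.const_mul _)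
  have s3i : Integrable fun ξ => d * (1 / (l + freq ξ) ^ 4 - l * (1 / (l + freq ξ) ^ 5))
      - σ ^ 2 / 2 * (1 / (l + freq ξ) ^ 3 - 2 * l * (1 / (l + freq ξ) ^ 4)
        + l ^ 2 * (1 / (l + freq ξ) ^ 5))
      + K * (Φ (freq ξ) / (l + freq ξ) ^ 5)
      - δ₁ * (Φ (freq ξ) / (l + freq ξ) ^ 4 - l * (Φ (freq ξ) / (l + freq ξ) ^ 5)) :=
    s2i.sub (t3i.const_mul _)
  simp_rw [hdec] at hneg
  rw [integral_sub s3i hMi, integral_sub s2i (t3i.const_mul _), integral_add s1i (j5.const_mul _),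
    integral_sub (t1i.const_mul _) (t2i.const_mul _), integral_const_mul, integral_const_mul,
    integral_const_mul, integral_const_mul, t1, t2, t3, y5, hM] at hneg
  rw [← neg_nonpos, ← Complex.ofReal_re (-_), Complex.ofReal_neg]
  simpa only [mul_zero, add_zero, sub_zero, zero_sub] using hneg

end BernsteinRep
end

section
variable {l : ℝ} {n : ℕ}

lemma exp_mul_gammaKernel (r : ℝ) (x : ℝ) :
    Real.exp (-r * x) * gammaKernel l n x = gammaKernel (l + r) n x := by
  unfold gammaKernel
  rw [show -(l + r) * x = -r * x + -l * x by ring, Real.exp_add]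
  ring

lemma integral_gammaKernel (hl : 0 < l) (hn : n ≠ 0) :
    ∫ x, gammaKernel l n x = 1 / l ^ (n + 1) := by
  have := integral_gammaKernel_mul_exp (l := l) hn (w := 0) (by simpa using hl)
  simp only [neg_zero, zero_mul, Complex.exp_zero, one_mul, add_zero] at this
  rw [integral_complex_ofReal] at this
  exact_mod_cast this

lemma mul_gammaKernel (x : ℝ) :
    max x 0 * gammaKernel l n x = (n + 1) * gammaKernel l (n + 1) x := by
  unfold gammaKernel
  rw [Nat.factorial_succ]
  push_cast
  have : ((n : ℝ) + 1) ≠ 0 := by positivity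
  field_simp
  ring

variable {u : ℝ → ℝ}

lemma integrable_mul_gammaKernel (hl : 0 < l) (hn : n ≠ 0) (hu : Continuous u) (h0 : ∀ x, 0 ≤ u x)
    (h1 : ∀ x, u x ≤ 1) : Integrable fun x => u x * gammaKernel l n x :=
  (gammaKernel_integrable hl hn).bdd_mul (c := 1) hu.aestronglyMeasurable
    (Filter.Eventually.of_forall fun x => by rw [Real.norm_of_nonneg (h0 x)]; exact h1 x)

lemma integral_mul_gammaKernel_le (hl : 0 < l) (hn : n ≠ 0) (hu : Continuous u) (h0 : ∀ x, 0 ≤ u x)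
    (h1 : ∀ x, u x ≤ 1) (hm : Monotone u) :
    ∫ x, u x * gammaKernel l n x ≤ l * ∫ x, u x * gammaKernel l (n + 1) x := by
  have hi := integrable_mul_gammaKernel hl hn hu h0 h1
  have hi' := integrable_mul_gammaKernel hl n.succ_ne_zero hu h0 h1
  have hg := gammaKernel_integrable hl hn
  have hg' := gammaKernel_integrable hl n.succ_ne_zero
  set x₀ : ℝ := (n + 1) / l
  have hpt : ∀ x, (u x - u x₀) * (gammaKernel l n x - l * gammaKernel l (n + 1) x) ≤ 0 := by
    intro x
    rcases le_or_gt x 0 with hx | hx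
    · rw [gammaKernel_of_nonpos hn hx, gammaKernel_of_nonpos n.succ_ne_zero hx]
      simp
    have h2 : gammaKernel l n x - l * gammaKernel l (n + 1) x
        = gammaKernel l n x * (l / (n + 1) * (x₀ - x)) := by
      have := mul_gammaKernel (l := l) (n := n) x
      rw [max_eq_left hx.le] at this
      have hn1 : ((n : ℝ) + 1) ≠ 0 := by positivity
      have h3 : gammaKernel l (n + 1) x = x * gammaKernel l n x / (n + 1) := by
        rw [this]; field_simp
      rw [h3]
      simp only [x₀]
      field_simp
    rw [h2]
    have hk := gammaKernel_nonneg (l := l) (n := n) x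
    have hk' : 0 ≤ gammaKernel l n x * (l / (n + 1)) := by positivity
    rcases le_total x x₀ with hxx | hxx
    · nlinarith [mul_nonneg hk' (mul_nonneg (sub_nonneg.mpr (hm hxx)) (sub_nonneg.mpr hxx))]
    · nlinarith [mul_nonneg hk' (mul_nonneg (sub_nonneg.mpr (hm hxx)) (sub_nonneg.mpr hxx))]
  have hInt : ∫ x, (u x - u x₀) * (gammaKernel l n x - l * gammaKernel l (n + 1) x) ≤ 0 :=
    integral_nonpos hpt
  have heq : ∫ x, (u x - u x₀) * (gammaKernel l n x - l * gammaKernel l (n + 1) x)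
      = ((∫ x, u x * gammaKernel l n x) - l * ∫ x, u x * gammaKernel l (n + 1) x)
        - u x₀ * ((∫ x, gammaKernel l n x) - l * ∫ x, gammaKernel l (n + 1) x) := by
    have i1 : Integrable fun x => u x * gammaKernel l n x - l * (u x * gammaKernel l (n + 1) x) :=
      hi.sub (hi'.const_mul l)
    have i2 : Integrable fun x => u x₀ * (gammaKernel l n x - l * gammaKernel l (n + 1) x) :=
      (hg.sub (hg'.const_mul l)).const_mul _
    rw [← integral_const_mul l, ← integral_const_mul l, ← integral_sub hi (hi'.const_mul l),
      ← integral_sub hg (hg'.const_mul l), ← integral_const_mul, ← integral_sub i1 i2]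
    congr with x
    ring
  have hz : (∫ x, gammaKernel l n x) - l * ∫ x, gammaKernel l (n + 1) x = 0 := by
    rw [integral_gammaKernel hl hn, integral_gammaKernel hl n.succ_ne_zero, pow_succ _ (n + 1)]
    field_simp
    ring
  rw [heq, hz] at hInt
  linarith

lemma integral_mul_gammaKernel_le_of_pos (hl : 0 < l) (hn : n ≠ 0) (hu : Continuous u)
    (h0 : ∀ x, 0 ≤ u x) (h1 : ∀ x, u x ≤ 1) (hm : Monotone u) {η : ℝ} (hη : 0 < η) :
    ∫ x, u x * gammaKernel l n x ≤ (u η + (n + 1) / (η * l)) * (1 / l ^ (n + 1)) := by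
  have hi := integrable_mul_gammaKernel hl hn hu h0 h1
  have hg := gammaKernel_integrable hl hn
  have hg' := gammaKernel_integrable hl n.succ_ne_zero
  calc ∫ x, u x * gammaKernel l n x
      ≤ ∫ x, (u η * gammaKernel l n x + (n + 1) / η * gammaKernel l (n + 1) x) := by
        refine integral_mono hi ((hg.const_mul _).add (hg'.const_mul _)) fun x => ?_
        have h2 : (n + 1) / η * gammaKernel l (n + 1) x = max x 0 / η * gammaKernel l n x := by
          rw [div_mul_eq_mul_div, ← mul_gammaKernel]; ring
        simp only [h2]
        rw [← add_mul]
        refine mul_le_mul_of_nonneg_right ?_ (gammaKernel_nonneg x)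
        have h3 : 0 ≤ max x 0 / η := by positivity
        rcases le_total x η with h | h
        · linarith [hm h]
        · have : 1 ≤ max x 0 / η := by
            rw [le_div_iff₀ hη, one_mul]; exact h.trans (le_max_left _ _)
          linarith [h1 x, h0 η]
    _ = _ := by
        rw [integral_add (hg.const_mul _) (hg'.const_mul _), integral_const_mul, integral_const_mul,
          integral_gammaKernel hl hn, integral_gammaKernel hl n.succ_ne_zero, Nat.succ_eq_add_one,
          pow_succ _ (n + 1)]
        field_simp

lemma le_integral_shift (r : ℝ) (hl : 0 < l + r) (hn : n ≠ 0) (hu : Continuous u)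
    (h0 : ∀ x, 0 ≤ u x) (h1 : ∀ x, u x ≤ 1) {y : ℝ} {v : ℝ → ℝ} (hv : Continuous v)
    (hv0 : ∀ x, 0 ≤ v x) (hv1 : ∀ x, v x ≤ 1) (hvu : ∀ x, 0 ≤ x → v x ≤ u (x + y)) :
    Real.exp (-r * y) * ∫ x, v x * gammaKernel (l + r) n x
      ≤ ∫ x, Real.exp (-r * x) * u x * gammaKernel l n (x - y) := by
  rw [← integral_add_right_eq_self (fun x => Real.exp (-r * x) * u x * gammaKernel l n (x - y)) y,
    ← integral_const_mul]
  have hc : Continuous fun x => u (x + y) := by fun_prop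
  have hi := (integrable_mul_gammaKernel hl hn hc (fun _ => h0 _) fun _ => h1 _).const_mul
    (Real.exp (-r * y))
  have e : ∀ x, Real.exp (-r * (x + y)) * u (x + y) * gammaKernel l n (x + y - y)
      = Real.exp (-r * y) * (u (x + y) * gammaKernel (l + r) n x) := fun x => by
    rw [add_sub_cancel_right, mul_add, Real.exp_add, ← exp_mul_gammaKernel r]
    ring
  simp_rw [e]
  refine integral_mono ((integrable_mul_gammaKernel hl hn hv hv0 hv1).const_mul _) hi fun x => ?_
  refine mul_le_mul_of_nonneg_left ?_ (Real.exp_pos _).le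
  rcases le_or_gt x 0 with h | h
  · rw [gammaKernel_of_nonpos hn h]; simp
  · exact mul_le_mul_of_nonneg_right (hvu x h.le) (gammaKernel_nonneg x)

lemma BernsteinRep.exists_pos_Ici {k δ : ℝ} {ν : Measure ℝ} {Φ : ℂ → ℂ}
    (h : BernsteinRep k δ ν Φ) : ∃ ε : ℝ, 0 < ε ∧ ν (Ici ε) ≠ 0 := by
  by_contra! hcon
  have h1 : ν (⋃ m : ℕ, Ici (1 / ((m : ℝ) + 1))) = 0 :=
    measure_iUnion_null fun m => hcon _ (by positivity)
  have h2 : (Ioi (0 : ℝ)) ⊆ ⋃ m : ℕ, Ici (1 / ((m : ℝ) + 1)) := fun x hx => by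
    obtain ⟨m, hm⟩ := exists_nat_one_div_lt (mem_Ioi.mp hx)
    exact mem_iUnion.mpr ⟨m, hm.le⟩
  have h3 : ν (Ioi 0) = 0 := measure_mono_null h2 h1
  have h4 : ν (Ioi 0)ᶜ = 0 := h.ae_pos
  refine h.ne_zero (Measure.measure_univ_eq_zero.mp ?_)
  rw [← union_compl_self (Ioi (0 : ℝ))]
  exact measure_union_null h3 h4

/-- A density `c e^{-r x} u(x)` with `u` nondecreasing and vanishing at the origin cannot have a
nonnegative image under a Bernstein function of the derivative. -/
lemma BernsteinRep.not_jump_nonneg {k δ : ℝ} {ν : Measure ℝ} {Φ : ℂ → ℂ}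
    (h : BernsteinRep k δ ν Φ) {μ : Measure ℝ} {c r : ℝ} (hc : 0 < c) (hr : 0 < r)
    (hu : Continuous u) (h0 : ∀ x, 0 ≤ u x) (h1 : ∀ x, u x ≤ 1) (hm : Monotone u) (hu0 : u 0 = 0)
    (hpos : ∀ x, 0 < x → 0 < u x)
    (hμ : ∀ g : ℝ → ℝ, Continuous g → ∫ x, g x ∂μ = c * ∫ x, Real.exp (-r * x) * u x * g x)
    (hjump : ∀ l : ℝ, 1 ≤ l → Integrable (fun y => ∫ x, gammaKernel l 4 (x - 0) ∂μ
        - ∫ x, gammaKernel l 4 (x - y) ∂μ) ν ∧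
      0 ≤ k * ∫ x, gammaKernel l 4 (x - 0) ∂μ
        + δ * (∫ x, gammaKernel l 3 (x - 0) ∂μ - l * ∫ x, gammaKernel l 4 (x - 0) ∂μ)
        + ∫ y, (∫ x, gammaKernel l 4 (x - 0) ∂μ - ∫ x, gammaKernel l 4 (x - y) ∂μ) ∂ν) :
    False := by
  obtain ⟨ε, hε, hνε⟩ := h.exists_pos_Ici
  have hki : Integrable ((Ici ε).indicator fun y => Real.exp (-r * y)) ν := by
    refine (h.integrable.div_const (min 1 ε)).mono'
      (Measurable.aestronglyMeasurable (Measurable.indicator (by fun_prop) measurableSet_Ici)) ?_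
    filter_upwards [h.ae_pos] with y hy
    have hme : 0 < min 1 ε := lt_min one_pos hε
    have hmy : 0 < min 1 y := lt_min one_pos hy
    by_cases hyε : y ∈ Ici ε
    · rw [indicator_of_mem hyε, Real.norm_of_nonneg (Real.exp_pos _).le, le_div_iff₀ hme]
      have e1 : Real.exp (-r * y) ≤ 1 := by rw [Real.exp_le_one_iff]; nlinarith
      have e2 : min 1 ε ≤ min 1 y := min_le_min_left _ hyε
      nlinarith
    · rw [indicator_of_notMem hyε, norm_zero]
      positivity
  set κ : ℝ := ∫ y, (Ici ε).indicator (fun y => Real.exp (-r * y)) y ∂ν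
  have hκ : 0 < κ := by
    refine (integral_pos_iff_support_of_nonneg
      (fun y => indicator_nonneg (fun _ _ => (Real.exp_pos _).le) y) hki).mpr ?_
    refine lt_of_lt_of_le (pos_iff_ne_zero.mpr hνε) (measure_mono fun y hy => ?_)
    rw [Function.mem_support, indicator_of_mem hy]
    exact (Real.exp_pos _).ne'
  set φ : ℝ := bernsteinReal k δ ν r
  have hφ : 0 ≤ φ := h.real_nonneg hr.le
  have hei := h.integrable_real hr.le
  -- the estimate for a fixed smoothing parameter
  have key : ∀ l : ℝ, 1 ≤ l → ∀ η : ℝ, 0 < η →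
      κ * u ε ≤ (φ + κ) * (u η + 5 / (η * (l + r))) := by
    intro l hl η hη
    have hL : 0 < l + r := by linarith
    obtain ⟨hJi, hJ⟩ := hjump l hl
    have hA : ∀ n, ∫ x, gammaKernel l n (x - 0) ∂μ = c * ∫ x, u x * gammaKernel (l + r) n x :=
      fun n => by
        rw [hμ _ (by fun_prop)]
        congr 2 with x
        rw [sub_zero, ← exp_mul_gammaKernel r]
        ring
    have hS : ∀ y, ∫ x, gammaKernel l 4 (x - y) ∂μ
        = c * ∫ x, Real.exp (-r * x) * u x * gammaKernel l 4 (x - y) := fun y =>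
      hμ _ (by fun_prop)
    set A := ∫ x, u x * gammaKernel (l + r) 4 x
    set B : ℝ := 1 / (l + r) ^ 5
    have hB : 0 < B := by positivity
    have hA4 : A ≤ (u η + 5 / (η * (l + r))) * B := by
      have := integral_mul_gammaKernel_le_of_pos hL (n := 4) (by norm_num) hu h0 h1 hm hη
      norm_num at this ⊢
      simpa [A, B] using this
    have hA3 : ∫ x, u x * gammaKernel (l + r) 3 x ≤ (l + r) * A :=
      integral_mul_gammaKernel_le hL (by norm_num) hu h0 h1 hm
    have hJle : ∫ y, (∫ x, gammaKernel l 4 (x - 0) ∂μ - ∫ x, gammaKernel l 4 (x - y) ∂μ) ∂ν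
        ≤ ∫ y, c * (A * (1 - Real.exp (-r * y))
          + (A - u ε * B) * (Ici ε).indicator (fun y => Real.exp (-r * y)) y) ∂ν := by
      refine integral_mono_ae hJi (((hei.const_mul _).add (hki.const_mul _)).const_mul _) ?_
      filter_upwards [h.ae_pos] with y hy
      rw [hA, hS, ← mul_sub]
      refine mul_le_mul_of_nonneg_left ?_ hc.le
      by_cases hyε : y ∈ Ici ε
      · rw [indicator_of_mem hyε]
        have := le_integral_shift r hL (n := 4) (by norm_num) hu h0 h1 (y := y)
          (v := fun _ => u ε) (by fun_prop) (fun _ => h0 _) (fun _ => h1 _)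
          (fun x hx => hm (by linarith [mem_Ici.mp hyε]))
        rw [integral_const_mul, integral_gammaKernel hL (by norm_num)] at this
        nlinarith
      · rw [indicator_of_notMem hyε]
        have := le_integral_shift r hL (n := 4) (by norm_num) hu h0 h1 (y := y)
          (v := u) hu h0 h1 (fun x hx => hm (by linarith))
        nlinarith
    rw [integral_const_mul, integral_add (hei.const_mul _) (hki.const_mul _), integral_const_mul,
      integral_const_mul] at hJle
    rw [hA, hA] at hJ
    have hδ := mul_le_mul_of_nonneg_left hA3 h.δ_nonneg
    have hφeq : φ = k + δ * r + ∫ y, (1 - Real.exp (-r * y)) ∂ν := rfl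
    have hfin : 0 ≤ c * (φ * A + (A - u ε * B) * κ) := by
      rw [hφeq]
      simp only [hA] at hJle
      nlinarith [mul_le_mul_of_nonneg_left hδ hc.le]
    have hfin' : 0 ≤ φ * A + (A - u ε * B) * κ := nonneg_of_mul_nonneg_right hfin hc
    have : κ * u ε * B ≤ (φ + κ) * (u η + 5 / (η * (l + r))) * B := by
      nlinarith [mul_le_mul_of_nonneg_left hA4 (by positivity : 0 ≤ φ + κ)]
    exact le_of_mul_le_mul_right this hB
  have hφκ : 0 < φ + κ := by linarith
  have hτ : 0 < κ * u ε / (4 * (φ + κ)) := by have := hpos ε hε; positivity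
  set τ := κ * u ε / (4 * (φ + κ))
  obtain ⟨η, hη, hητ⟩ : ∃ η : ℝ, 0 < η ∧ u η < τ := by
    have : Filter.Tendsto u (nhdsWithin 0 (Ioi 0)) (nhds 0) := by
      simpa [hu0] using (hu.tendsto 0).mono_left nhdsWithin_le_nhds
    obtain ⟨η, h2, h3⟩ := ((this.eventually (gt_mem_nhds hτ)).and self_mem_nhdsWithin).exists
    exact ⟨η, h3, h2⟩
  have hk := key (max 1 (5 / (η * τ))) (le_max_left _ _) η hη
  have h5 : 5 / (η * (max 1 (5 / (η * τ)) + r)) ≤ τ := by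
    rw [div_le_iff₀ (by positivity)]
    have : 5 / (η * τ) ≤ max 1 (5 / (η * τ)) + r := by linarith [le_max_right 1 (5 / (η * τ))]
    rw [div_le_iff₀ (by positivity)] at this
    linarith
  have hτ4 : (φ + κ) * τ = κ * u ε / 4 := by simp only [τ]; field_simp
  nlinarith [mul_le_mul_of_nonneg_left (add_le_add hητ.le h5) hφκ.le, mul_pos hκ (hpos ε hε)]

end

lemma integral_betaJump_eq {c α β γ : ℝ} (hβ : 0 < β) (hc : 0 < c) (hγ : γ < -1) {g : ℝ → ℝ}
    (hg : Continuous g) :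
    ∫ x, g x ∂betaJump c α β γ = c * ∫ x, Real.exp (-(β * (1 - α + γ)) * x)
      * max (1 - Real.exp (-β * x)) 0 ^ (-γ - 1) * g x := by
  have himg : (fun x : ℝ => Real.exp (-β * x)) '' Ioi 0 = Ioo 0 1 := by
    ext t
    constructor
    · rintro ⟨x, hx, rfl⟩
      refine ⟨Real.exp_pos _, Real.exp_lt_one_iff.mpr ?_⟩
      nlinarith [mul_pos hβ (mem_Ioi.mp hx)]
    · rintro ⟨h0, h1⟩
      refine ⟨-Real.log t / β, div_pos (neg_pos.mpr (Real.log_neg h0 h1)) hβ, ?_⟩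
      have : -β * (-Real.log t / β) = Real.log t := by field_simp
      simp only [this, Real.exp_log h0]
  have hinj : InjOn (fun x : ℝ => Real.exp (-β * x)) (Ioi 0) := fun x _ y _ hxy => by
    have := Real.exp_injective hxy
    nlinarith [mul_left_cancel₀ (neg_ne_zero.mpr hβ.ne') this]
  have hder : ∀ x ∈ Ioi (0 : ℝ), HasDerivWithinAt (fun x : ℝ => Real.exp (-β * x))
      (-β * Real.exp (-β * x)) (Ioi 0) x := fun x _ => by
    have := (((hasDerivAt_id x).const_mul (-β)).exp).hasDerivWithinAt (s := Ioi 0)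
    simpa [mul_comm] using this
  have hreal : ∫ x, g x ∂betaJump c α β γ = ∫ t in Ioo (0 : ℝ) 1,
      c / β * (t ^ (1 - α + γ - 1) * (1 - t) ^ (-γ - 1)) * g (-Real.log t / β) := by
    have := integral_betaJump (α := α) (γ := γ) hβ hc
      (g := fun x => (g x : ℂ)) (Complex.measurable_ofReal.comp hg.measurable)
    simp only [← Complex.ofReal_mul] at this
    rwa [integral_complex_ofReal, integral_complex_ofReal, Complex.ofReal_inj] at this
  rw [hreal, ← himg, integral_image_eq_integral_abs_deriv_smul measurableSet_Ioi hder hinj,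
    ← integral_const_mul, ← integral_indicator measurableSet_Ioi]
  refine integral_congr_ae (Filter.Eventually.of_forall fun x => ?_)
  simp only
  by_cases hx : x ∈ Ioi (0 : ℝ)
  · rw [indicator_of_mem hx]
    have h1 : Real.exp (-β * x) < 1 :=
      Real.exp_lt_one_iff.mpr (by nlinarith [mul_pos hβ (mem_Ioi.mp hx)])
    have h2 : -Real.log (Real.exp (-β * x)) / β = x := by rw [Real.log_exp]; field_simp
    have h3 : Real.exp (-β * x) * Real.exp (-β * x) ^ (1 - α + γ - 1)
        = Real.exp (-(β * (1 - α + γ)) * x) := by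
      rw [← Real.exp_mul, ← Real.exp_add]
      ring_nf
    rw [h2, max_eq_left (by linarith), abs_mul, abs_neg, abs_of_pos hβ,
      abs_of_pos (Real.exp_pos _), ← h3, smul_eq_mul]
    field_simp
  · rw [indicator_of_notMem hx]
    have h1 : 1 ≤ Real.exp (-β * x) :=
      Real.one_le_exp (by nlinarith [mul_nonneg hβ.le (neg_nonneg.mpr (not_lt.mp hx))])
    rw [max_eq_right (by linarith), Real.zero_rpow (by linarith)]
    simp

/-- No process has a hypergeometric exponent whose ascending jump density vanishes at the origin. -/
lemma not_exists_process_of_lt_neg_one {d σ k₁ δ₁ c₁ α₁ γ₁ k₂ δ₂ c₂ α₂ γ₂ β : ℝ} (hβ : 0 < β)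
    (hc₁ : 0 < c₁) (hc₂ : 0 < c₂) (hγ₁ : γ₁ < -1) (hγ₂ : γ₂ < 0 ∨ γ₂ ∈ Ioo (0 : ℝ) 1)
    (hα₁ : 0 < 1 - α₁ + γ₁) (hα₂ : 0 < 1 - α₂ + γ₂) (hδ₁ : 0 ≤ δ₁) (hδ₂ : 0 ≤ δ₂)
    (hk₁ : 0 ≤ k₁) (hk₂ : 0 ≤ k₂)
    {Ω : Type*} [MeasurableSpace Ω] {P : Measure Ω} [IsProbabilityMeasure P] {X : ℝ → Ω → ℝ}
    (hX : ∀ t, Measurable (X t))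
    (hchar : ∀ θ t : ℝ, 0 ≤ t → ∫ ω, Complex.exp (Complex.I * θ * X t ω) ∂P
      = Complex.exp (-(t : ℂ) * GHExponent d σ k₁ δ₁ c₁ α₁ γ₁ k₂ δ₂ c₂ α₂ γ₂ β θ)) : False := by
  obtain ⟨ν, hν⟩ := exists_bernsteinRep hβ hc₂ hα₂ hγ₂ hk₂ hδ₂
  have h₁ := bernsteinRep_betaJump hβ hc₁ hα₁ (by linarith : γ₁ < 0) hk₁ hδ₁
  have := isFiniteMeasure_betaJump (c := c₁) (β := β) hα₁ (by linarith : γ₁ < 0)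
  have hcont₁ : Continuous fun θ : ℝ =>
      betaSubLaplaceExponent k₁ δ₁ c₁ α₁ β γ₁ (-Complex.I * θ) :=
    continuous_iff_continuousAt.mpr fun θ =>
      ContinuousAt.comp (f := fun θ : ℝ => -Complex.I * (θ : ℂ))
      (betaSub_differentiableAt_of_re hβ (by simpa using mul_pos hβ hα₁)).continuousAt
      (by fun_prop)
  have hcont₂ : Continuous fun θ : ℝ =>
      betaSubLaplaceExponent k₂ δ₂ c₂ α₂ β γ₂ (Complex.I * θ) :=
    continuous_iff_continuousAt.mpr fun θ =>
      ContinuousAt.comp (f := fun θ : ℝ => Complex.I * (θ : ℂ))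
      (betaSub_differentiableAt_of_re hβ (by simpa using mul_pos hβ hα₂)).continuousAt
      (by fun_prop)
  have hexp : ∀ {x y : ℝ}, x ≤ y → 1 - Real.exp (-β * x) ≤ 1 - Real.exp (-β * y) := fun hxy => by
    have := Real.exp_le_exp.mpr (mul_le_mul_of_nonneg_left hxy hβ.le |> neg_le_neg)
    simp only [neg_mul]
    linarith
  refine hν.not_jump_nonneg (μ := betaJump c₁ α₁ β γ₁) hc₁ (mul_pos hβ hα₁)
    (u := fun x => max (1 - Real.exp (-β * x)) 0 ^ (-γ₁ - 1)) ?_ ?_ ?_ ?_ ?_ ?_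
    (fun g hg => integral_betaJump_eq hβ hc₁ hγ₁ hg) fun l hl =>
      ⟨(hν.integral_mul_transform (n := 2) hl _).1, h₁.jump_nonneg hν hcont₁ hcont₂ hX hchar hl⟩
  · exact Continuous.rpow_const (by fun_prop) fun x => Or.inr (by linarith)
  · exact fun x => Real.rpow_nonneg (le_max_right _ _) _
  · exact fun x => Real.rpow_le_one (le_max_right _ _)
      (max_le (by linarith [Real.exp_pos (-β * x)]) zero_le_one) (by linarith)
  · exact fun x y hxy => Real.rpow_le_rpow (le_max_right _ _)
      (max_le_max_right _ (hexp hxy)) (by linarith)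
  · simp [Real.zero_rpow (by linarith : -γ₁ - 1 ≠ 0)]
  · intro x hx
    refine Real.rpow_pos_of_pos (lt_max_of_lt_left ?_) _
    have : Real.exp (-β * x) < 1 := Real.exp_lt_one_iff.mpr (by nlinarith [mul_pos hβ hx])
    linarith

lemma add_GHExponent_eq_complexExponent {q d σ k₁ δ₁ c₁ α₁ γ₁ k₂ δ₂ c₂ α₂ γ₂ β : ℝ} (hβ : 0 < β)
    (hα₁ : 0 < 1 - α₁ + γ₁) (h0 : γ₁ ≠ 0) (h1 : γ₁ < 1) (h2 : -1 ≤ γ₁) {z s : ℂ}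
    (hz : Complex.I * z = s) (hs : ∀ n, s ≠ betaPole α₁ β γ₁ n) :
    (q : ℂ) + GHExponent d σ k₁ δ₁ c₁ α₁ γ₁ k₂ δ₂ c₂ α₂ γ₂ β z
      = complexExponent q d σ k₁ δ₁ (betaWeight c₁ α₁ β γ₁) (betaPole α₁ β γ₁)
          (betaSubLaplaceExponent k₂ δ₂ c₂ α₂ β γ₂) s := by
  rw [GHExponent, complexExponent, ← betaSub_neg_eq hβ hα₁ h0 h1 h2 hs, ← hz, neg_mul]
  linear_combination ((σ : ℂ) ^ 2 * z ^ 2 / 2) * Complex.I_sq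

/-- The law of the supremum at an independent exponential time, in terms of interlacing zeros and
poles of the exponent. -/
lemma map_supAt_apply {Ω : Type*} [MeasurableSpace Ω] {P : Measure Ω} [IsProbabilityMeasure P]
    {d σ k₁ δ₁ c₁ α₁ γ₁ k₂ δ₂ c₂ α₂ γ₂ β : ℝ} (hβ : 0 < β) (hc₁ : 0 < c₁) (hc₂ : 0 < c₂)
    (hγ₁ : γ₁ < 0 ∨ γ₁ ∈ Ioo (0 : ℝ) 1) (hγ₂ : γ₂ < 0 ∨ γ₂ ∈ Ioo (0 : ℝ) 1)
    (hα₁ : 0 < 1 - α₁ + γ₁) (hα₂ : 0 < 1 - α₂ + γ₂) (hδ₁ : 0 ≤ δ₁) (hδ₂ : 0 ≤ δ₂)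
    (hk₁ : 0 ≤ k₁) (hk₂ : 0 ≤ k₂) {X : ℝ → Ω → ℝ} (hX : IsLevyProcess P X)
    (hchar : ∀ θ t : ℝ, 0 ≤ t → ∫ ω, Complex.exp (Complex.I * θ * X t ω) ∂P
      = Complex.exp (-(t : ℂ) * GHExponent d σ k₁ δ₁ c₁ α₁ γ₁ k₂ δ₂ c₂ α₂ γ₂ β θ))
    {q : ℝ} (hq : 0 < q) {ζ : ℕ → ℝ} (hI : Interlacing ζ (betaPole α₁ β γ₁))
    (hroot : ∀ n, (q : ℂ)
      + GHExponent d σ k₁ δ₁ c₁ α₁ γ₁ k₂ δ₂ c₂ α₂ γ₂ β (-(Complex.I * ζ n)) = 0)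
    {E : Ω → ℝ} (hE : Measurable E) (hE_law : Measure.map E P = expMeasure q)
    (hE_indep : IndepFun E (fun ω => (fun t : ℝ => X t ω)) P) {A : Set ℝ} (hA : MeasurableSet A)
    (hA0 : A ⊆ Ioi 0) :
    P.map (supAt X E) A = ENNReal.ofReal (∫ x in A,
      ∑' k, Interlacing.coeff ζ (betaPole α₁ β γ₁) k * ζ k * Real.exp (-ζ k * x)) := by
  have h2 : -1 ≤ γ₁ := by
    by_contra! h
    exact not_exists_process_of_lt_neg_one hβ hc₁ hc₂ h hγ₂ hα₁ hα₂ hδ₁ hδ₂ hk₁ hk₂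
      hX.measurable hchar
  have h0 : γ₁ ≠ 0 := by rcases hγ₁ with h | h; exacts [h.ne, h.1.ne']
  have h1 : γ₁ < 1 := by rcases hγ₁ with h | h; exacts [by linarith, h.2]
  obtain ⟨ν, hν⟩ := exists_bernsteinRep hβ hc₂ hα₂ hγ₂ hk₂ hδ₂
  have hXn := hX.neg
  have : IsProbabilityMeasure (P.map (supAt X E)) :=
    Measure.isProbabilityMeasure_map (hX.aemeasurable_supAt hq hE hE_law)
  have : IsProbabilityMeasure (P.map (supAt (fun t ω => -X t ω) E)) :=
    Measure.isProbabilityMeasure_map (hXn.aemeasurable_supAt hq hE hE_law)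
  have hS := hX.ae_supAt_nonneg hq hE hE_law
  have hT := hXn.ae_supAt_nonneg hq hE hE_law
  obtain ⟨hwh, C, hC⟩ := hX.wienerHopf hq hE hE_law hE_indep
    (Ψ := fun θ => GHExponent d σ k₁ δ₁ c₁ α₁ γ₁ k₂ δ₂ c₂ α₂ γ₂ β θ) hchar
  refine apply_eq_of_charFun hI _ (fun θ => ?_) hA hA0
  rw [← complexMGF_id_mul_I]
  refine factor_eq_interlacingQuotient (q := q) (d := d) (σ := σ) (k₁ := k₁) (δ₁ := δ₁)
    (m := fun s => complexMGF id (P.map (supAt (fun t ω => -X t ω) E)) (-s))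
    hq hk₁ hδ₁ (cauchyData_beta hβ hc₁ hα₁ h0 h1 h2) hν hI
    (fun z hz => betaSub_differentiableAt_of_re hβ (by nlinarith [mul_pos hβ hα₂]))
    (fun n => ?_) (continuousOn_complexMGF hS)
    (fun s hs => differentiableAt_complexMGF_of_re_neg hS hs) hC complexMGF_id_zero
    (fun x hx => exists_ofReal_complexMGF hS hx) ?_ (fun s hs => ?_)
    (fun s hs => norm_complexMGF_le_one hT (by simpa using hs)) (fun x hx => ?_)
    (fun s hs => ?_) (by simp)
  · rw [← hroot n, add_GHExponent_eq_complexExponent hβ hα₁ h0 h1 h2 (s := ζ n)]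
    · linear_combination -(ζ n : ℂ) * Complex.I_sq
    · intro m hm
      rw [Complex.ofReal_inj] at hm
      rcases lt_or_ge m n with h | h
      · have := hI.lt_succ m
        have := hI.strictMono.monotone (show m + 1 ≤ n from h)
        linarith
      · have := hI.lt m
        have := hI.strictMono.monotone h
        linarith
  · exact (continuousOn_complexMGF hT).comp (by fun_prop) fun s hs => by simpa using hs
  · exact (differentiableAt_complexMGF_of_re_neg hT (by simpa using hs)).comp s (by fun_prop)
  · obtain ⟨y, hy, h⟩ := exists_ofReal_complexMGF hT (neg_nonpos.mpr hx)
    exact ⟨y, hy.le, by simpa using h⟩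
  · have hs' : (s.im : ℂ) * Complex.I = s := Complex.ext (by simp [hs]) (by simp)
    have := hwh s.im
    rw [hs', add_GHExponent_eq_complexExponent hβ hα₁ h0 h1 h2
      (s := s) (by rw [mul_comm, hs'])] at this
    · exact this
    · intro n hn
      have := betaPole_pos hβ hα₁ n
      rw [hn, Complex.ofReal_re] at hs
      linarith

/-- **Law of the running supremum at an independent exponential time for General
Hypergeometric Lévy processes (Theorem 3, distributional part).**  With `(ξₙ⁻)`
the roots of `q + Ψ(iξ) = 0` on the negative axis and `c_k⁻` the associated
infinite-product coefficients,
`P(sup_{0≤s≤e} X_s ∈ A) = ∫_A (−∑_k c_k⁻ ξ_k⁻ e^{ξ_k⁻ x}) dx` for Borel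
`A ⊆ (0,∞)`, where `e ∼ Exp(q)` is independent of `X`. -/
theorem GH_law_of_supremum
    {Ω : Type*} [MeasurableSpace Ω] (P : Measure Ω) [IsProbabilityMeasure P]
    (d σ k₁ δ₁ c₁ α₁ γ₁ k₂ δ₂ c₂ α₂ γ₂ β : ℝ)
    (hβ : 0 < β) (hc₁ : 0 < c₁) (hc₂ : 0 < c₂)
    (hγ₁ : γ₁ < 0 ∨ γ₁ ∈ Ioo (0 : ℝ) 1) (hγ₂ : γ₂ < 0 ∨ γ₂ ∈ Ioo (0 : ℝ) 1)
    (hα₁ : 0 < 1 - α₁ + γ₁) (hα₂ : 0 < 1 - α₂ + γ₂)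
    (hδ₁ : 0 ≤ δ₁) (hδ₂ : 0 ≤ δ₂)
    (hk₁ : 0 ≤ k₁) (hk₂ : 0 ≤ k₂) (hk : k₁ * k₂ = 0)
    (X : ℝ → Ω → ℝ) (hX : IsLevyProcess P X)
    -- `X` has characteristic exponent `Ψ`
    (hchar : ∀ θ : ℝ, ∀ t : ℝ, 0 ≤ t →
      ∫ ω, Complex.exp (Complex.I * θ * X t ω) ∂P =
        Complex.exp (-(t : ℂ) * GHExponent d σ k₁ δ₁ c₁ α₁ γ₁ k₂ δ₂ c₂ α₂ γ₂ β θ))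
    (q : ℝ) (hq : 0 < q)
    -- the roots `ξₙ⁻` on the negative imaginary axis
    (ξ : ℕ → ℝ)
    (hξ0 : ξ 0 ∈ Ioo (-(β * (1 + γ₁ - α₁))) 0)
    (hξ : ∀ n : ℕ, 1 ≤ n →
      ξ n ∈ Ioo (-(β * (1 + γ₁ - α₁ + n))) (-(β * (γ₁ - α₁ + n))))
    (hroot : ∀ n : ℕ, (q : ℂ)
      + GHExponent d σ k₁ δ₁ c₁ α₁ γ₁ k₂ δ₂ c₂ α₂ γ₂ β (Complex.I * ξ n) = 0)
    -- the coefficients `c_k⁻`, given by convergent infinite products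
    (c : ℕ → ℝ)
    (hc0 : c 0 = ∏' m : ℕ,
      (1 + ξ 0 / (β * (γ₁ - α₁ + ((m : ℝ) + 1)))) / (1 - ξ 0 / ξ (m + 1)))
    (hck : ∀ j : ℕ, 1 ≤ j → c j =
      (1 + ξ j / (β * (γ₁ - α₁ + j))) / (1 - ξ j / ξ 0) *
        ∏' m : {m : ℕ // 1 ≤ m ∧ m ≠ j},
          (1 + ξ j / (β * (γ₁ - α₁ + (m : ℝ)))) / (1 - ξ j / ξ m))
    -- an exponential random variable with rate `q`, independent of `X`
    (E : Ω → ℝ) (hE_meas : Measurable E)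
    (hE_law : Measure.map E P = expMeasure q)
    (hE_indep : IndepFun E (fun ω => (fun t : ℝ => X t ω)) P) :
    (Multipliable fun m : ℕ =>
        (1 + ξ 0 / (β * (γ₁ - α₁ + ((m : ℝ) + 1)))) / (1 - ξ 0 / ξ (m + 1))) ∧
    (∀ j : ℕ, 1 ≤ j → Multipliable fun m : {m : ℕ // 1 ≤ m ∧ m ≠ j} =>
        (1 + ξ j / (β * (γ₁ - α₁ + (m : ℝ)))) / (1 - ξ j / ξ m)) ∧
    ∀ A : Set ℝ, MeasurableSet A → A ⊆ Ioi 0 →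
      Measure.map (fun ω => sSup ((fun s => X s ω) '' Icc 0 (E ω))) P A
        = ENNReal.ofReal
            (∫ x in A, -(∑' j : ℕ, c j * ξ j * Real.exp (ξ j * x))) := by
  set ζ : ℕ → ℝ := fun n => -ξ n with hζ
  set r : ℕ → ℝ := betaPole α₁ β γ₁ with hr
  have hI : Interlacing ζ r :=
    { zero_pos := neg_pos.mpr hξ0.2
      lt := fun n => by
        rcases Nat.eq_zero_or_pos n with rfl | hn
        · have := hξ0.1
          simp only [hζ, hr, betaPole, Nat.cast_zero]
          nlinarith
        · have := (hξ n hn).1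
          simp only [hζ, hr, betaPole]
          nlinarith
      lt_succ := fun n => by
        have := (hξ (n + 1) (by omega)).2
        push_cast at this
        simp only [hζ, hr, betaPole]
        nlinarith
      tendsto := (Filter.tendsto_atTop_add_const_left _ _
        tendsto_natCast_atTop_atTop).const_mul_atTop hβ }
  have hfac : ∀ j m n : ℕ, skipIndex j m = n → interlacingFactor ζ r j m
      = (1 + ξ j / (β * (γ₁ - α₁ + ((m : ℝ) + 1)))) / (1 - ξ j / ξ n) := fun j m n h => by
    have : r m = β * (γ₁ - α₁ + ((m : ℝ) + 1)) := by simp only [hr, betaPole]; ring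
    rw [interlacingFactor, h, this]
    simp only [hζ]
    rw [neg_div, sub_neg_eq_add, neg_div_neg_eq]
  have hfac0 : (interlacingFactor ζ r 0) = fun m : ℕ =>
      (1 + ξ 0 / (β * (γ₁ - α₁ + ((m : ℝ) + 1)))) / (1 - ξ 0 / ξ (m + 1)) :=
    funext fun m => hfac 0 m (m + 1) (by simp [skipIndex])
  let g : ℕ → ℕ → ℝ := fun j m => (1 + ξ j / (β * (γ₁ - α₁ + (m : ℝ)))) / (1 - ξ j / ξ m)
  have hg : ∀ j m : ℕ, m + 1 ≠ j → g j (m + 1) = interlacingFactor ζ r j m := fun j m h => by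
    rw [hfac j m (m + 1) (by simp [skipIndex, h])]
    simp only [g, Nat.cast_add, Nat.cast_one]
  have hcoeff : ∀ j, c j = Interlacing.coeff ζ r j := fun j => by
    rcases Nat.eq_zero_or_pos j with rfl | hj
    · rw [hc0, Interlacing.coeff, hfac0]
    · rw [hck j hj, hI.coeff_eq_mul_tprod_subtype (hg j) hj,
        hfac j (j - 1) 0 (by simp [skipIndex, Nat.sub_add_cancel hj])]
      simp only [g, Nat.cast_sub hj, Nat.cast_one, sub_add_cancel]
  refine ⟨hfac0 ▸ hI.multipliable_factor 0,
    fun j hj => hI.multipliable_subtype (hg j) hj, fun A hA hA0 => ?_⟩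
  have := map_supAt_apply hβ hc₁ hc₂ hγ₁ hγ₂ hα₁ hα₂ hδ₁ hδ₂ hk₁ hk₂ hX hchar hq hI
    (fun n => by simpa [hζ] using hroot n) hE_meas hE_law hE_indep hA hA0
  refine this.trans (congrArg ENNReal.ofReal (integral_congr_ae
    (Filter.Eventually.of_forall fun x => ?_)))
  simp only [← tsum_neg]
  refine tsum_congr fun j => ?_
  rw [hcoeff]
  simp only [hζ, neg_neg]
  ring

end
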